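/- arXiv:1912.03396 — 2 statements merged into one kernel-verified Lean document; each statement's English description precedes it below -/
import Mathlib

section
/- Let G be a planar near-triangulation and let e = ab be a fixed edge on the outer cycle of G. Let v_1, …, v_k be the vertices of the outer cycle other than a and b, and let u_1, …, u_l be the interior vertices of G. Define the reference monomial R_{G−e} = v_1²v_2²⋯v_k² · u_1⁴u_2⁴⋯u_l⁴. Then the Laurent polynomial Z_{G−e} = Q_{G−e} · R_{G−e} is good; equivalently, the graph polynomial P_{G−e} contains a nonvanishing monomial N with (i) deg_a(N) = deg_b(N) = 0, (ii) deg_{v_i}(N) ≤ 2 for every other vertex v_i of the outer cycle, and (iii) deg_{u_j}(N) ≤ 4 for every interior vertex u_j. -/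
open MvPolynomial

noncomputable def graphPoly {V : Type} [Fintype V] [DecidableEq V] [LinearOrder V]
    (G : SimpleGraph V) : MvPolynomial V ℤ :=
  letI : Fintype G.edgeSet := Fintype.ofFinite _
  ∏ e ∈ G.edgeFinset,
    Sym2.lift ⟨fun a b => (X (min a b) : MvPolynomial V ℤ) - X (max a b),
      fun a b => by simp only [min_comm a b, max_comm a b]⟩ e

/-- The dart-reversal involution of a simple graph, as a permutation of darts. -/
def dartRev {V : Type} (G : SimpleGraph V) : Equiv.Perm G.Dart :=
  ⟨SimpleGraph.Dart.symm, SimpleGraph.Dart.symm,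
    fun d => SimpleGraph.Dart.symm_symm d, fun d => SimpleGraph.Dart.symm_symm d⟩

/-- A rotation system (combinatorial embedding) on a simple graph: a permutation of the
darts which fixes the tail of each dart and acts transitively (cyclically) on the darts
emanating from any fixed vertex. -/
structure RotationSystem {V : Type} (G : SimpleGraph V) where
  rot : Equiv.Perm G.Dart
  rot_fst : ∀ d : G.Dart, (rot d).fst = d.fst
  rot_cyclic : ∀ d d' : G.Dart, d.fst = d'.fst → ∃ n : ℕ, rot^[n] d = d'

namespace RotationSystem

variable {V : Type} {G : SimpleGraph V}

/-- The face permutation of the rotation system: first reverse a dart, then rotate. -/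
def faceMap (S : RotationSystem G) : Equiv.Perm G.Dart :=
  (dartRev G).trans S.rot

/-- Two darts are equivalent iff they lie on the same face, i.e. in the same orbit of the
face permutation. -/
def faceSetoid (S : RotationSystem G) : Setoid G.Dart where
  r d d' := ∃ n : ℤ, (S.faceMap ^ n) d = d'
  iseqv := by
    constructor
    · exact fun d => ⟨0, by simp⟩
    · rintro d d' ⟨n, rfl⟩
      exact ⟨-n, by rw [← Equiv.Perm.mul_apply, ← zpow_add, neg_add_cancel, zpow_zero,
        Equiv.Perm.one_apply]⟩
    · rintro d d' d'' ⟨m, rfl⟩ ⟨n, rfl⟩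
      exact ⟨n + m, by rw [← Equiv.Perm.mul_apply, ← zpow_add]⟩

/-- The faces of a rotation system: orbits of the face permutation on darts. -/
def Face (S : RotationSystem G) : Type := Quotient S.faceSetoid

/-- The face containing a given dart. -/
def faceOf (S : RotationSystem G) (d : G.Dart) : S.Face := Quotient.mk S.faceSetoid d

/-- The size (number of darts) of a face. -/
noncomputable def faceSize (S : RotationSystem G) (F : S.Face) : ℕ :=
  Nat.card {d : G.Dart // S.faceOf d = F}

/-- The vertices on (the boundary of) a face. -/
def faceVerts (S : RotationSystem G) (F : S.Face) : Set V :=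
  {v | ∃ d : G.Dart, S.faceOf d = F ∧ d.fst = v}

/-- The edges on (the boundary of) a face. -/
def faceEdges (S : RotationSystem G) (F : S.Face) : Set (Sym2 V) :=
  {e | ∃ d : G.Dart, S.faceOf d = F ∧ d.edge = e}

/-- A rotation system on a finite graph is a plane embedding when the graph is connected
and Euler's formula `|V| - |E| + |F| = 2` holds. -/
def IsPlane [Fintype V] (S : RotationSystem G) : Prop :=
  G.Connected ∧ Fintype.card V + Nat.card S.Face = Nat.card G.edgeSet + 2

end RotationSystem

/-- A finite graph is 2-connected if it has at least 3 vertices and deleting any single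
vertex leaves it connected. -/
def TwoConnected {V : Type} [Fintype V] (G : SimpleGraph V) : Prop :=
  3 ≤ Fintype.card V ∧ ∀ v : V, ((⊤ : G.Subgraph).deleteVerts {v}).coe.Connected

/-- A plane near-triangulation: a 2-connected plane graph together with a distinguished
(outer) face such that every other (bounded) face is a triangle. -/
def IsNearTriangulation {V : Type} [Fintype V] {G : SimpleGraph V}
    (S : RotationSystem G) (outer : S.Face) : Prop :=
  S.IsPlane ∧ TwoConnected G ∧ ∀ F : S.Face, F ≠ outer → S.faceSize F = 3

section EdgePolynomials

variable {V : Type} [LinearOrder V]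

/-- The factor `± (x - y)` contributed by an edge `xy` to the graph polynomial. -/
noncomputable def edgeDiff (e : Sym2 V) : MvPolynomial V ℤ :=
  Sym2.lift ⟨fun a b => (X (min a b) : MvPolynomial V ℤ) - X (max a b),
      fun a b => by simp only [min_comm a b, max_comm a b]⟩ e

/-- The graph polynomial of a finite set of edges. -/
noncomputable def edgesPoly (E : Finset (Sym2 V)) : MvPolynomial V ℤ := ∏ e ∈ E, edgeDiff e

theorem edgeDiff_mk (x y : V) :
    edgeDiff s(x, y) = X x - X y ∨ edgeDiff s(x, y) = -(X x - X y) := by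
  rcases le_total x y with h | h
  · left; simp [edgeDiff, h]
  · right; simp [edgeDiff, h]

theorem edgeDiff_isHomogeneous (e : Sym2 V) : (edgeDiff e).IsHomogeneous 1 := by
  induction e with
  | _ x y => exact (isHomogeneous_X _ _).sub (isHomogeneous_X _ _)

theorem edgesPoly_isHomogeneous (E : Finset (Sym2 V)) :
    (edgesPoly E).IsHomogeneous E.card := by
  have := IsHomogeneous.prod E (fun e => edgeDiff e) (fun _ => 1)
    (fun e _ => edgeDiff_isHomogeneous e)
  simpa [edgesPoly] using this

theorem degree_eq_card {E : Finset (Sym2 V)} {m : V →₀ ℕ} (h : coeff m (edgesPoly E) ≠ 0) :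
    m.degree = E.card := by
  by_contra hne
  exact h ((edgesPoly_isHomogeneous E).coeff_eq_zero hne)

theorem exponent_eq_zero {E : Finset (Sym2 V)} {m : V →₀ ℕ} (h : coeff m (edgesPoly E) ≠ 0)
    {v : V} (hv : ∀ e ∈ E, v ∉ e) : m v = 0 := by
  have h1 : m v ≤ degreeOf v (edgesPoly E) := by
    rw [degreeOf_eq_sup]
    exact Finset.le_sup (f := fun m : V →₀ ℕ => m v) (mem_support_iff.2 h)
  have h2 : degreeOf v (edgesPoly E) ≤ ∑ e ∈ E, degreeOf v (edgeDiff e) := degreeOf_prod_le _ _ _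
  have h3 : ∑ e ∈ E, degreeOf v (edgeDiff e) = 0 := by
    refine Finset.sum_eq_zero fun e he => ?_
    have := hv e he
    induction e with
    | _ x y =>
      simp only [Sym2.mem_iff, not_or] at this
      have hmin : v ≠ min x y := by rcases min_choice x y with h | h <;> rw [h] <;> tauto
      have hmax : v ≠ max x y := by rcases max_choice x y with h | h <;> rw [h] <;> tauto
      have : degreeOf v ((X (min x y) : MvPolynomial V ℤ) - X (max x y)) ≤ 0 := by
        refine (degreeOf_sub_le _ _ _).trans ?_
        simp [degreeOf_X, hmin, hmax]
      simpa [edgeDiff] using this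
  omega

/-- Monomials of two edge-disjoint graphs meeting in two vertices multiply to a monomial of the
union, provided the second one avoids the two common vertices. -/
theorem coeff_add_ne_zero {E₁ E₂ : Finset (Sym2 V)} (hd : Disjoint E₁ E₂) {x y : V}
    (hV : ∀ q, (∃ e ∈ E₁, q ∈ e) → (∃ e ∈ E₂, q ∈ e) → q = x ∨ q = y)
    {m₁ m₂ : V →₀ ℕ} (h₁ : coeff m₁ (edgesPoly E₁) ≠ 0) (h₂ : coeff m₂ (edgesPoly E₂) ≠ 0)
    (hx : m₂ x = 0) (hy : m₂ y = 0) :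
    coeff (m₁ + m₂) (edgesPoly (E₁ ∪ E₂)) ≠ 0 := by
  have hprod : edgesPoly (E₁ ∪ E₂) = edgesPoly E₁ * edgesPoly E₂ := Finset.prod_union hd
  rw [hprod, coeff_mul, Finset.sum_eq_single (m₁, m₂)]
  · exact mul_ne_zero h₁ h₂
  · rintro ⟨p₁, p₂⟩ hp hne
    by_contra hcon
    have hp₁ : coeff p₁ (edgesPoly E₁) ≠ 0 := left_ne_zero_of_mul hcon
    have hp₂ : coeff p₂ (edgesPoly E₂) ≠ 0 := right_ne_zero_of_mul hcon
    rw [Finset.HasAntidiagonal.mem_antidiagonal] at hp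
    simp only at hp
    have hle : m₂ ≤ p₂ := by
      intro q
      have hq : p₁ q + p₂ q = m₁ q + m₂ q := DFunLike.congr_fun hp q
      by_cases hq₁ : ∃ e ∈ E₁, q ∈ e
      · by_cases hq₂ : ∃ e ∈ E₂, q ∈ e
        · rcases hV q hq₁ hq₂ with rfl | rfl <;> omega
        · push Not at hq₂
          rw [exponent_eq_zero h₂ hq₂]; exact Nat.zero_le _
      · push Not at hq₁
        have := exponent_eq_zero h₁ hq₁
        have := exponent_eq_zero hp₁ hq₁
        omega
    obtain ⟨k, rfl⟩ := exists_add_of_le hle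
    have hk : k = 0 := by
      have := degree_eq_card hp₂
      rw [map_add, degree_eq_card h₂] at this
      exact (Finsupp.degree_eq_zero_iff k).1 (by omega)
    subst hk
    apply hne
    simp only [add_zero] at hp ⊢
    rw [add_right_cancel hp]
  · intro h
    simp at h

theorem coeff_edgeDiff_mul_ne_zero_iff (x y : V) (m : V →₀ ℕ) (Q : MvPolynomial V ℤ) :
    coeff m (edgeDiff s(x, y) * Q) ≠ 0 ↔ coeff m (X x * Q) - coeff m (X y * Q) ≠ 0 := by
  rcases edgeDiff_mk x y with h | h
  · rw [h, sub_mul, coeff_sub]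
  · rw [h, neg_mul, coeff_neg, neg_ne_zero, sub_mul, coeff_sub]

theorem coeff_add_single_edgeDiff_mul {x y : V} (hxy : x ≠ y) {m : V →₀ ℕ} (hm : m x = 0)
    (Q : MvPolynomial V ℤ) :
    coeff (m + Finsupp.single y 1) (edgeDiff s(x, y) * Q) ≠ 0 ↔ coeff m Q ≠ 0 := by
  rw [coeff_edgeDiff_mul_ne_zero_iff, coeff_X_mul', coeff_X_mul']
  simp [hm, hxy]

theorem coeff_add_single_add_single_edgeDiff_mul (x y : V) (m : V →₀ ℕ)
    (Q : MvPolynomial V ℤ) :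
    coeff (m + Finsupp.single x 1 + Finsupp.single y 1) (edgeDiff s(x, y) * Q) ≠ 0 ↔
      coeff (m + Finsupp.single y 1) Q - coeff (m + Finsupp.single x 1) Q ≠ 0 := by
  have : m + Finsupp.single x 1 + Finsupp.single y 1 =
    m + Finsupp.single y 1 + Finsupp.single x 1 := add_right_comm _ _ _
  rw [coeff_edgeDiff_mul_ne_zero_iff, mul_comm (X y), coeff_mul_X, this, mul_comm (X x),
    coeff_mul_X]

/-- The product of the edge factors of the star with centre `v` and leaves `l`. -/
noncomputable def starPoly (v : V) (l : List V) : MvPolynomial V ℤ :=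
  (l.map fun n => edgeDiff s(v, n)).prod

/-- The monomial `∏ x`, `x ∈ l`, as an exponent vector. -/
noncomputable def listMonomial {V : Type} (l : List V) : V →₀ ℕ :=
  (l.map fun n => Finsupp.single n 1).sum

theorem listMonomial_apply (l : List V) (x : V) : listMonomial l x = l.count x := by
  induction l with
  | nil => simp [listMonomial]
  | cons y l ih =>
    have : listMonomial (y :: l) = Finsupp.single y 1 + listMonomial l := by simp [listMonomial]
    rw [this, Finsupp.add_apply, ih, List.count_cons, Finsupp.single_apply, add_comm]
    simp

theorem listMonomial_cons {V : Type} (y : V) (l : List V) :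
    listMonomial (y :: l) = listMonomial l + Finsupp.single y 1 := by
  simp [listMonomial, add_comm]

theorem starPoly_cons (v y : V) (l : List V) :
    starPoly v (y :: l) = edgeDiff s(v, y) * starPoly v l := by
  simp [starPoly]

theorem coeff_add_listMonomial {v : V} {l : List V} (hl : v ∉ l) {m : V →₀ ℕ} (hm : m v = 0)
    (Q : MvPolynomial V ℤ) :
    coeff (m + listMonomial l) (starPoly v l * Q) ≠ 0 ↔ coeff m Q ≠ 0 := by
  induction l with
  | nil => simp [starPoly, listMonomial]
  | cons y l ih =>
    simp only [List.mem_cons, not_or] at hl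
    rw [listMonomial_cons, starPoly_cons, ← add_assoc, mul_assoc,
      coeff_add_single_edgeDiff_mul hl.1, ih hl.2]
    simp [hm, listMonomial_apply, List.count_eq_zero.2 hl.2]

theorem exists_of_coeff_add_single_add_listMonomial {v : V} {l : List V} (hl : v ∉ l)
    {m : V →₀ ℕ} (hm : m v = 0) {Q : MvPolynomial V ℤ}
    (h : coeff (m + Finsupp.single v 1 + listMonomial l) (starPoly v l * Q) ≠ 0) :
    coeff (m + Finsupp.single v 1) Q ≠ 0 ∨ ∃ u ∈ l, coeff (m + Finsupp.single u 1) Q ≠ 0 := by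
  induction l with
  | nil => left; simpa [starPoly, listMonomial] using h
  | cons y l ih =>
    simp only [List.mem_cons, not_or] at hl
    have e : m + Finsupp.single v 1 + listMonomial (y :: l) =
        (m + listMonomial l) + Finsupp.single v 1 + Finsupp.single y 1 := by
      rw [listMonomial_cons]; abel
    rw [e, starPoly_cons, mul_assoc, coeff_add_single_add_single_edgeDiff_mul] at h
    by_cases h1 : coeff (m + listMonomial l + Finsupp.single y 1) (starPoly v l * Q) ≠ 0
    · rw [add_right_comm, coeff_add_listMonomial hl.2 (by simp [hm, Ne.symm hl.1])] at h1
      exact Or.inr ⟨y, by simp, h1⟩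
    · have h2 : coeff (m + Finsupp.single v 1 + listMonomial l) (starPoly v l * Q) ≠ 0 := by
        rw [add_right_comm]
        intro h0
        rw [h0] at h
        exact h1 (by simpa using h)
      rcases ih hl.2 h2 with h3 | ⟨u, hu, h3⟩
      · exact Or.inl h3
      · exact Or.inr ⟨u, by simp [hu], h3⟩

/-- Adding a vertex `v` joined to `a`, to `w` and to the list `us`. -/
theorem exists_coeff_star_ne_zero {v a w b : V} {us : List V} {Q : MvPolynomial V ℤ}
    (hQ : ∀ m, coeff m Q ≠ 0 → m v = 0)
    (hnd : (v :: a :: (us ++ [w])).Nodup) (hab : a ≠ b) (hvb : v ≠ b) (hbus : b ∉ us)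
    {m : V →₀ ℕ} (hm : coeff m Q ≠ 0) (ha : m a = 0) (hb : m b = 0) (hw : m w ≤ 2)
    (hus : ∀ u ∈ us, m u ≤ 2) :
    ∃ m' : V →₀ ℕ, coeff m' (starPoly v (a :: w :: us) * Q) ≠ 0 ∧ m' a = 0 ∧ m' b = 0 ∧
      m' v ≤ 2 ∧ m' w ≤ 2 ∧ (∀ u ∈ us, m' u ≤ 4) ∧
      ∀ x, x ≠ v → x ≠ w → x ∉ us → m' x = m x := by
  have hmv := hQ m hm
  simp only [List.nodup_cons, List.mem_cons, List.mem_append, List.not_mem_nil, or_false,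
    List.nodup_append, not_or, List.nodup_nil] at hnd
  obtain ⟨⟨hva, hvus, hvw⟩, ⟨haus, haw⟩, hndus, -, hdis⟩ := hnd
  have hwus : w ∉ us := fun h => hdis w h w (by simp) rfl
  have hcount : ∀ u ∈ us, us.count u = 1 := fun u hu => List.count_eq_one_of_mem hndus hu
  have hcount0 : ∀ u, u ∉ us → us.count u = 0 := fun u hu => List.count_eq_zero.2 hu
  by_cases hspec : w ≠ b ∧ ∃ u ∈ us, ∃ n : V →₀ ℕ, n + Finsupp.single w 1 = m ∧
      coeff (n + Finsupp.single u 1) Q ≠ 0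
  · obtain ⟨hwb, u, hu, n, hn, hc⟩ := hspec
    have hnm : ∀ x, n x + (if w = x then 1 else 0) = m x := by
      intro x; rw [← hn]; simp [Finsupp.single_apply]
    have huv : v ≠ u := fun h => hvus (h ▸ hu)
    have huw : w ≠ u := fun h => hwus (h ▸ hu)
    have hnv : n v = 0 := by have := hnm v; omega
    have hval : ∀ x, (n + Finsupp.single u 1 + listMonomial us + Finsupp.single w 1 +
        Finsupp.single v 1 : V →₀ ℕ) x =
        m x + (if u = x then 1 else 0) + us.count x + if v = x then 1 else 0 := by
      intro x
      rw [← hnm x]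
      simp only [Finsupp.add_apply, listMonomial_apply, Finsupp.single_apply]
      ring
    refine ⟨n + Finsupp.single u 1 + listMonomial us + Finsupp.single w 1 +
      Finsupp.single v 1, ?_, ?_, ?_, ?_, ?_, ?_, ?_⟩
    · rw [starPoly_cons, starPoly_cons, mul_assoc, mul_assoc, Sym2.eq_swap (a := v) (b := a),
        coeff_add_single_edgeDiff_mul (Ne.symm hva), coeff_add_single_edgeDiff_mul hvw,
        coeff_add_listMonomial hvus]
      · exact hc
      · simp [hnv, Ne.symm huv]
      · simp [hnv, Ne.symm huv, listMonomial_apply, hcount0 v hvus]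
      · have hua : u ≠ a := fun h => haus (h ▸ hu)
        have := hnm a
        simp [hua, listMonomial_apply, hcount0 a haus, Ne.symm haw]
        omega
    · have hua : u ≠ a := fun h => haus (h ▸ hu)
      rw [hval]; simp [ha, hua, hcount0 a haus, hva]
    · have hub : u ≠ b := fun h => hbus (h ▸ hu)
      rw [hval]; simp [hb, hub, hcount0 b hbus, hvb]
    · rw [hval]; simp [hmv, Ne.symm huv, hcount0 v hvus]
    · rw [hval]; simp [Ne.symm huw, hcount0 w hwus, hvw, hw]
    · intro x hx
      have hxv : v ≠ x := fun h => hvus (h ▸ hx)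
      have := hus x hx
      rw [hval, hcount x hx]
      simp only [hxv, if_false]
      split_ifs <;> omega
    · intro x hxv hxw hx
      have hux : u ≠ x := fun h => hx (h ▸ hu)
      rw [hval]; simp [hux, Ne.symm hxv, hcount0 x hx]
  · have hval : ∀ x, (m + listMonomial us + Finsupp.single v 1 + Finsupp.single v 1 : V →₀ ℕ) x =
        m x + us.count x + if v = x then 2 else 0 := by
      intro x
      simp only [Finsupp.add_apply, listMonomial_apply, Finsupp.single_apply]
      split_ifs <;> ring
    refine ⟨m + listMonomial us + Finsupp.single v 1 + Finsupp.single v 1,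
      ?_, ?_, ?_, ?_, ?_, ?_, ?_⟩
    · rw [starPoly_cons, starPoly_cons, mul_assoc, mul_assoc, Sym2.eq_swap (a := v) (b := a),
        coeff_add_single_edgeDiff_mul (Ne.symm hva)]
      · by_cases hmw : m w = 0
        · rw [Sym2.eq_swap (a := v) (b := w), coeff_add_single_edgeDiff_mul (Ne.symm hvw),
            coeff_add_listMonomial hvus hmv]
          · exact hm
          · simp [hmw, listMonomial_apply, hcount0 w hwus]
        · have hwb : w ≠ b := by rintro rfl; exact hmw hb
          have hle : Finsupp.single w 1 ≤ m := by
            rw [Finsupp.single_le_iff]; omega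
          obtain ⟨n, rfl⟩ := exists_add_of_le hle
          have hnv : n v = 0 := by
            simp only [Finsupp.add_apply] at hmv; omega
          have e : Finsupp.single w 1 + n + listMonomial us + Finsupp.single v 1 =
            n + listMonomial us + Finsupp.single v 1 + Finsupp.single w 1 := by abel
          rw [e, coeff_add_single_add_single_edgeDiff_mul]
          have h1 : coeff (n + listMonomial us + Finsupp.single w 1) (starPoly v us * Q) ≠ 0 := by
            rw [add_right_comm, coeff_add_listMonomial hvus (by simp [hnv, Ne.symm hvw]), add_comm]
            exact hm
          have h2 : coeff (n + listMonomial us + Finsupp.single v 1) (starPoly v us * Q) = 0 := by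
            by_contra h2
            rw [add_right_comm] at h2
            rcases exists_of_coeff_add_single_add_listMonomial hvus hnv h2 with h3 | ⟨u, hu, h3⟩
            · have := hQ _ h3
              simp at this
            · exact hspec ⟨hwb, u, hu, n, add_comm _ _, h3⟩
          rw [h2, sub_zero]
          exact h1
      · simp [ha, listMonomial_apply, hcount0 a haus, hva]
    · rw [hval]; simp [ha, hcount0 a haus, hva]
    · rw [hval]; simp [hb, hcount0 b hbus, hvb]
    · rw [hval]; simp [hmv, hcount0 v hvus]
    · rw [hval]; simp [hcount0 w hwus, hvw, hw]
    · intro x hx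
      have hxv : v ≠ x := fun h => hvus (h ▸ hx)
      have := hus x hx
      rw [hval, hcount x hx]
      simp only [hxv, if_false]
      omega
    · intro x hxv hxw hx
      rw [hval]; simp [Ne.symm hxv, hcount0 x hx]

theorem edgesPoly_union_star (E : Finset (Sym2 V)) (v : V) (l : List V)
    (hl : l.Nodup) (hE : ∀ e ∈ E, v ∉ e) :
    edgesPoly (E ∪ (l.map fun n => s(v, n)).toFinset) = starPoly v l * edgesPoly E := by
  have hnd : (l.map fun n => s(v, n)).Nodup :=
    hl.map fun x y h => by
      rcases Sym2.eq_iff.1 h with h | h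
      · exact h.2
      · exact h.2.trans h.1
  have hd : Disjoint E (l.map fun n => s(v, n)).toFinset := by
    rw [Finset.disjoint_left]
    intro e he h
    simp only [List.mem_toFinset, List.mem_map] at h
    obtain ⟨n, -, rfl⟩ := h
    exact hE _ he (by simp)
  rw [edgesPoly, Finset.prod_union hd, List.prod_toFinset _ hnd, List.map_map, mul_comm]
  rfl

end EdgePolynomials
section PathChains

variable {V : Type} [LinearOrder V]

/-- The mod 2 chain of the edges between consecutive entries of a list of vertices. -/
def pathSum : List V → Sym2 V → ZMod 2
  | x :: y :: t => Pi.single s(x, y) 1 + pathSum (y :: t)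
  | [_] => 0
  | [] => 0

/-- The mod 2 chain of a list of vertices closed up by the edge `ab`. -/
def cycleSum (a b : V) (L : List V) : Sym2 V → ZMod 2 := pathSum L + Pi.single s(a, b) 1

theorem pathSum_cons_cons (x y : V) (t : List V) :
    pathSum (x :: y :: t) = Pi.single s(x, y) 1 + pathSum (y :: t) := rfl

theorem pathSum_append (A : List V) (c : V) (B : List V) :
    pathSum (A ++ c :: B) = pathSum (A ++ [c]) + pathSum (c :: B) := by
  induction A with
  | nil => simp [pathSum]
  | cons x A ih =>
    cases A with
    | nil => simp [pathSum]
    | cons y A =>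
      simp only [List.cons_append, pathSum_cons_cons] at ih ⊢
      rw [ih, add_assoc]

theorem pathSum_reverse (L : List V) : pathSum L.reverse = pathSum L := by
  induction L with
  | nil => rfl
  | cons x L ih =>
    cases L with
    | nil => rfl
    | cons y L =>
      rw [pathSum_cons_cons, ← ih, List.reverse_cons, List.reverse_cons, List.append_assoc,
        List.singleton_append, pathSum_append, add_comm]
      congr 1
      simp [pathSum, Sym2.eq_swap]

theorem pathSum_eq_zero {L : List V} {e : Sym2 V} {q : V} (hq : q ∈ e) (hL : q ∉ L) :
    pathSum L e = 0 := by
  induction L with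
  | nil => rfl
  | cons x L ih =>
    cases L with
    | nil => rfl
    | cons y L =>
      rw [pathSum_cons_cons, Pi.add_apply, ih (fun h => hL (List.mem_cons_of_mem _ h)),
        Pi.single_eq_of_ne, add_zero]
      rintro rfl
      rcases Sym2.mem_iff.1 hq with rfl | rfl <;> simp at hL

theorem pathSum_consecutive {A B : List V} {x y : V} (h : (A ++ x :: y :: B).Nodup) :
    pathSum (A ++ x :: y :: B) s(x, y) = 1 := by
  rw [pathSum_append, pathSum_cons_cons]
  simp only [List.nodup_append, List.nodup_cons, List.mem_cons, not_or] at h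
  obtain ⟨-, ⟨⟨hxy, hxB⟩, -⟩, hdis⟩ := h
  have h1 : pathSum (A ++ [x]) s(x, y) = 0 := by
    refine pathSum_eq_zero (q := y) (by simp) ?_
    simp only [List.mem_append, List.mem_singleton, not_or]
    exact ⟨fun hy => hdis y hy y (by simp) rfl, Ne.symm hxy⟩
  have h2 : pathSum (y :: B) s(x, y) = 0 := by
    refine pathSum_eq_zero (q := x) (by simp) ?_
    simp [hxy, hxB]
  simp [h1, h2]

variable [Fintype V]

/-- The mod 2 boundary map from chains of edges to chains of vertices. -/
def vertexBd : (Sym2 V → ZMod 2) →ₗ[ZMod 2] (V → ZMod 2) where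
  toFun h v := ∑ u, h s(v, u)
  map_add' g h := by ext v; simp [Finset.sum_add_distrib]
  map_smul' c h := by ext v; simp [Finset.mul_sum]

theorem vertexBd_apply {V : Type} [Fintype V] (h : Sym2 V → ZMod 2) (v : V) :
    vertexBd h v = ∑ u, h s(v, u) := rfl

theorem add_self_eq_zero_of_zmod_two {α : Type*} (f : α → ZMod 2) : f + f = 0 := by
  ext x; exact CharTwo.add_self_eq_zero (f x)

theorem eq_one_of_ne_zero_zmod_two {x : ZMod 2} (h : x ≠ 0) : x = 1 := by
  revert x; decide

theorem vertexBd_single {x y : V} (hxy : x ≠ y) :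
    vertexBd (Pi.single s(x, y) 1) = Pi.single x 1 + Pi.single y 1 := by
  ext v
  rw [vertexBd_apply]
  by_cases hx : v = x
  · subst hx
    rw [Finset.sum_eq_single y]
    · simp [hxy]
    · intro u _ hu
      rw [Pi.single_eq_of_ne]
      intro h
      rcases Sym2.eq_iff.1 h with h | h
      · exact hu h.2
      · exact hxy h.1
    · simp
  · by_cases hy : v = y
    · subst hy
      rw [Finset.sum_eq_single x]
      · simp [Sym2.eq_swap, hx]
      · intro u _ hu
        rw [Pi.single_eq_of_ne]
        intro h
        rcases Sym2.eq_iff.1 h with h | h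
        · exact hx h.1
        · exact hu h.2
      · simp
    · rw [Finset.sum_eq_zero]
      · simp [hx, hy]
      · intro u _
        rw [Pi.single_eq_of_ne]
        intro h
        rcases Sym2.eq_iff.1 h with h | h
        · exact hx h.1
        · exact hy h.1

theorem vertexBd_pathSum {a b : V} {t : List V} (hnd : (a :: t).Nodup)
    (hb : (a :: t).getLast? = some b) :
    vertexBd (pathSum (a :: t)) = Pi.single a 1 + Pi.single b 1 := by
  induction t generalizing a with
  | nil =>
    simp only [List.getLast?_singleton, Option.some.injEq] at hb
    subst hb
    rw [add_self_eq_zero_of_zmod_two]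
    simp [pathSum]
  | cons y t ih =>
    rw [List.getLast?_cons_cons] at hb
    rw [pathSum_cons_cons, map_add, ih (List.nodup_cons.1 hnd).2 hb, vertexBd_single]
    · rw [add_assoc, ← add_assoc (Pi.single y 1), add_self_eq_zero_of_zmod_two, zero_add]
    · rintro rfl; simp at hnd

theorem vertexBd_cycleSum {a b : V} {t : List V} (hnd : (a :: t).Nodup)
    (hb : (a :: t).getLast? = some b) (hab : a ≠ b) : vertexBd (cycleSum a b (a :: t)) = 0 := by
  rw [cycleSum, map_add, vertexBd_pathSum hnd hb, vertexBd_single hab,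
    add_self_eq_zero_of_zmod_two]

/-- A mod 2 cycle supported on a path vanishes. -/
theorem eq_zero_of_support_path {L : List V} (hnd : L.Nodup) {h : Sym2 V → ZMod 2}
    (hs : ∀ e, pathSum L e = 0 → h e = 0) (hc : vertexBd h = 0) : h = 0 := by
  induction L with
  | nil => ext e; exact hs e rfl
  | cons x L ih =>
    cases L with
    | nil => ext e; exact hs e rfl
    | cons y t =>
      have hx : h s(x, y) = 0 := by
        have h0 : vertexBd h x = 0 := by rw [hc]; rfl
        rw [vertexBd_apply, Finset.sum_eq_single y] at h0
        · exact h0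
        · intro u _ hu
          apply hs
          rw [pathSum_cons_cons, Pi.add_apply, pathSum_eq_zero (q := x) (by simp)
            (List.nodup_cons.1 hnd).1, add_zero, Pi.single_eq_of_ne]
          intro h
          rcases Sym2.eq_iff.1 h with h | h
          · exact hu h.2
          · exact hu (h.2.trans h.1)
        · simp
      refine ih (List.nodup_cons.1 hnd).2 fun e he => ?_
      by_cases hexy : e = s(x, y)
      · rw [hexy, hx]
      · apply hs
        rw [pathSum_cons_cons, Pi.add_apply, he, Pi.single_eq_of_ne hexy, add_zero]

/-- A mod 2 cycle supported on a simple cycle is either zero or that cycle. -/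
theorem eq_zero_or_eq_of_support_cycle {a b : V} {t : List V} (hnd : (a :: t).Nodup)
    (hb : (a :: t).getLast? = some b) (hab : a ≠ b) (hr : pathSum (a :: t) s(a, b) = 0)
    {h : Sym2 V → ZMod 2}
    (hs : ∀ e, cycleSum a b (a :: t) e = 0 → h e = 0) (hc : vertexBd h = 0) :
    h = 0 ∨ h = cycleSum a b (a :: t) := by
  by_cases h0 : h s(a, b) = 0
  · left
    refine eq_zero_of_support_path hnd (fun e he => ?_) hc
    by_cases hE : e = s(a, b)
    · rw [hE, h0]
    · exact hs e (by simp [cycleSum, he, hE])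
  · right
    have h1 := eq_one_of_ne_zero_zmod_two h0
    have : h + cycleSum a b (a :: t) = 0 := by
      refine eq_zero_of_support_path hnd (fun e he => ?_) ?_
      · by_cases hE : e = s(a, b)
        · subst hE
          simp only [cycleSum, Pi.add_apply, h1, hr, Pi.single_eq_same, zero_add]
          decide
        · have := hs e (by simp [cycleSum, he, hE])
          simp [cycleSum, he, hE, this]
      · rw [map_add, hc, vertexBd_cycleSum hnd hb hab, zero_add]
    have h2 := congrArg (· + cycleSum a b (a :: t)) this
    simp only [add_assoc, zero_add] at h2
    rw [← h2, add_self_eq_zero_of_zmod_two, add_zero]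

end PathChains
namespace RotationSystem

section Homology

variable {V : Type} {G : SimpleGraph V} (S : RotationSystem G)

theorem fst_faceMap (d : G.Dart) : (S.faceMap d).fst = d.snd := S.rot_fst d.symm

theorem faceMap_symm_apply (d : G.Dart) : S.faceMap d.symm = S.rot d := by
  change S.rot d.symm.symm = S.rot d
  rw [SimpleGraph.Dart.symm_symm]

/-- A function on darts that is constant on faces. -/
def FaceInvariant (s : G.Dart → ZMod 2) : Prop := ∀ d, s (S.faceMap d) = s d

variable {S}

theorem FaceInvariant.rot {s : G.Dart → ZMod 2} (hs : S.FaceInvariant s) (d : G.Dart) :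
    s (S.rot d) = s d.symm := by
  rw [← S.faceMap_symm_apply, hs]

theorem eq_of_rot_eq {s : G.Dart → ZMod 2} {q : V}
    (h : ∀ d : G.Dart, d.fst = q → s (S.rot d) = s d) {d d' : G.Dart} (hd : d.fst = q)
    (hd' : d'.fst = q) : s d = s d' := by
  obtain ⟨n, rfl⟩ := S.rot_cyclic d d' (hd.trans hd'.symm)
  clear hd'
  induction n generalizing d with
  | zero => rfl
  | succ n ih =>
    rw [Function.iterate_succ_apply, ← ih (d := S.rot d) ((S.rot_fst d).trans hd), h d hd]

theorem FaceInvariant.eq_of_symm {s : G.Dart → ZMod 2} (hs : S.FaceInvariant s)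
    (hG : G.Connected) (h : ∀ d : G.Dart, s d.symm = s d) (d d' : G.Dart) : s d = s d' := by
  have hrot : ∀ d : G.Dart, s (S.rot d) = s d := fun d => by rw [hs.rot, h]
  have key : ∀ (u v : V) (_ : G.Walk u v) (d d' : G.Dart), d.fst = u → d'.fst = v →
      s d = s d' := by
    intro u v p
    induction p with
    | nil => intro d d' hd hd'; exact eq_of_rot_eq (S := S) (fun d _ => hrot d) hd hd'
    | @cons u w v huw p ih =>
      intro d d' hd hd'
      have h1 : s d = s ⟨(u, w), huw⟩ := eq_of_rot_eq (S := S) (fun d _ => hrot d) hd rfl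
      rw [h1, ← h, ih _ d' rfl hd']
  exact key _ _ (hG.preconnected d.fst d'.fst).some d d' rfl rfl

theorem faceOf_faceMap (d : G.Dart) : S.faceOf (S.faceMap d) = S.faceOf d :=
  Quotient.sound ⟨-1, by simp⟩

theorem FaceInvariant.of_face (f : S.Face → ZMod 2) : S.FaceInvariant fun d => f (S.faceOf d) :=
  fun d => by simp only [faceOf_faceMap]

theorem FaceInvariant.eq_of_faceOf_eq {s : G.Dart → ZMod 2} (hs : S.FaceInvariant s)
    {d d' : G.Dart} (h : S.faceOf d = S.faceOf d') : s d = s d' := by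
  obtain ⟨n, rfl⟩ : ∃ n : ℤ, (S.faceMap ^ n) d = d' := Quotient.exact h
  induction n with
  | zero => rfl
  | succ n ih =>
    rw [ih (Quotient.sound ⟨n, rfl⟩), add_comm, zpow_add, zpow_one, Equiv.Perm.mul_apply, hs]
  | pred n ih =>
    rw [ih (Quotient.sound ⟨_, rfl⟩), ← hs ((S.faceMap ^ (-(n : ℤ) - 1)) d),
      ← Equiv.Perm.mul_apply, ← zpow_one_add]
    congr 3
    ring

variable [LinearOrder V] [Fintype G.Dart]

/-- The mod 2 boundary map from functions on darts to chains of edges. -/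
def edgeBd : (G.Dart → ZMod 2) →ₗ[ZMod 2] (Sym2 V → ZMod 2) where
  toFun s := ∑ d, s d • Pi.single d.edge 1
  map_add' s t := by simp only [Pi.add_apply, add_smul, Finset.sum_add_distrib]
  map_smul' c s := by simp [Finset.smul_sum, mul_smul]

theorem edgeBd_def (s : G.Dart → ZMod 2) : edgeBd s = ∑ d, s d • Pi.single d.edge 1 := rfl

theorem edgeBd_apply (s : G.Dart → ZMod 2) (e : Sym2 V) :
    edgeBd s e = ∑ d, if e = d.edge then s d else 0 := by
  rw [edgeBd_def, Finset.sum_apply]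
  simp [Pi.single_apply]

theorem edgeBd_edge (s : G.Dart → ZMod 2) (d : G.Dart) :
    edgeBd s d.edge = s d + s d.symm := by
  rw [edgeBd_apply, ← Finset.sum_filter]
  have : (Finset.univ.filter fun d' : G.Dart => d.edge = d'.edge) = {d, d.symm} := by
    ext d'
    simp only [Finset.mem_filter, Finset.mem_univ, true_and, Finset.mem_insert,
      Finset.mem_singleton]
    rw [eq_comm, SimpleGraph.dart_edge_eq_iff]
  rw [this, Finset.sum_pair d.symm_ne.symm]

theorem exists_dart_of_edgeBd_ne_zero {s : G.Dart → ZMod 2} {e : Sym2 V}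
    (h : edgeBd s e ≠ 0) : ∃ d : G.Dart, d.edge = e ∧ s d ≠ 0 := by
  rw [edgeBd_apply] at h
  obtain ⟨d, -, hd⟩ := Finset.exists_ne_zero_of_sum_ne_zero h
  by_cases he : e = d.edge
  · exact ⟨d, he.symm, by simpa [he] using hd⟩
  · simp [he] at hd

variable [Fintype V]

theorem vertexBd_edgeBd {s : G.Dart → ZMod 2} (hs : S.FaceInvariant s) :
    vertexBd (edgeBd s) = 0 := by
  have h1 : ∀ d : G.Dart, vertexBd (Pi.single d.edge 1) =
      Pi.single d.fst 1 + Pi.single d.snd 1 := fun d => vertexBd_single d.fst_ne_snd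
  have h2 : ∑ d : G.Dart, s d • (Pi.single d.snd 1 : V → ZMod 2) =
      ∑ d : G.Dart, s d • Pi.single d.fst 1 := by
    rw [← Equiv.sum_comp S.faceMap fun d => s d • (Pi.single d.fst 1 : V → ZMod 2)]
    refine Finset.sum_congr rfl fun d _ => ?_
    rw [hs d, S.fst_faceMap]
  rw [edgeBd_def, map_sum]
  simp only [map_smul, h1, smul_add, Finset.sum_add_distrib, h2]
  exact add_self_eq_zero_of_zmod_two _

/-- In a plane map every mod 2 cycle bounds. -/
theorem exists_edgeBd_eq (hS : S.IsPlane) {h : Sym2 V → ZMod 2}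
    (hsupp : ∀ e, h e ≠ 0 → e ∈ G.edgeSet) (hc : vertexBd h = 0) :
    ∃ s, S.FaceInvariant s ∧ edgeBd s = h := by
  classical
  obtain ⟨hconn, hEuler⟩ := hS
  have : Finite S.Face := Quotient.finite _
  let _ : Fintype S.Face := Fintype.ofFinite _
  let _ : Fintype G.edgeSet := Fintype.ofFinite _
  rw [Nat.card_eq_fintype_card, Nat.card_eq_fintype_card] at hEuler
  let ext : (G.edgeSet → ZMod 2) →ₗ[ZMod 2] (Sym2 V → ZMod 2) :=
    { toFun := fun g e => if he : e ∈ G.edgeSet then g ⟨e, he⟩ else 0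
      map_add' := by intro g g'; ext e; by_cases he : e ∈ G.edgeSet <;> simp [he]
      map_smul' := by intro c g; ext e; by_cases he : e ∈ G.edgeSet <;> simp [he] }
  let bd : (S.Face → ZMod 2) →ₗ[ZMod 2] (G.edgeSet → ZMod 2) :=
    { toFun := fun f e => edgeBd (fun d => f (S.faceOf d)) e
      map_add' := by
        intro f g; ext e
        exact congrFun (edgeBd.map_add (fun d => f (S.faceOf d)) fun d => g (S.faceOf d)) e
      map_smul' := by
        intro c f; ext e
        exact congrFun (edgeBd.map_smul c fun d => f (S.faceOf d)) e }
  let bd₁ := vertexBd ∘ₗ ext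
  have hext : ∀ h : Sym2 V → ZMod 2, (∀ e, h e ≠ 0 → e ∈ G.edgeSet) →
      ext (fun e => h e) = h := by
    intro h hh
    ext e
    by_cases he : e ∈ G.edgeSet
    · simp [ext, he]
    · simp only [ext, LinearMap.coe_mk, AddHom.coe_mk, he, dif_neg, not_false_iff]
      by_contra hne
      exact he (hh e (Ne.symm hne))
  have hbdsupp : ∀ (s : G.Dart → ZMod 2) e, edgeBd s e ≠ 0 → e ∈ G.edgeSet := by
    intro s e he
    obtain ⟨d, rfl, -⟩ := exists_dart_of_edgeBd_ne_zero he
    exact d.edge_mem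
  have hle : LinearMap.range bd ≤ LinearMap.ker bd₁ := by
    rintro _ ⟨f, rfl⟩
    rw [LinearMap.mem_ker]
    change vertexBd (ext (fun e => edgeBd (fun d => f (S.faceOf d)) e)) = 0
    rw [hext _ (hbdsupp _), vertexBd_edgeBd (FaceInvariant.of_face f)]
  have hker : Module.finrank (ZMod 2) (LinearMap.ker bd) ≤ 1 := by
    have : LinearMap.ker bd ≤ Submodule.span (ZMod 2) {fun _ => 1} := by
      intro f hf
      rw [LinearMap.mem_ker] at hf
      have hsymm : ∀ d : G.Dart, f (S.faceOf d.symm) = f (S.faceOf d) := by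
        intro d
        have h0 : edgeBd (fun d => f (S.faceOf d)) d.edge = 0 := congrFun hf ⟨d.edge, d.edge_mem⟩
        rw [edgeBd_edge] at h0
        exact (CharTwo.add_eq_zero.1 h0).symm
      have hconst := (FaceInvariant.of_face f).eq_of_symm hconn hsymm
      rw [Submodule.mem_span_singleton]
      by_cases hne : Nonempty G.Dart
      · obtain ⟨d₀⟩ := hne
        refine ⟨f (S.faceOf d₀), ?_⟩
        ext F
        obtain ⟨d, rfl⟩ := Quotient.exists_rep F
        change f (S.faceOf d₀) * 1 = f (S.faceOf d)
        rw [mul_one]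
        exact hconst d₀ d
      · refine ⟨0, ?_⟩
        ext F
        obtain ⟨d, rfl⟩ := Quotient.exists_rep F
        exact (hne ⟨d⟩).elim
    exact (Submodule.finrank_mono this).trans ((finrank_span_le_card _).trans (by simp))
  have hrange : Fintype.card V ≤ Module.finrank (ZMod 2) (LinearMap.range bd₁) + 1 := by
    obtain ⟨v₀⟩ := hconn.nonempty
    have hadj : ∀ u v, G.Adj u v → (Pi.single u 1 + Pi.single v 1 : V → ZMod 2) ∈
        LinearMap.range bd₁ := by
      intro u v huv
      refine ⟨fun e => (Pi.single s(u, v) 1 : Sym2 V → ZMod 2) e, ?_⟩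
      change vertexBd (ext _) = _
      rw [hext, vertexBd_single huv.ne]
      intro e he
      by_cases h : e = s(u, v)
      · rw [h]; exact huv
      · simp [h] at he
    have htop : LinearMap.range bd₁ ⊔ Submodule.span (ZMod 2) {Pi.single v₀ 1} = ⊤ := by
      have hs : ∀ u v (_ : G.Walk u v),
          (Pi.single v 1 : V → ZMod 2) ∈
            LinearMap.range bd₁ ⊔ Submodule.span (ZMod 2) {Pi.single v₀ 1} →
          (Pi.single u 1 : V → ZMod 2) ∈
            LinearMap.range bd₁ ⊔ Submodule.span (ZMod 2) {Pi.single v₀ 1} := by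
        intro u v p
        induction p with
        | nil => exact id
        | @cons u w v huw p ih =>
          intro h
          have := Submodule.add_mem _ (Submodule.mem_sup_left (hadj u w huw)) (ih h)
          rwa [add_assoc, add_self_eq_zero_of_zmod_two, add_zero] at this
      rw [eq_top_iff]
      intro g _
      have hg : g = ∑ v, g v • (Pi.single v 1 : V → ZMod 2) := by
        ext v
        simp [Finset.sum_apply, Pi.single_apply]
      rw [hg]
      refine Submodule.sum_mem _ fun v _ => Submodule.smul_mem _ _ ?_
      exact hs v v₀ (hconn.preconnected v v₀).some
        (Submodule.mem_sup_right (Submodule.mem_span_singleton_self _))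
    have h1 := Submodule.finrank_add_le_finrank_add_finrank (LinearMap.range bd₁)
      (Submodule.span (ZMod 2) {Pi.single v₀ 1})
    rw [htop, finrank_top, Module.finrank_fintype_fun_eq_card] at h1
    have h2 : Module.finrank (ZMod 2)
      (Submodule.span (ZMod 2) {(Pi.single v₀ 1 : V → ZMod 2)}) ≤ 1 :=
      (finrank_span_le_card _).trans (by simp)
    omega
  have r1 := LinearMap.finrank_range_add_finrank_ker bd
  have r2 := LinearMap.finrank_range_add_finrank_ker bd₁
  rw [Module.finrank_fintype_fun_eq_card] at r1 r2
  have heq := Submodule.eq_of_le_of_finrank_le hle (by omega)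
  have hmem : (fun e : G.edgeSet => h e) ∈ LinearMap.ker bd₁ := by
    rw [LinearMap.mem_ker]
    change vertexBd (ext _) = 0
    rw [hext h hsupp, hc]
  rw [← heq] at hmem
  obtain ⟨f, hf⟩ := hmem
  refine ⟨fun d => f (S.faceOf d), FaceInvariant.of_face f, ?_⟩
  rw [← hext h hsupp, ← hf]
  exact (hext _ (hbdsupp _)).symm

end Homology

end RotationSystem
namespace RotationSystem

section Fan

variable {V : Type} {G : SimpleGraph V} {S : RotationSystem G}

theorem fst_iterate_rot (d : G.Dart) (n : ℕ) : (S.rot^[n] d).fst = d.fst := by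
  induction n with
  | zero => rfl
  | succ n ih => rw [Function.iterate_succ_apply', S.rot_fst, ih]

theorem dart_eq_of_snd_eq {d d' : G.Dart} (h : d.fst = d'.fst) (h' : d.snd = d'.snd) : d = d' :=
  SimpleGraph.Dart.ext _ _ (Prod.ext h h')

variable [LinearOrder V]

/-- If a function on the darts at a vertex changes, along the rotation, exactly after the darts
`dp` and `dq`, then it is constant on the arc that leads from `dp` to `dq`. -/
theorem exists_arc {s : G.Dart → ZMod 2} {dp dq : G.Dart} (hpq : dp ≠ dq)
    (hfst : dp.fst = dq.fst)
    (hs : ∀ d : G.Dart, d.fst = dp.fst →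
      s (S.rot d) = s d + if d = dp ∨ d = dq then 1 else 0) :
    ∃ n, 0 < n ∧ S.rot^[n] dp = dq ∧ (∀ i < n, S.rot^[i] dp ≠ dq) ∧
      (∀ i ≤ n, 0 < i → S.rot^[i] dp ≠ dp) ∧
      ∀ i ≤ n, 0 < i → s (S.rot^[i] dp) = s dp + 1 := by
  have hex := S.rot_cyclic dp dq hfst
  have hn := Nat.find_spec hex
  have hmin : ∀ i < Nat.find hex, S.rot^[i] dp ≠ dq := fun i hi => Nat.find_min hex hi
  set n := Nat.find hex
  have hnp : ∀ i ≤ n, 0 < i → S.rot^[i] dp ≠ dp := by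
    intro i hi hi0 h
    refine hmin (n - i) (by omega) ?_
    rw [← hn]
    conv_rhs => rw [show n = (n - i) + i by omega, Function.iterate_add_apply, h]
  refine ⟨n, Nat.pos_of_ne_zero fun h => ?_, hn, hmin, hnp, ?_⟩
  · rw [h] at hn; exact hpq hn
  · intro i
    induction i with
    | zero => intro _ h; omega
    | succ i ih =>
      intro hi _
      rw [Function.iterate_succ_apply', hs _ (fst_iterate_rot _ _)]
      rcases Nat.eq_zero_or_pos i with rfl | hi0
      · simp
      · rw [ih (by omega) hi0]
        simp [hmin i (by omega), hnp i (by omega) hi0]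

theorem pathSum_map_range (u : ℕ → V) (k : ℕ) :
    pathSum ((List.range (k + 1)).map u) =
      ∑ i ∈ Finset.range k, Pi.single s(u i, u (i + 1)) 1 := by
  induction k with
  | zero => simp [pathSum]
  | succ k ih =>
    rw [Finset.sum_range_succ, ← ih, List.range_succ, List.range_succ]
    simp only [List.map_append, List.map_cons, List.map_nil, List.append_assoc,
      List.singleton_append]
    rw [pathSum_append]
    simp [pathSum]

/-- The part of `s` on the triangles through `v`. -/
def starPart (S : RotationSystem G) (s : G.Dart → ZMod 2) (v : V) (d : G.Dart) : ZMod 2 :=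
  (if d.fst = v then s d else 0) +
    (if (S.faceMap d).fst = v then s (S.faceMap d) else 0) +
    (if (S.faceMap (S.faceMap d)).fst = v then s (S.faceMap (S.faceMap d)) else 0)

theorem faceInvariant_starPart {s : G.Dart → ZMod 2} (hs : S.FaceInvariant s)
    (htri : ∀ d, s d ≠ 0 → S.faceMap (S.faceMap (S.faceMap d)) = d) (v : V) :
    S.FaceInvariant (S.starPart s v) := by
  intro d
  by_cases h : s d = 0
  · simp [starPart, hs _, h]
  · simp only [starPart]
    rw [htri d h]
    ring

theorem starPart_eq {s : G.Dart → ZMod 2} (hs : S.FaceInvariant s)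
    (htri : ∀ d, s d ≠ 0 → S.faceMap (S.faceMap (S.faceMap d)) = d) (v : V) (d : G.Dart) :
    S.starPart s v d =
      if d.fst = v ∨ d.snd = v ∨ (S.faceMap (S.faceMap d)).fst = v then s d else 0 := by
  by_cases h : s d = 0
  · simp [starPart, hs _, h]
  · have h1 : d.fst ≠ d.snd := d.fst_ne_snd
    have h2 : d.snd ≠ (S.faceMap (S.faceMap d)).fst := by
      rw [fst_faceMap, ← S.fst_faceMap d]
      exact (S.faceMap d).fst_ne_snd
    have h3 : (S.faceMap (S.faceMap d)).fst ≠ d.fst := by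
      have := (S.faceMap (S.faceMap d)).fst_ne_snd
      rwa [← S.fst_faceMap (S.faceMap (S.faceMap d)), htri d h] at this
    simp only [starPart, hs _, S.fst_faceMap d]
    by_cases c1 : d.fst = v
    · have c2 : d.snd ≠ v := fun c => h1 (c1.trans c.symm)
      have c3 : (S.faceMap (S.faceMap d)).fst ≠ v := fun c => h3 (c.trans c1.symm)
      simp [c1, c2, c3]
    · by_cases c2 : d.snd = v
      · have c3 : (S.faceMap (S.faceMap d)).fst ≠ v := fun c => h2 (c2.trans c.symm)
        simp [c1, c2, c3]
      · simp [c1, c2]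

variable [Fintype G.Dart]

theorem edgeBd_starPart {s : G.Dart → ZMod 2}
    (htri : ∀ d, s d ≠ 0 → S.faceMap (S.faceMap (S.faceMap d)) = d) (v : V) :
    edgeBd (S.starPart s v) = ∑ d ∈ Finset.univ.filter (fun d : G.Dart => d.fst = v ∧ s d ≠ 0),
      (Pi.single d.edge 1 + Pi.single (S.faceMap d).edge 1 +
        Pi.single (S.faceMap (S.faceMap d)).edge 1) := by
  set r : G.Dart → ZMod 2 := fun d => if d.fst = v then s d else 0 with hr
  have hr3 : ∀ d, r d ≠ 0 → S.faceMap (S.faceMap (S.faceMap d)) = d := by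
    intro d hd
    refine htri d fun h => hd ?_
    simp [hr, h]
  have e0 : edgeBd (S.starPart s v) = ∑ d, r d • (Pi.single d.edge 1 : Sym2 V → ZMod 2) +
      ∑ d, r (S.faceMap d) • (Pi.single d.edge 1 : Sym2 V → ZMod 2) +
      ∑ d, r (S.faceMap (S.faceMap d)) • (Pi.single d.edge 1 : Sym2 V → ZMod 2) := by
    rw [edgeBd_def, ← Finset.sum_add_distrib, ← Finset.sum_add_distrib]
    refine Finset.sum_congr rfl fun d _ => ?_
    rw [← add_smul, ← add_smul]
    rfl
  have e1 : ∑ d, r (S.faceMap d) • (Pi.single d.edge 1 : Sym2 V → ZMod 2) =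
      ∑ d, r d • Pi.single (S.faceMap (S.faceMap d)).edge 1 := by
    rw [← Equiv.sum_comp S.faceMap fun d =>
      r d • (Pi.single (S.faceMap (S.faceMap d)).edge 1 : Sym2 V → ZMod 2)]
    refine Finset.sum_congr rfl fun d _ => ?_
    by_cases h : r (S.faceMap d) = 0
    · simp [h]
    · rw [S.faceMap.injective (hr3 _ h)]
  have e2 : ∑ d, r (S.faceMap (S.faceMap d)) • (Pi.single d.edge 1 : Sym2 V → ZMod 2) =
      ∑ d, r d • Pi.single (S.faceMap d).edge 1 := by
    rw [← Equiv.sum_comp (S.faceMap.trans S.faceMap) fun d =>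
      r d • (Pi.single (S.faceMap d).edge 1 : Sym2 V → ZMod 2)]
    refine Finset.sum_congr rfl fun d _ => ?_
    simp only [Equiv.trans_apply]
    by_cases h : r (S.faceMap (S.faceMap d)) = 0
    · simp [h]
    · rw [S.faceMap.injective (S.faceMap.injective (hr3 _ h))]
  rw [e0, e1, e2, ← Finset.sum_add_distrib, ← Finset.sum_add_distrib, Finset.sum_filter]
  refine Finset.sum_congr rfl fun d _ => ?_
  by_cases hv : d.fst = v
  · by_cases h : s d = 0
    · simp [hr, h]
    · have h1 := eq_one_of_ne_zero_zmod_two h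
      simp only [hr, hv, h1, if_true, one_smul]
      simp [add_right_comm]
  · simp [hr, hv]

/-- The triangles at a boundary vertex `v` form a fan between its two boundary neighbours. -/
theorem exists_fan_aux {s : G.Dart → ZMod 2} (hs : S.FaceInvariant s)
    (htri : ∀ d, s d ≠ 0 → S.faceMap (S.faceMap (S.faceMap d)) = d) {v : V} {dp dq : G.Dart}
    (hpq : dp ≠ dq) (hp : dp.fst = v) (hq : dq.fst = v)
    (hrot : ∀ d : G.Dart, d.fst = v → s (S.rot d) = s d + if d = dp ∨ d = dq then 1 else 0)
    (hp0 : s dp = 0) :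
    ∃ us : List V, (dp.snd :: (us ++ [dq.snd])).Nodup ∧
      (∀ x, x ∈ dp.snd :: (us ++ [dq.snd]) ↔
        ∃ d : G.Dart, d.fst = v ∧ d.snd = x ∧ (s d ≠ 0 ∨ s d.symm ≠ 0)) ∧
      (∀ d : G.Dart, d.fst = v → s d ≠ 0 → ∃ A x y B,
        dp.snd :: (us ++ [dq.snd]) = A ++ x :: y :: B ∧ (S.faceMap d).edge = s(x, y)) ∧
      edgeBd (S.starPart s v) = Pi.single s(v, dp.snd) 1 + Pi.single s(v, dq.snd) 1 +
        pathSum (dp.snd :: (us ++ [dq.snd])) := by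
  subst hp
  obtain ⟨n, hn0, hn, hnq, hnp, hone⟩ := exists_arc (S := S) (s := s) hpq hq.symm hrot
  obtain ⟨m, rfl⟩ : ∃ m, n = m + 1 := ⟨n - 1, by omega⟩
  simp only [hp0, zero_add] at hone
  set e : ℕ → G.Dart := fun i => S.rot^[i] dp with he
  have he0 : e 0 = dp := rfl
  have hes : ∀ i, e (i + 1) = S.rot (e i) := fun i => Function.iterate_succ_apply' _ _ _
  have hef : ∀ i, (e i).fst = dp.fst := fun i => fst_iterate_rot _ _
  change e (m + 1) = dq at hn
  change ∀ i ≤ m + 1, 0 < i → e i ≠ dp at hnp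
  change ∀ i ≤ m + 1, 0 < i → s (e i) = 1 at hone
  have hinj : ∀ i j, i < j → j ≤ m + 1 → e i ≠ e j := by
    intro i j hij hj h
    refine hnp (j - i) (by omega) (by omega) ?_
    apply S.rot.injective.iterate i
    change S.rot^[i] (S.rot^[j - i] dp) = e i
    rw [← Function.iterate_add_apply, h]
    simp only [he]
    congr 1
    omega
  have harc : ∀ k, (∃ i ≤ m + 1, 0 < i ∧ e k = e i) ∨ s (e k) = 0 := by
    intro k
    induction k with
    | zero => exact Or.inr hp0
    | succ k ih =>
      rcases ih with ⟨i, hi, hi0, hki⟩ | h0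
      · rcases Nat.lt_or_ge i (m + 1) with hlt | hge
        · exact Or.inl ⟨i + 1, by omega, by omega, by rw [hes, hes, hki]⟩
        · right
          have : i = m + 1 := by omega
          subst this
          rw [hes, hrot _ (hef k), hki, hone _ le_rfl (by omega), hn]
          simp only [or_true, if_true]
          decide
      · by_cases hkp : e k = dp
        · exact Or.inl ⟨1, by omega, by omega, by rw [hes, hkp, hes, he0]⟩
        · right
          have hkq : e k ≠ dq := by
            intro h
            rw [h, ← hn, hone _ le_rfl (by omega)] at h0
            exact one_ne_zero h0
          rw [hes, hrot _ (hef k), h0]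
          simp [hkp, hkq]
  have hmem : ∀ d : G.Dart, d.fst = dp.fst → s d ≠ 0 → ∃ i ≤ m, d = e (i + 1) := by
    intro d hd hsd
    obtain ⟨k, rfl⟩ := S.rot_cyclic dp d hd.symm
    rcases harc k with ⟨i, hi, hi0, h⟩ | h
    · exact ⟨i - 1, by omega, by rw [Nat.sub_add_cancel hi0]; exact h⟩
    · exact (hsd h).elim
  set u : ℕ → V := fun i => (e i).snd with hu
  have hlist : dp.snd :: ((List.range m).map (fun i => u (i + 1)) ++ [dq.snd]) =
      (List.range (m + 1 + 1)).map u := by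
    rw [List.range_succ, List.map_append, List.range_succ_eq_map, ← hn]
    simp [hu, he0]
  have hunbr : ∀ i, (e i).edge = s(dp.fst, u i) := by
    intro i
    rw [← hef i]
    rfl
  have htr2 : ∀ i ≤ m, S.faceMap (S.faceMap (e (i + 1))) = (e i).symm := by
    intro i hi
    have h1 := htri (e (i + 1)) (by rw [hone _ (by omega) (by omega)]; exact one_ne_zero)
    rw [hes, ← S.faceMap_symm_apply] at h1 ⊢
    exact S.faceMap.injective h1
  have htr1 : ∀ i ≤ m, (S.faceMap (e (i + 1))).edge = s(u i, u (i + 1)) := by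
    intro i hi
    have h1 : (S.faceMap (e (i + 1))).fst = u (i + 1) := S.fst_faceMap _
    have h2 : (S.faceMap (e (i + 1))).snd = u i := by
      rw [← S.fst_faceMap, htr2 i hi]; rfl
    rw [Sym2.eq_swap, ← h1, ← h2]
    rfl
  refine ⟨(List.range m).map fun i => u (i + 1), ?_⟩
  rw [hlist]
  refine ⟨?_, ?_, ?_, ?_⟩
  · refine (List.nodup_range).map_on ?_
    intro i hi j hj hij
    rw [List.mem_range] at hi hj
    have hij' : e i = e j := dart_eq_of_snd_eq ((hef i).trans (hef j).symm) hij
    rcases lt_trichotomy i j with h | h | h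
    · exact (hinj i j h (by omega) hij').elim
    · exact h
    · exact (hinj j i h (by omega) hij'.symm).elim
  · intro x
    simp only [List.mem_map, List.mem_range]
    constructor
    · rintro ⟨i, hi, rfl⟩
      refine ⟨e i, hef i, rfl, ?_⟩
      rcases Nat.eq_zero_or_pos i with rfl | hi0
      · right
        rw [← hs.rot, ← hes, hone _ (by omega) (by omega)]
        exact one_ne_zero
      · left
        rw [hone _ (by omega) hi0]
        exact one_ne_zero
    · rintro ⟨d, hd, rfl, h | h⟩
      · obtain ⟨i, hi, rfl⟩ := hmem d hd h
        exact ⟨i + 1, by omega, rfl⟩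
      · rw [← hs.rot] at h
        obtain ⟨i, hi, hdi⟩ := hmem _ ((S.rot_fst d).trans hd) h
        rw [hes] at hdi
        exact ⟨i, by omega, by rw [S.rot.injective hdi]⟩
  · intro d hd hsd
    obtain ⟨i, hi, rfl⟩ := hmem d hd hsd
    refine ⟨(List.range i).map u, u i, u (i + 1),
      (List.range (m - i)).map fun j => u (i + 2 + j), ?_, htr1 i hi⟩
    rw [show m + 1 + 1 = i + (2 + (m - i)) by omega, List.range_add, List.range_add]
    simp [Function.comp_def, List.range_succ, add_assoc]
  · have hfil : (Finset.univ.filter fun d : G.Dart => d.fst = dp.fst ∧ s d ≠ 0) =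
        (Finset.range (m + 1)).image fun i => e (i + 1) := by
      ext d
      simp only [Finset.mem_filter, Finset.mem_univ, true_and, Finset.mem_image, Finset.mem_range]
      constructor
      · rintro ⟨hd, hsd⟩
        obtain ⟨i, hi, rfl⟩ := hmem d hd hsd
        exact ⟨i, by omega, rfl⟩
      · rintro ⟨i, hi, rfl⟩
        refine ⟨hef _, ?_⟩
        rw [hone _ (by omega) (by omega)]
        exact one_ne_zero
    rw [edgeBd_starPart htri, hfil, Finset.sum_image, pathSum_map_range]
    · have htel : ∀ k, ∑ i ∈ Finset.range k,
          ((Pi.single s(dp.fst, u (i + 1)) 1 : Sym2 V → ZMod 2) + Pi.single s(dp.fst, u i) 1) =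
          Pi.single s(dp.fst, u 0) 1 + Pi.single s(dp.fst, u k) 1 := by
        intro k
        induction k with
        | zero => rw [Finset.sum_range_zero, add_self_eq_zero_of_zmod_two]
        | succ k ih =>
          rw [Finset.sum_range_succ, ih, add_comm (Pi.single s(dp.fst, u (k + 1)) 1), add_assoc,
            ← add_assoc (Pi.single s(dp.fst, u k) 1), add_self_eq_zero_of_zmod_two, zero_add]
      have h0 : dp.snd = u 0 := rfl
      have h1 : dq.snd = u (m + 1) := by rw [← hn]
      rw [h0, h1, ← htel, ← Finset.sum_add_distrib]
      refine Finset.sum_congr rfl fun i hi => ?_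
      rw [Finset.mem_range] at hi
      rw [htr1 i (by omega), htr2 i (by omega), SimpleGraph.Dart.edge_symm, hunbr, hunbr,
        add_right_comm]
    · intro i hi j hj hij
      simp only [Finset.coe_range, Set.mem_Iio] at hi hj
      rcases lt_trichotomy i j with h | h | h
      · exact (hinj (i + 1) (j + 1) (by omega) (by omega) hij).elim
      · exact h
      · exact (hinj (j + 1) (i + 1) (by omega) (by omega) hij.symm).elim

theorem exists_fan {s : G.Dart → ZMod 2} (hs : S.FaceInvariant s)
    (htri : ∀ d, s d ≠ 0 → S.faceMap (S.faceMap (S.faceMap d)) = d) {v : V} {dp dq : G.Dart}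
    (hpq : dp ≠ dq) (hp : dp.fst = v) (hq : dq.fst = v)
    (hrot : ∀ d : G.Dart, d.fst = v → s (S.rot d) = s d + if d = dp ∨ d = dq then 1 else 0) :
    ∃ us : List V, (dp.snd :: (us ++ [dq.snd])).Nodup ∧
      (∀ x, x ∈ dp.snd :: (us ++ [dq.snd]) ↔
        ∃ d : G.Dart, d.fst = v ∧ d.snd = x ∧ (s d ≠ 0 ∨ s d.symm ≠ 0)) ∧
      (∀ d : G.Dart, d.fst = v → s d ≠ 0 → ∃ A x y B,
        dp.snd :: (us ++ [dq.snd]) = A ++ x :: y :: B ∧ (S.faceMap d).edge = s(x, y)) ∧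
      edgeBd (S.starPart s v) = Pi.single s(v, dp.snd) 1 + Pi.single s(v, dq.snd) 1 +
        pathSum (dp.snd :: (us ++ [dq.snd])) := by
  by_cases hp0 : s dp = 0
  · exact exists_fan_aux hs htri hpq hp hq hrot hp0
  · have hq0 : s dq = 0 := by
      obtain ⟨n, hn0, hn, -, -, hone⟩ := exists_arc (S := S) (s := s) hpq (hp.trans hq.symm)
        (by rw [hp]; exact hrot)
      rw [← hn, hone n le_rfl hn0, eq_one_of_ne_zero_zmod_two hp0]
      decide
    obtain ⟨us, h1, h2, h3, h4⟩ := exists_fan_aux hs htri hpq.symm hq hp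
      (fun d hd => by rw [hrot d hd]; simp only [or_comm]) hq0
    have hrev : dp.snd :: (us.reverse ++ [dq.snd]) = (dq.snd :: (us ++ [dp.snd])).reverse := by
      simp
    refine ⟨us.reverse, ?_⟩
    rw [hrev]
    refine ⟨List.nodup_reverse.2 h1, fun x => by rw [List.mem_reverse, h2], ?_, ?_⟩
    · intro d hd hsd
      obtain ⟨A, x, y, B, hl, hE⟩ := h3 d hd hsd
      exact ⟨B.reverse, y, x, A.reverse, by rw [hl]; simp, by rw [hE, Sym2.eq_swap]⟩
    · rw [h4, pathSum_reverse, add_comm (Pi.single s(v, dq.snd) 1)]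

end Fan

end RotationSystem
section CycleChains

variable {V : Type} [LinearOrder V]

theorem exists_consecutive_of_pathSum_ne_zero {L : List V} {e : Sym2 V} (h : pathSum L e ≠ 0) :
    ∃ A x y B, L = A ++ x :: y :: B ∧ e = s(x, y) := by
  induction L with
  | nil => exact (h rfl).elim
  | cons x L ih =>
    cases L with
    | nil => exact (h rfl).elim
    | cons y L =>
      by_cases he : e = s(x, y)
      · exact ⟨[], x, y, L, rfl, he⟩
      · rw [pathSum_cons_cons, Pi.add_apply, Pi.single_eq_of_ne he, zero_add] at h
        obtain ⟨A, x', y', B, hL, he'⟩ := ih h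
        exact ⟨x :: A, x', y', B, by rw [hL]; rfl, he'⟩

/-- The closing edge of a cycle of length at least three is not on the path it closes. -/
theorem pathSum_closing_edge {a b x y : V} {t : List V} (hnd : (a :: x :: y :: t).Nodup)
    (hb : (a :: x :: y :: t).getLast? = some b) : pathSum (a :: x :: y :: t) s(a, b) = 0 := by
  have hbm : b ∈ y :: t := List.mem_of_getLast? (by simpa using hb)
  rw [List.nodup_cons, List.nodup_cons] at hnd
  obtain ⟨ha, hx, -⟩ := hnd
  have hxb : s(a, b) ≠ s(a, x) := by
    intro h
    rw [Sym2.congr_right] at h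
    exact hx (h ▸ hbm)
  rw [pathSum_cons_cons, Pi.add_apply, Pi.single_eq_of_ne hxb,
    pathSum_eq_zero (Sym2.mem_mk_left a b) ha, add_zero]

theorem cycleSum_consecutive {a b x y : V} {A B : List V} (h : (A ++ x :: y :: B).Nodup)
    (hne : s(x, y) ≠ s(a, b)) : cycleSum a b (A ++ x :: y :: B) s(x, y) = 1 := by
  rw [cycleSum, Pi.add_apply, pathSum_consecutive h, Pi.single_eq_of_ne hne, add_zero]

theorem cycleSum_eq_zero {a b q : V} {L : List V} {e : Sym2 V} (hq : q ∈ e) (hL : q ∉ L)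
    (ha : q ≠ a) (hb : q ≠ b) : cycleSum a b L e = 0 := by
  have hne : e ≠ s(a, b) := by
    rintro rfl
    rcases Sym2.mem_iff.1 hq with h | h
    exacts [ha h, hb h]
  rw [cycleSum, Pi.add_apply, pathSum_eq_zero hq hL, Pi.single_eq_of_ne hne, add_zero]

theorem exists_cycleSum_ne_zero {a b x y q : V} {t : List V} (hnd : (a :: x :: y :: t).Nodup)
    (hb : (a :: x :: y :: t).getLast? = some b) (hq : q ∈ a :: x :: y :: t) :
    ∃ e, q ∈ e ∧ cycleSum a b (a :: x :: y :: t) e ≠ 0 := by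
  have hr := pathSum_closing_edge hnd hb
  generalize a :: x :: y :: t = L at *
  obtain ⟨A, B, rfl⟩ := List.append_of_mem hq
  cases B with
  | nil =>
    have : q = b := by simpa using hb
    subst this
    refine ⟨s(a, q), Sym2.mem_mk_right _ _, ?_⟩
    rw [cycleSum, Pi.add_apply, hr, Pi.single_eq_same, zero_add]
    exact one_ne_zero
  | cons z B =>
    refine ⟨s(q, z), Sym2.mem_mk_left _ _, ?_⟩
    rw [cycleSum_consecutive hnd]
    · exact one_ne_zero
    · intro h
      rw [← h, pathSum_consecutive hnd] at hr
      exact one_ne_zero hr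

theorem cycleSum_chord (a b v c : V) (A B : List V) :
    cycleSum a b (a :: v :: (A ++ c :: B)) =
      cycleSum a b (a :: v :: c :: B) + cycleSum v c (v :: (A ++ [c])) := by
  have h : pathSum (v :: (A ++ c :: B)) = pathSum (v :: (A ++ [c])) + pathSum (c :: B) :=
    pathSum_append (v :: A) c B
  simp only [cycleSum, pathSum_cons_cons, h]
  ext e
  simp only [Pi.add_apply]
  have h2 := CharTwo.add_self_eq_zero ((Pi.single s(v, c) 1 : Sym2 V → ZMod 2) e)
  linear_combination -h2

end CycleChains

namespace RotationSystem

section Region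

variable {V : Type} {G : SimpleGraph V} {S : RotationSystem G} [LinearOrder V] [Fintype G.Dart]

/-- The edges on the boundaries of the faces where `s` is nonzero. -/
def edgeSupp (s : G.Dart → ZMod 2) : Finset (Sym2 V) :=
  (Finset.univ.filter fun d => s d ≠ 0).image SimpleGraph.Dart.edge

theorem mem_edgeSupp {s : G.Dart → ZMod 2} {e : Sym2 V} :
    e ∈ edgeSupp s ↔ ∃ d : G.Dart, s d ≠ 0 ∧ d.edge = e := by
  simp [edgeSupp]

theorem mem_erase_edgeSupp {s : G.Dart → ZMod 2} {e e' : Sym2 V} :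
    e ∈ (edgeSupp s).erase e' ↔ e ≠ e' ∧ e ∈ edgeSupp s :=
  Finset.mem_erase

theorem edge_mem_edgeSupp {s : G.Dart → ZMod 2} {d : G.Dart} :
    d.edge ∈ edgeSupp s ↔ s d ≠ 0 ∨ s d.symm ≠ 0 := by
  rw [mem_edgeSupp]
  constructor
  · rintro ⟨d', h, he⟩
    rcases (SimpleGraph.dart_edge_eq_iff _ _).1 he with rfl | rfl
    exacts [Or.inl h, Or.inr h]
  · rintro (h | h)
    exacts [⟨d, h, rfl⟩, ⟨d.symm, h, d.edge_symm⟩]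

theorem exists_mem_edgeSupp_iff {s : G.Dart → ZMod 2} (hs : S.FaceInvariant s) {q : V} :
    (∃ e ∈ edgeSupp s, q ∈ e) ↔ ∃ d : G.Dart, d.fst = q ∧ s d ≠ 0 := by
  constructor
  · rintro ⟨e, he, hq⟩
    obtain ⟨d, hd, rfl⟩ := mem_edgeSupp.1 he
    rcases Sym2.mem_iff.1 (show q ∈ s(d.fst, d.snd) from hq) with rfl | rfl
    · exact ⟨d, rfl, hd⟩
    · exact ⟨S.faceMap d, S.fst_faceMap d, by rwa [hs]⟩
  · rintro ⟨d, rfl, hd⟩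
    exact ⟨d.edge, mem_edgeSupp.2 ⟨d, hd, rfl⟩, Sym2.mem_mk_left _ _⟩

theorem mem_edgeSupp_of_edgeBd_ne_zero {s : G.Dart → ZMod 2} {e : Sym2 V}
    (h : edgeBd s e ≠ 0) : e ∈ edgeSupp s := by
  obtain ⟨d, hd, h⟩ := exists_dart_of_edgeBd_ne_zero h
  exact mem_edgeSupp.2 ⟨d, h, hd⟩

theorem FaceInvariant.rot_eq_add {s : G.Dart → ZMod 2} (hs : S.FaceInvariant s) (d : G.Dart) :
    s (S.rot d) = s d + edgeBd s d.edge := by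
  rw [hs.rot, edgeBd_edge, ← add_assoc, CharTwo.add_self_eq_zero, zero_add]

/-- Two regions with disjoint sets of faces meet only in boundary vertices. -/
theorem exists_edgeBd_ne_zero_of_common {s s' : G.Dart → ZMod 2} (hs : S.FaceInvariant s)
    (hdis : ∀ d, s d = 0 ∨ s' d = 0) {q : V} (h : ∃ d : G.Dart, d.fst = q ∧ s d ≠ 0)
    (h' : ∃ d : G.Dart, d.fst = q ∧ s' d ≠ 0) : ∃ e, q ∈ e ∧ edgeBd s e ≠ 0 := by
  obtain ⟨d, hd, hsd⟩ := h
  obtain ⟨d', hd', hsd'⟩ := h'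
  by_contra! hc
  have := eq_of_rot_eq (S := S) (s := s) (q := q) (fun d hd => by
    rw [hs.rot_eq_add, hc d.edge (hd ▸ Sym2.mem_mk_left _ _), add_zero]) hd hd'
  rcases hdis d' with h0 | h0
  · exact hsd (this.trans h0)
  · exact hsd' h0

/-- The graph polynomial of the region `s`, without the edge `ab`, has a monomial that avoids `a`
and `b`, has degree at most two on `L` and degree at most four everywhere. -/
def HasGoodMonomial (s : G.Dart → ZMod 2) (a b : V) (L : List V) : Prop :=
  ∃ m : V →₀ ℕ, coeff m (edgesPoly ((edgeSupp s).erase s(a, b))) ≠ 0 ∧ m a = 0 ∧ m b = 0 ∧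
    (∀ x ∈ L, m x ≤ 2) ∧ ∀ x, m x ≤ 4

theorem exists_dart_of_mem_boundary {s : G.Dart → ZMod 2} (hs : S.FaceInvariant s)
    {a b x y q : V} {t : List V} (hnd : (a :: x :: y :: t).Nodup)
    (hb : (a :: x :: y :: t).getLast? = some b)
    (hbd : edgeBd s = cycleSum a b (a :: x :: y :: t)) (hq : q ∈ a :: x :: y :: t) :
    ∃ d : G.Dart, d.fst = q ∧ s d ≠ 0 := by
  obtain ⟨e, hqe, he⟩ := exists_cycleSum_ne_zero hnd hb hq
  rw [← hbd] at he
  exact (exists_mem_edgeSupp_iff hs).1 ⟨e, mem_edgeSupp_of_edgeBd_ne_zero he, hqe⟩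

variable [Fintype V]

/-- A chord splits a region bounded by a cycle into two regions bounded by cycles. -/
theorem exists_chord_split (hS : S.IsPlane) {s : G.Dart → ZMod 2} (hs : S.FaceInvariant s)
    {a b v c : V} {A B : List V} (hA : A ≠ []) (hnd : (a :: v :: (A ++ c :: B)).Nodup)
    (hb : (a :: v :: (A ++ c :: B)).getLast? = some b) (hab : a ≠ b)
    (hbd : edgeBd s = cycleSum a b (a :: v :: (A ++ c :: B))) {d : G.Dart}
    (hde : d.edge = s(v, c)) (hsd : s d ≠ 0) (hsd' : s d.symm ≠ 0) :
    ∃ s₁ s₂, S.FaceInvariant s₁ ∧ S.FaceInvariant s₂ ∧ s = s₁ + s₂ ∧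
      (∀ d, s₁ d = 0 ∨ s₂ d = 0) ∧ edgeBd s₁ = cycleSum a b (a :: v :: c :: B) ∧
      edgeBd s₂ = cycleSum v c (v :: (A ++ [c])) := by
  obtain ⟨z, A, rfl⟩ := List.exists_cons_of_ne_nil hA
  have hr : pathSum (a :: v :: (z :: A ++ c :: B)) s(a, b) = 0 := pathSum_closing_edge hnd hb
  have hnd₂ : (v :: (z :: A ++ [c])).Nodup :=
    hnd.sublist (List.Sublist.cons _ (by simp))
  have hvc : v ≠ c := by
    rintro rfl
    simp at hnd₂
  have hpath : ∀ e, pathSum (v :: (z :: A ++ [c])) e ≠ 0 → edgeBd s e ≠ 0 := by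
    intro e he
    obtain ⟨A', x, y, B', hL, rfl⟩ := exists_consecutive_of_pathSum_ne_zero he
    have hL' : a :: v :: (z :: A ++ c :: B) = (a :: A') ++ x :: y :: (B' ++ B) := by
      have := congrArg (fun l => a :: (l ++ B)) hL
      simpa using this
    rw [hL'] at hnd hr
    rw [hbd, hL', cycleSum_consecutive hnd]
    · exact one_ne_zero
    · intro h
      rw [← h, pathSum_consecutive hnd] at hr
      exact one_ne_zero hr
  have hz : ∀ e, cycleSum v c (v :: (z :: A ++ [c])) e ≠ 0 → edgeBd s e ≠ 0 ∨ e = d.edge := by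
    intro e he
    by_cases h : e = d.edge
    · exact Or.inr h
    · rw [hde] at h
      rw [cycleSum, Pi.add_apply, Pi.single_eq_of_ne h, add_zero] at he
      exact Or.inl (hpath e he)
  have hcl : vertexBd (cycleSum v c (v :: (z :: A ++ [c]))) = 0 :=
    vertexBd_cycleSum hnd₂ (by simp [List.getLast?_cons]) hvc
  obtain ⟨f, hf, hfbd⟩ := exists_edgeBd_eq hS (h := cycleSum v c (v :: (z :: A ++ [c])))
    (fun e he => by
      rcases hz e he with h | rfl
      · obtain ⟨d', rfl, -⟩ := exists_dart_of_edgeBd_ne_zero h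
        exact d'.edge_mem
      · exact d.edge_mem) hcl
  have hg : S.FaceInvariant (s * f) := fun d => by rw [Pi.mul_apply, hs, hf]; rfl
  have hsplit := cycleSum_chord a b v c (z :: A) B
  rw [← hbd] at hsplit
  have hdis : ∀ d, (s + s * f) d = 0 ∨ (s * f) d = 0 := by
    intro d
    simp only [Pi.add_apply, Pi.mul_apply]
    generalize s d = x
    generalize f d = y
    revert x y
    decide
  have hsg : S.FaceInvariant (s + s * f) := fun d => by rw [Pi.add_apply, hs, hg]; rfl
  have hsum : s = s + s * f + s * f := by
    rw [add_assoc, add_self_eq_zero_of_zmod_two, add_zero]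
  have key := eq_zero_or_eq_of_support_cycle hnd hb hab hr
    (h := edgeBd (s * f) + cycleSum v c (v :: (z :: A ++ [c]))) (by
      intro e he
      rw [← hbd] at he
      rw [Pi.add_apply]
      by_cases hE : ∃ d' : G.Dart, d'.edge = e
      · obtain ⟨d', rfl⟩ := hE
        rw [edgeBd_edge] at he
        have heq : s d' = s d'.symm := CharTwo.add_eq_zero.1 he
        rw [edgeBd_edge, Pi.mul_apply, Pi.mul_apply, ← heq]
        by_cases h0 : s d' = 0
        · rw [h0, zero_mul, zero_mul, zero_add, zero_add]
          by_contra hne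
          rcases hz _ hne with h | h
          · rw [edgeBd_edge, he] at h
            exact h rfl
          · rcases (SimpleGraph.dart_edge_eq_iff _ _).1 h with rfl | rfl
            exacts [hsd h0, hsd' h0]
        · rw [eq_one_of_ne_zero_zmod_two h0, one_mul, one_mul, ← edgeBd_edge, hfbd]
          exact CharTwo.add_self_eq_zero _
      · have h1 : ∀ r : G.Dart → ZMod 2, edgeBd r e = 0 := by
          intro r
          by_contra hne
          obtain ⟨d', hd', -⟩ := exists_dart_of_edgeBd_ne_zero hne
          exact hE ⟨d', hd'⟩
        rw [← hfbd, h1, h1, add_zero]) (by rw [map_add, vertexBd_edgeBd hg, hcl, add_zero])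
  rcases key with h0 | h0
  · have h2 : edgeBd (s * f) = cycleSum v c (v :: (z :: A ++ [c])) := by
      ext e
      exact CharTwo.add_eq_zero.1 (congrFun h0 e)
    refine ⟨s + s * f, s * f, hsg, hg, hsum, hdis, ?_, h2⟩
    rw [map_add, hsplit, h2, add_assoc, add_self_eq_zero_of_zmod_two, add_zero]
  · have h2 : edgeBd (s * f) = cycleSum a b (a :: v :: c :: B) := by
      rw [← hbd, hsplit] at h0
      exact add_right_cancel h0
    refine ⟨s * f, s + s * f, hg, hsg, by rw [add_comm]; exact hsum, fun d => (hdis d).symm,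
      h2, ?_⟩
    rw [map_add, hsplit, h2, add_right_comm, add_self_eq_zero_of_zmod_two, zero_add]

end Region

end RotationSystem
namespace RotationSystem

section Induction

variable {V : Type} {G : SimpleGraph V} {S : RotationSystem G} [LinearOrder V] [Fintype G.Dart]

/-- Good monomials of the two sides of a chord multiply to a good monomial. -/
theorem HasGoodMonomial.of_chord {s s₁ s₂ : G.Dart → ZMod 2} (hs₁ : S.FaceInvariant s₁)
    (hs₂ : S.FaceInvariant s₂) (hsum : s = s₁ + s₂) (hdis : ∀ d, s₁ d = 0 ∨ s₂ d = 0)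
    {a b v c z : V} {A B : List V} (hnd : (a :: v :: (z :: A ++ c :: B)).Nodup)
    (hb : (a :: v :: (z :: A ++ c :: B)).getLast? = some b)
    (hbd₁ : edgeBd s₁ = cycleSum a b (a :: v :: c :: B))
    (hbd₂ : edgeBd s₂ = cycleSum v c (v :: (z :: A ++ [c])))
    (h₁ : HasGoodMonomial s₁ a b (a :: v :: c :: B))
    (h₂ : HasGoodMonomial s₂ v c (v :: (z :: A ++ [c]))) :
    HasGoodMonomial s a b (a :: v :: (z :: A ++ c :: B)) := by
  have hnd₁ : (a :: v :: c :: B).Nodup := hnd.sublist (by simp)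
  have hb₁ : (a :: v :: c :: B).getLast? = some b := by
    rw [← hb]; simp [List.getLast?_cons, List.getLast?_append]
  have hbm : b ∈ a :: v :: c :: B := List.mem_of_getLast? hb₁
  have hL₁ : ∀ q ∈ a :: v :: c :: B, ∃ e ∈ edgeSupp s₁, q ∈ e := fun q hq =>
    (exists_mem_edgeSupp_iff hs₁).2 (exists_dart_of_mem_boundary hs₁ hnd₁ hb₁ hbd₁ hq)
  have hL₂ : ∀ q ∈ v :: (z :: A ++ [c]), ∃ e ∈ edgeSupp s₂, q ∈ e := by
    intro q hq
    refine (exists_mem_edgeSupp_iff hs₂).2 ?_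
    have hnd₂ : (v :: (z :: A ++ [c])).Nodup := hnd.sublist (List.Sublist.cons _ (by simp))
    have hb₂ : (v :: (z :: A ++ [c])).getLast? = some c := by simp [List.getLast?_cons]
    obtain ⟨y, t, hyt⟩ := List.exists_cons_of_ne_nil (l := A ++ [c]) (by simp)
    rw [List.cons_append, hyt] at hnd₂ hb₂ hbd₂ hq
    exact exists_dart_of_mem_boundary hs₂ hnd₂ hb₂ hbd₂ hq
  have hcommon : ∀ q, (∃ e ∈ edgeSupp s₁, q ∈ e) → (∃ e ∈ edgeSupp s₂, q ∈ e) →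
      q = v ∨ q = c := by
    intro q hq₁ hq₂
    rw [exists_mem_edgeSupp_iff hs₁] at hq₁
    rw [exists_mem_edgeSupp_iff hs₂] at hq₂
    obtain ⟨e₁, hqe₁, he₁⟩ := exists_edgeBd_ne_zero_of_common hs₁ hdis hq₁ hq₂
    obtain ⟨e₂, hqe₂, he₂⟩ := exists_edgeBd_ne_zero_of_common hs₂ (fun d => (hdis d).symm) hq₂ hq₁
    rw [hbd₁] at he₁
    rw [hbd₂] at he₂
    by_contra! hc
    have m₁ : q ∈ a :: v :: c :: B := by
      by_contra hn
      refine he₁ (cycleSum_eq_zero hqe₁ hn (fun h => hn ?_) fun h => hn ?_)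
      · simp [h]
      · rwa [h]
    have m₂ : q ∈ v :: (z :: A ++ [c]) := by
      by_contra hn
      exact he₂ (cycleSum_eq_zero hqe₂ hn hc.1 hc.2)
    simp only [List.mem_cons, hc.1, hc.2, false_or, List.mem_append, List.not_mem_nil, or_false,
      List.cons_append] at m₁ m₂
    simp only [List.nodup_cons, List.nodup_append, List.mem_cons, List.mem_append,
      List.cons_append] at hnd
    grind
  have hcomm₂ : ∀ q, (∃ e ∈ edgeSupp s₁, q ∈ e) → ∀ m : V →₀ ℕ,
      coeff m (edgesPoly ((edgeSupp s₂).erase s(v, c))) ≠ 0 → m v = 0 → m c = 0 → m q = 0 := by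
    intro q hq m hm hv hc
    by_cases h : ∃ e ∈ edgeSupp s₂, q ∈ e
    · rcases hcommon q hq h with rfl | rfl
      exacts [hv, hc]
    · exact exponent_eq_zero hm fun e he hqe => h ⟨e, Finset.mem_of_mem_erase he, hqe⟩
  have hav : a ≠ v := by rintro rfl; simp at hnd
  have hac : a ≠ c := by rintro rfl; simp at hnd
  have hab₂ : s(a, b) ∉ edgeSupp s₂ := by
    intro h
    rcases hcommon a (hL₁ a (by simp)) ⟨_, h, Sym2.mem_mk_left _ _⟩ with h | h
    exacts [hav h, hac h]
  have hvcab : s(v, c) ≠ s(a, b) := by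
    intro h
    have : a ∈ s(v, c) := h ▸ Sym2.mem_mk_left a b
    rcases Sym2.mem_iff.1 this with h | h
    exacts [hav h, hac h]
  have hvc₁ : s(v, c) ∈ edgeSupp s₁ := by
    refine mem_edgeSupp_of_edgeBd_ne_zero ?_
    have h : cycleSum a b (a :: v :: c :: B) s(v, c) = 1 :=
      cycleSum_consecutive (A := [a]) hnd₁ hvcab
    rw [hbd₁, h]
    exact one_ne_zero
  have hunion : edgeSupp s = edgeSupp s₁ ∪ edgeSupp s₂ := by
    ext e
    have hd : ∀ d : G.Dart, s d ≠ 0 ↔ s₁ d ≠ 0 ∨ s₂ d ≠ 0 := by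
      intro d
      rw [hsum, Pi.add_apply]
      rcases hdis d with h | h <;> simp [h]
    simp only [Finset.mem_union, mem_edgeSupp, hd, or_and_right, exists_or]
  have hE : (edgeSupp s).erase s(a, b) =
      (edgeSupp s₁).erase s(a, b) ∪ (edgeSupp s₂).erase s(v, c) := by
    ext e
    simp only [hunion, Finset.mem_erase, Finset.mem_union]
    constructor
    · rintro ⟨hne, h | h⟩
      · exact Or.inl ⟨hne, h⟩
      · by_cases hvc : e = s(v, c)
        · exact Or.inl ⟨hne, hvc ▸ hvc₁⟩
        · exact Or.inr ⟨hvc, h⟩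
    · rintro (⟨hne, h⟩ | ⟨hne, h⟩)
      · exact ⟨hne, Or.inl h⟩
      · exact ⟨fun h' => hab₂ (h' ▸ h), Or.inr h⟩
  have hdisj : Disjoint ((edgeSupp s₁).erase s(a, b)) ((edgeSupp s₂).erase s(v, c)) := by
    rw [Finset.disjoint_left]
    intro e he₁ he₂
    obtain ⟨hne, he₂⟩ := Finset.mem_erase.1 he₂
    have he₁ := Finset.mem_of_mem_erase he₁
    obtain ⟨d, -, rfl⟩ := mem_edgeSupp.1 he₁
    have hf := hcommon d.fst ⟨_, he₁, Sym2.mem_mk_left _ _⟩ ⟨_, he₂, Sym2.mem_mk_left _ _⟩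
    have hs := hcommon d.snd ⟨_, he₁, Sym2.mem_mk_right _ _⟩ ⟨_, he₂, Sym2.mem_mk_right _ _⟩
    have hn := d.fst_ne_snd
    refine hne ?_
    change s(d.fst, d.snd) = s(v, c)
    rcases hf with hf | hf <;> rcases hs with hs | hs
    · exact (hn (hf.trans hs.symm)).elim
    · rw [hf, hs]
    · rw [hf, hs, Sym2.eq_swap]
    · exact (hn (hf.trans hs.symm)).elim
  obtain ⟨m₁, hm₁, ha₁, hb₁', hL₁', h4₁⟩ := h₁
  obtain ⟨m₂, hm₂, hv₂, hc₂, hL₂', h4₂⟩ := h₂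
  have hzero : ∀ q, (∃ e ∈ edgeSupp s₁, q ∈ e) → m₂ q = 0 := fun q hq =>
    hcomm₂ q hq m₂ hm₂ hv₂ hc₂
  have hzero₁ : ∀ q, (¬ ∃ e ∈ edgeSupp s₁, q ∈ e) → m₁ q = 0 := fun q hq =>
    exponent_eq_zero hm₁ fun e he hqe => hq ⟨e, Finset.mem_of_mem_erase he, hqe⟩
  refine ⟨m₁ + m₂, ?_, ?_, ?_, ?_, ?_⟩
  · rw [hE]
    refine coeff_add_ne_zero hdisj ?_ hm₁ hm₂ hv₂ hc₂
    rintro q ⟨e₁, he₁, hq₁⟩ ⟨e₂, he₂, hq₂⟩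
    exact hcommon q ⟨e₁, Finset.mem_of_mem_erase he₁, hq₁⟩ ⟨e₂, Finset.mem_of_mem_erase he₂, hq₂⟩
  · rw [Finsupp.add_apply, ha₁, hzero a (hL₁ a (by simp))]
  · rw [Finsupp.add_apply, hb₁', hzero b (hL₁ b hbm)]
  · intro x hx
    rw [Finsupp.add_apply]
    by_cases h : x ∈ a :: v :: c :: B
    · rw [hzero x (hL₁ x h), add_zero]
      exact hL₁' x h
    · have hx₂ : x ∈ v :: (z :: A ++ [c]) := by
        simp only [List.mem_cons, List.mem_append, List.cons_append] at hx h ⊢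
        tauto
      rw [hzero₁, zero_add]
      · exact hL₂' x hx₂
      · intro hx₁
        rcases hcommon x hx₁ (hL₂ x hx₂) with rfl | rfl <;> simp at h
  · intro x
    rw [Finsupp.add_apply]
    by_cases h : ∃ e ∈ edgeSupp s₁, x ∈ e
    · rw [hzero x h, add_zero]
      exact h4₁ x
    · rw [hzero₁ x h, zero_add]
      exact h4₂ x

/-- A good monomial survives adding a boundary vertex `v` with the triangles around it. -/
theorem HasGoodMonomial.of_fan {s : G.Dart → ZMod 2} (hs : S.FaceInvariant s)
    (htri : ∀ d, s d ≠ 0 → S.faceMap (S.faceMap (S.faceMap d)) = d)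
    {a b v w : V} {us rest : List V} (hnd : (a :: v :: w :: rest).Nodup)
    (hb : (a :: v :: w :: rest).getLast? = some b)
    (hus : (a :: (us ++ [w])).Nodup) (hus' : (a :: (us ++ w :: rest)).Nodup)
    (hmem : ∀ x, x ∈ a :: (us ++ [w]) ↔
      ∃ d : G.Dart, d.fst = v ∧ d.snd = x ∧ (s d ≠ 0 ∨ s d.symm ≠ 0))
    (hfan : ∀ d : G.Dart, d.fst = v → s d ≠ 0 → ∃ A x y B,
      a :: (us ++ [w]) = A ++ x :: y :: B ∧ (S.faceMap d).edge = s(x, y))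
    (hbd : edgeBd (s + S.starPart s v) = cycleSum a b (a :: (us ++ w :: rest)))
    (h : HasGoodMonomial (s + S.starPart s v) a b (a :: (us ++ w :: rest))) :
    HasGoodMonomial s a b (a :: v :: w :: rest) := by
  have hbm : b ∈ w :: rest := List.mem_of_getLast? (by simpa using hb)
  have hva : v ≠ a := by rintro rfl; simp at hnd
  have hvb : v ≠ b := by
    rintro rfl
    rw [List.nodup_cons, List.nodup_cons] at hnd
    exact hnd.2.1 hbm
  have hab : a ≠ b := by
    rintro rfl
    rw [List.nodup_cons] at hnd
    exact hnd.1 (List.mem_cons_of_mem _ hbm)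
  have hbus : b ∉ us := by
    rw [List.nodup_cons, List.nodup_append'] at hus'
    exact fun h => hus'.2.2.2 h hbm
  have hvfan : v ∉ a :: (us ++ [w]) := by
    intro hv
    obtain ⟨d, hd, hd', -⟩ := (hmem v).1 hv
    exact d.fst_ne_snd (hd.trans hd'.symm)
  have hs' : S.FaceInvariant (s + S.starPart s v) := fun d => by
    rw [Pi.add_apply, hs, faceInvariant_starPart hs htri]; rfl
  have hstar : ∀ d, (s + S.starPart s v) d =
      if d.fst = v ∨ d.snd = v ∨ (S.faceMap (S.faceMap d)).fst = v then 0 else s d := by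
    intro d
    rw [Pi.add_apply, starPart_eq hs htri]
    split_ifs
    · exact CharTwo.add_self_eq_zero _
    · exact add_zero _
  have hv' : ∀ e ∈ (edgeSupp (s + S.starPart s v)).erase s(a, b), v ∉ e := by
    intro e he hve
    obtain ⟨d, hd, hsd⟩ := (exists_mem_edgeSupp_iff hs').1 ⟨e, Finset.mem_of_mem_erase he, hve⟩
    exact hsd (by rw [hstar, if_pos (Or.inl hd)])
  have hE : (edgeSupp s).erase s(a, b) = (edgeSupp (s + S.starPart s v)).erase s(a, b) ∪
      ((a :: w :: us).map fun n => s(v, n)).toFinset := by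
    have hperm : ∀ x, x ∈ a :: w :: us ↔ x ∈ a :: (us ++ [w]) := by
      intro x
      simp only [List.mem_cons, List.mem_append, List.not_mem_nil, or_false]
      tauto
    ext e
    simp only [Finset.mem_erase, Finset.mem_union, List.mem_toFinset, List.mem_map, hperm]
    constructor
    · rintro ⟨hne, he⟩
      obtain ⟨d, hd, rfl⟩ := mem_edgeSupp.1 he
      by_cases h1 : d.fst = v
      · exact Or.inr ⟨d.snd, (hmem _).2 ⟨d, h1, rfl, Or.inl hd⟩, by rw [← h1]; rfl⟩
      by_cases h2 : d.snd = v
      · refine Or.inr ⟨d.fst, (hmem _).2 ⟨d.symm, h2, rfl, Or.inr ?_⟩, ?_⟩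
        · rwa [SimpleGraph.Dart.symm_symm]
        · rw [← h2, Sym2.eq_swap]; rfl
      refine Or.inl ⟨hne, ?_⟩
      by_cases h3 : (S.faceMap (S.faceMap d)).fst = v
      · obtain ⟨A, x, y, B, hl, hxy⟩ := hfan _ h3 (by rwa [hs, hs])
        rw [htri d hd] at hxy
        have hl' : a :: (us ++ w :: rest) = A ++ x :: y :: (B ++ rest) := by
          simpa using congrArg (fun l => l ++ rest) hl
        rw [hl'] at hbd hus'
        refine mem_edgeSupp_of_edgeBd_ne_zero ?_
        rw [hbd, hxy, cycleSum_consecutive hus' (hxy ▸ hne)]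
        exact one_ne_zero
      · refine mem_edgeSupp.2 ⟨d, ?_, rfl⟩
        rw [hstar, if_neg (by tauto)]
        exact hd
    · rintro (⟨hne, he⟩ | ⟨x, hx, rfl⟩)
      · refine ⟨hne, ?_⟩
        obtain ⟨d, hd, rfl⟩ := mem_edgeSupp.1 he
        refine mem_edgeSupp.2 ⟨d, fun h0 => hd ?_, rfl⟩
        rw [hstar, h0, ite_self]
      · obtain ⟨d, rfl, rfl, h⟩ := (hmem x).1 hx
        refine ⟨fun h => ?_, edge_mem_edgeSupp.2 h⟩
        have : d.fst ∈ s(a, b) := h ▸ Sym2.mem_mk_left _ _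
        rcases Sym2.mem_iff.1 this with h | h
        exacts [hva h, hvb h]
  obtain ⟨m, hm, hma, hmb, hmL, hm4⟩ := h
  obtain ⟨m', hm', ha', hb', hv2, hw2, hus4, hrest⟩ := exists_coeff_star_ne_zero
    (v := v) (a := a) (w := w) (b := b) (us := us)
    (fun m hm => exponent_eq_zero hm hv') (List.nodup_cons.2 ⟨hvfan, hus⟩) hab hvb hbus hm hma hmb
    (hmL w (by simp)) (fun u hu => hmL u (by simp [hu]))
  have hndl : (a :: w :: us).Nodup := by
    have : (a :: (us ++ [w])).Perm (a :: w :: us) := by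
      simp
    exact this.nodup hus
  have hdisj : ∀ x ∈ rest, x ≠ v ∧ x ≠ w ∧ x ∉ us := by
    intro x hx
    simp only [List.nodup_cons, List.mem_cons, not_or, List.nodup_append'] at hnd hus'
    refine ⟨?_, ?_, fun hu => hus'.2.2.2 hu (List.mem_cons_of_mem _ hx)⟩
    · rintro rfl; exact hnd.2.1.2 hx
    · rintro rfl; exact hnd.2.2.1 hx
  refine ⟨m', ?_, ha', hb', ?_, ?_⟩
  · rwa [hE, edgesPoly_union_star _ _ _ hndl hv']
  · intro x hx
    simp only [List.mem_cons] at hx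
    rcases hx with rfl | rfl | rfl | hx
    · omega
    · exact hv2
    · exact hw2
    · obtain ⟨h1, h2, h3⟩ := hdisj x hx
      rw [hrest x h1 h2 h3]
      exact hmL x (by simp [hx])
  · intro x
    by_cases h1 : x = v
    · rw [h1]; omega
    by_cases h2 : x = w
    · rw [h2]; omega
    by_cases h3 : x ∈ us
    · exact hus4 x h3
    · rw [hrest x h1 h2 h3]
      exact hm4 x

theorem card_support_lt {V : Type} {G : SimpleGraph V} [Fintype G.Dart]
    {s s' : G.Dart → ZMod 2} (hle : ∀ d, s' d ≠ 0 → s d ≠ 0)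
    (hlt : ∃ d, s d ≠ 0 ∧ s' d = 0) :
    (Finset.univ.filter fun d => s' d ≠ 0).card < (Finset.univ.filter fun d => s d ≠ 0).card := by
  obtain ⟨d, hd, hd'⟩ := hlt
  refine Finset.card_lt_card (Finset.ssubset_iff_of_subset ?_ |>.2 ⟨d, ?_, ?_⟩)
  · intro d
    simpa using hle d
  · simpa using hd
  · simpa using hd'

variable [Fintype V]

/-- A triangulated region bounded by a cycle through the edge `ab` has a good monomial. -/
theorem hasGoodMonomial_of_edgeBd_eq (hS : S.IsPlane) {s : G.Dart → ZMod 2}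
    (hs : S.FaceInvariant s) (htri : ∀ d, s d ≠ 0 → S.faceMap (S.faceMap (S.faceMap d)) = d)
    (h0 : ∃ d, s d = 0) {a b : V} {t : List V} (hnd : (a :: t).Nodup)
    (hb : (a :: t).getLast? = some b) (hab : a ≠ b) (hbd : edgeBd s = cycleSum a b (a :: t)) :
    HasGoodMonomial s a b (a :: t) := by
  induction hn : (Finset.univ.filter fun d => s d ≠ 0).card using Nat.strong_induction_on
    generalizing s a b t with
  | _ n ih =>
  subst hn
  obtain ⟨d₀, hd₀⟩ := h0
  match t, hnd, hb, hbd with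
  | [], _, hb, _ => simp [hab] at hb
  | [b'], hnd, hb, hbd =>
    have : b' = b := by simpa using hb
    subst this
    have hzero : ∀ d, s d = 0 := by
      have hsymm : ∀ d : G.Dart, s d.symm = s d := by
        intro d
        have h1 := congrFun hbd d.edge
        rw [edgeBd_edge, cycleSum, pathSum_cons_cons, Pi.add_apply, Pi.add_apply] at h1
        simp only [pathSum, Pi.zero_apply, add_zero, CharTwo.add_self_eq_zero] at h1
        exact (CharTwo.add_eq_zero.1 h1).symm
      intro d
      rw [hs.eq_of_symm hS.1 hsymm d d₀, hd₀]
    have hE : edgeSupp s = ∅ := by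
      ext e
      simp [mem_edgeSupp, hzero]
    refine ⟨0, ?_, by simp, by simp, by simp, by simp⟩
    rw [hE]
    simp [edgesPoly]
  | v :: w :: rest, hnd, hb, hbd =>
    have hbm : b ∈ w :: rest := List.mem_of_getLast? (by simpa using hb)
    have hnd' := hnd
    simp only [List.nodup_cons, List.mem_cons, not_or] at hnd'
    obtain ⟨⟨hav, haw, har⟩, ⟨hvw, hvr⟩, hwr, hrest⟩ := hnd'
    have hvb : v ≠ b := by
      rintro rfl
      rcases List.mem_cons.1 hbm with h | h
      exacts [hvw h, hvr h]
    by_cases hchord : ∃ d : G.Dart, d.fst = v ∧ (s d ≠ 0 ∨ s d.symm ≠ 0) ∧ d.snd ∈ rest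
    · obtain ⟨d, hdv, hsd, hdr⟩ := hchord
      obtain ⟨A, B, hAB⟩ := List.append_of_mem hdr
      generalize hc : d.snd = c at hAB
      have hde : d.edge = s(v, c) := by rw [← hdv, ← hc]; rfl
      have hvc0 : edgeBd s d.edge = 0 := by
        rw [hbd, hde, cycleSum, Pi.add_apply, pathSum_cons_cons, pathSum_cons_cons, Pi.add_apply,
          Pi.add_apply, pathSum_eq_zero (Sym2.mem_mk_left v c) (by simp [hvw, hvr])]
        have hcr : c ∈ rest := hc ▸ hdr
        have hca : a ≠ c := by rintro rfl; exact har hcr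
        have hcw : w ≠ c := by rintro rfl; exact hwr hcr
        rw [Pi.single_eq_of_ne, Pi.single_eq_of_ne, Pi.single_eq_of_ne]
        · simp
        all_goals
          rw [Ne, Sym2.eq_iff]
          grind
      rw [edgeBd_edge] at hvc0
      have heq : s d = s d.symm := CharTwo.add_eq_zero.1 hvc0
      rw [← heq, or_self] at hsd
      subst hAB
      change HasGoodMonomial s a b (a :: v :: (w :: A ++ c :: B))
      obtain ⟨s₁, s₂, hs₁, hs₂, hsum, hdis, hbd₁, hbd₂⟩ := exists_chord_split hS hs (A := w :: A)
        (by simp) hnd hb hab hbd hde hsd (heq ▸ hsd)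
      have hle₁ : ∀ d, s₁ d ≠ 0 → s d ≠ 0 := by
        intro d hd
        rw [hsum, Pi.add_apply, (hdis d).resolve_left hd, add_zero]
        exact hd
      have hle₂ : ∀ d, s₂ d ≠ 0 → s d ≠ 0 := by
        intro d hd
        rw [hsum, Pi.add_apply, (hdis d).resolve_right hd, zero_add]
        exact hd
      have hnd₁ : (a :: v :: c :: B).Nodup := hnd.sublist (by simp)
      have hnd₂ : (v :: (w :: A ++ [c])).Nodup := hnd.sublist (List.Sublist.cons _ (by simp))
      have hb₁ : (a :: v :: c :: B).getLast? = some b := by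
        rw [← hb]; simp [List.getLast?_cons, List.getLast?_append]
      have hb₂ : (v :: (w :: A ++ [c])).getLast? = some c := by simp [List.getLast?_cons]
      obtain ⟨d₁, -, hd₁⟩ := exists_dart_of_mem_boundary hs₁ hnd₁ hb₁ hbd₁ (q := a) (by simp)
      have hd₂ : ∃ d, s₂ d ≠ 0 := by
        obtain ⟨y, t, hyt⟩ := List.exists_cons_of_ne_nil (l := A ++ [c]) (by simp)
        have hnd₂' := hnd₂
        have hb₂' := hb₂
        have hbd₂' := hbd₂
        rw [List.cons_append, hyt] at hnd₂' hb₂' hbd₂'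
        obtain ⟨d, -, hd⟩ := exists_dart_of_mem_boundary hs₂ hnd₂' hb₂' hbd₂' (q := v) (by simp)
        exact ⟨d, hd⟩
      obtain ⟨d₂, hd₂⟩ := hd₂
      have hvc : v ≠ c := by rw [← hc, ← hdv]; exact d.fst_ne_snd
      refine HasGoodMonomial.of_chord hs₁ hs₂ hsum hdis hnd hb hbd₁ hbd₂ ?_ ?_
      · exact ih _ (card_support_lt hle₁ ⟨d₂, hle₂ d₂ hd₂, (hdis d₂).resolve_right hd₂⟩) hs₁
          (fun d hd => htri d (hle₁ d hd)) ⟨d₀, by_contra fun h => hle₁ d₀ h hd₀⟩ hnd₁ hb₁ hab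
          hbd₁ rfl
      · exact ih _ (card_support_lt hle₂ ⟨d₁, hle₁ d₁ hd₁, (hdis d₁).resolve_left hd₁⟩) hs₂
          (fun d hd => htri d (hle₂ d hd)) ⟨d₀, by_contra fun h => hle₂ d₀ h hd₀⟩ hnd₂ hb₂ hvc
          hbd₂ rfl
    · have hval : ∀ x, edgeBd s s(v, x) = if x = a ∨ x = w then 1 else 0 := by
        intro x
        rw [hbd, cycleSum, Pi.add_apply, pathSum_cons_cons, pathSum_cons_cons, Pi.add_apply,
          Pi.add_apply, pathSum_eq_zero (Sym2.mem_mk_left v x) (by simp [hvw, hvr])]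
        simp only [Pi.single_apply, Sym2.eq_iff]
        have := Ne.symm hav
        by_cases h1 : x = a
        · subst h1
          simp [hvb, this, haw, hvw]
        · simp [hvb, this, h1, hvw]
      have hdart : ∀ x, x = a ∨ x = w → ∃ d : G.Dart, d.fst = v ∧ d.snd = x := by
        intro x hx
        obtain ⟨d, hd, -⟩ := exists_dart_of_edgeBd_ne_zero (s := s) (e := s(v, x)) (by
          rw [hval, if_pos hx]; exact one_ne_zero)
        have : G.Adj v x := by
          rw [← SimpleGraph.mem_edgeSet, ← hd]; exact d.edge_mem
        exact ⟨⟨(v, x), this⟩, rfl, rfl⟩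
      obtain ⟨da, hda, hda'⟩ := hdart a (Or.inl rfl)
      obtain ⟨dw, hdw, hdw'⟩ := hdart w (Or.inr rfl)
      have hne : da ≠ dw := by rintro rfl; exact haw (hda'.symm.trans hdw')
      obtain ⟨us, hus, hmem, hfan, hstar⟩ := exists_fan hs htri hne hda hdw (by
        intro d hd
        have hde : d.edge = s(v, d.snd) := by rw [← hd]; rfl
        rw [hs.rot_eq_add, hde, hval]
        have hiff : ∀ d' : G.Dart, d'.fst = v → (d = d' ↔ d.snd = d'.snd) := fun d' hd' =>
          ⟨fun h => by rw [h], fun h => dart_eq_of_snd_eq (hd.trans hd'.symm) h⟩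
        simp only [hiff da hda, hiff dw hdw, hda', hdw'])
      rw [hda', hdw'] at hus hmem hfan hstar
      have hus' : (a :: (us ++ w :: rest)).Nodup := by
        have h1 : ∀ x ∈ a :: (us ++ [w]), x ∉ rest := by
          intro x hx hxr
          obtain ⟨d, hd, rfl, h⟩ := (hmem x).1 hx
          exact hchord ⟨d, hd, h, hxr⟩
        have h2 : a :: (us ++ w :: rest) = (a :: (us ++ [w])) ++ rest := by simp
        rw [h2, List.nodup_append']
        exact ⟨hus, hrest, fun x hx hx' => h1 x hx hx'⟩
      have hbd' : edgeBd (s + S.starPart s v) = cycleSum a b (a :: (us ++ w :: rest)) := by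
        have h1 : pathSum (a :: (us ++ w :: rest)) =
            pathSum (a :: (us ++ [w])) + pathSum (w :: rest) := pathSum_append (a :: us) w rest
        rw [map_add, hbd, hstar, cycleSum, cycleSum, h1, pathSum_cons_cons, pathSum_cons_cons]
        ext e
        simp only [Pi.add_apply]
        rw [Sym2.eq_swap (a := a) (b := v)]
        have e1 := CharTwo.add_self_eq_zero ((Pi.single s(v, a) 1 : Sym2 V → ZMod 2) e)
        have e2 := CharTwo.add_self_eq_zero ((Pi.single s(v, w) 1 : Sym2 V → ZMod 2) e)
        linear_combination e1 + e2
      have hle : ∀ d, (s + S.starPart s v) d ≠ 0 → s d ≠ 0 := by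
        intro d hd h
        rw [Pi.add_apply, starPart_eq hs htri, h, ite_self, add_zero] at hd
        exact hd rfl
      obtain ⟨d₁, hd₁, hsd₁⟩ := exists_dart_of_mem_boundary hs hnd hb hbd (q := v) (by simp)
      refine HasGoodMonomial.of_fan hs htri hnd hb hus hus' hmem hfan hbd' ?_
      refine ih _ (card_support_lt hle ⟨d₁, hsd₁, ?_⟩) (fun d => ?_)
        (fun d hd => htri d (hle d hd)) ⟨d₀, by_contra fun h => hle d₀ h hd₀⟩ hus' ?_ hab hbd' rfl
      · rw [Pi.add_apply, starPart_eq hs htri, if_pos (Or.inl hd₁)]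
        exact CharTwo.add_self_eq_zero _
      · rw [Pi.add_apply, hs, faceInvariant_starPart hs htri]; rfl
      · rw [← hb]; simp [List.getLast?_cons, List.getLast?_append]

end Induction

end RotationSystem
namespace RotationSystem

section Faces

variable {V : Type} {G : SimpleGraph V} {S : RotationSystem G}

theorem exists_iterate_of_faceOf_eq [Finite G.Dart] {d d' : G.Dart}
    (h : S.faceOf d' = S.faceOf d) :
    ∃ i < Function.minimalPeriod S.faceMap d, S.faceMap^[i] d = d' := by
  have hcyc : S.faceMap.SameCycle d d' := Quotient.exact h.symm
  obtain ⟨i, rfl⟩ := hcyc.exists_nat_pow_eq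
  refine ⟨i % Function.minimalPeriod S.faceMap d, Nat.mod_lt _ ?_, ?_⟩
  · exact Function.minimalPeriod_pos_of_mem_periodicPts (S.faceMap.injective.mem_periodicPts d)
  · rw [Function.iterate_mod_minimalPeriod_eq, Equiv.Perm.iterate_eq_pow]

theorem faceOf_iterate (d : G.Dart) (i : ℕ) : S.faceOf (S.faceMap^[i] d) = S.faceOf d := by
  induction i with
  | zero => rfl
  | succ i ih => rw [Function.iterate_succ_apply', faceOf_faceMap, ih]

theorem filter_faceOf_eq [Fintype G.Dart] [DecidableEq G.Dart] (d : G.Dart)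
    [DecidablePred fun d' => S.faceOf d' = S.faceOf d] :
    (Finset.univ.filter fun d' => S.faceOf d' = S.faceOf d) =
      (Finset.range (Function.minimalPeriod S.faceMap d)).image fun i => S.faceMap^[i] d := by
  ext d'
  simp only [Finset.mem_filter, Finset.mem_univ, true_and, Finset.mem_image, Finset.mem_range]
  constructor
  · exact exists_iterate_of_faceOf_eq
  · rintro ⟨i, -, rfl⟩
    exact faceOf_iterate d i

theorem iterate_injOn_range (d : G.Dart) :
    Set.InjOn (fun i => S.faceMap^[i] d)
      (Finset.range (Function.minimalPeriod S.faceMap d) : Set ℕ) := by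
  rw [Finset.coe_range]
  exact Function.iterate_injOn_Iio_minimalPeriod

theorem faceSize_faceOf [Finite G.Dart] (d : G.Dart) :
    S.faceSize (S.faceOf d) = Function.minimalPeriod S.faceMap d := by
  classical
  let _ : Fintype G.Dart := Fintype.ofFinite _
  rw [faceSize, Nat.card_eq_fintype_card, Fintype.card_subtype, filter_faceOf_eq,
    Finset.card_image_of_injOn (iterate_injOn_range d), Finset.card_range]

theorem iterate_three_of_faceSize [Finite G.Dart] {d : G.Dart}
    (h : S.faceSize (S.faceOf d) = 3) : S.faceMap (S.faceMap (S.faceMap d)) = d := by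
  have := Function.iterate_minimalPeriod (f := S.faceMap) (x := d)
  rwa [← faceSize_faceOf, h] at this

end Faces

section TwoConnected

variable {V : Type} [Fintype V] [LinearOrder V] {G : SimpleGraph V} {S : RotationSystem G}

theorem exists_chain_of_walk_deleteVerts {x : V} {u w : ((⊤ : G.Subgraph).deleteVerts {x}).verts}
    (p : ((⊤ : G.Subgraph).deleteVerts {x}).coe.Walk u w) :
    ∃ h : Sym2 V → ZMod 2, (∀ e, h e ≠ 0 → e ∈ G.edgeSet) ∧ (∀ e, x ∈ e → h e = 0) ∧
      vertexBd h = Pi.single (u : V) 1 + Pi.single (w : V) 1 := by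
  induction p with
  | nil => exact ⟨0, by simp, by simp, by rw [map_zero, add_self_eq_zero_of_zmod_two]⟩
  | @cons u v w huv p ih =>
    obtain ⟨h, h1, h2, h3⟩ := ih
    have hadj := SimpleGraph.Subgraph.deleteVerts_adj.1 huv
    have hG : G.Adj u v := hadj.2.2.2.2
    refine ⟨Pi.single s((u : V), (v : V)) 1 + h, ?_, ?_, ?_⟩
    · intro e he
      by_cases hE : e = s((u : V), (v : V))
      · rw [hE]; exact hG
      · rw [Pi.add_apply, Pi.single_eq_of_ne hE, zero_add] at he
        exact h1 e he
    · intro e he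
      have hE : e ≠ s((u : V), (v : V)) := by
        rintro rfl
        rcases Sym2.mem_iff.1 he with hx | hx
        · exact hadj.2.1 hx.symm
        · exact hadj.2.2.2.1 hx.symm
      rw [Pi.add_apply, Pi.single_eq_of_ne hE, h2 e he, add_zero]
    · rw [map_add, vertexBd_single hG.ne, h3, add_assoc, ← add_assoc (Pi.single (v : V) 1),
        add_self_eq_zero_of_zmod_two, zero_add]

/-- A face of a 2-connected plane graph visits every vertex at most once. -/
theorem eq_of_faceOf_eq_of_fst_eq [Fintype G.Dart] (hS : S.IsPlane) (hG : TwoConnected G)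
    {d d' : G.Dart} (hface : S.faceOf d = S.faceOf d') (hfst : d.fst = d'.fst) : d = d' := by
  by_contra hne
  have hmem : ∀ d' : G.Dart, d'.fst = d.fst →
      d'.snd ∈ ((⊤ : G.Subgraph).deleteVerts {d.fst}).verts := by
    intro d' h
    simp [← h]
  obtain ⟨p⟩ := (hG.2 d.fst).preconnected ⟨d.snd, hmem d rfl⟩ ⟨d'.snd, hmem d' hfst.symm⟩
  obtain ⟨h, h1, h2, h3⟩ := exists_chain_of_walk_deleteVerts p
  obtain ⟨f, hf, hfbd⟩ := exists_edgeBd_eq hS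
    (h := h + (Pi.single d.edge 1 + Pi.single d'.edge 1)) (by
      intro e he
      by_cases e1 : e = d.edge
      · rw [e1]; exact d.edge_mem
      by_cases e2 : e = d'.edge
      · rw [e2]; exact d'.edge_mem
      refine h1 e ?_
      simpa [e1, e2] using he) (by
      have hv : ∀ d : G.Dart, vertexBd (Pi.single d.edge 1) =
          Pi.single d.fst 1 + Pi.single d.snd 1 := fun d => vertexBd_single d.fst_ne_snd
      have e4 : (Pi.single d.fst 1 : V → ZMod 2) = Pi.single d'.fst 1 := by rw [hfst]
      rw [map_add, map_add, h3, hv, hv]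
      have e1 := add_self_eq_zero_of_zmod_two (Pi.single d.snd 1 : V → ZMod 2)
      have e2 := add_self_eq_zero_of_zmod_two (Pi.single d'.snd 1 : V → ZMod 2)
      have e3 := add_self_eq_zero_of_zmod_two (Pi.single d'.fst 1 : V → ZMod 2)
      linear_combination e1 + e2 + e3 + e4)
  obtain ⟨n, hn0, hn, -, -, hone⟩ := exists_arc (S := S) (s := f) hne hfst (by
    intro c hc
    have hiff : ∀ d' : G.Dart, d'.fst = d.fst → (c.edge = d'.edge ↔ c = d') := by
      intro d' hd'
      refine ⟨fun h => ?_, fun h => by rw [h]⟩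
      rcases (SimpleGraph.dart_edge_eq_iff _ _).1 h with h | rfl
      · exact h
      · exact (d'.fst_ne_snd (hd'.trans hc.symm)).elim
    rw [hf.rot_eq_add, hfbd, Pi.add_apply, Pi.add_apply,
      h2 _ (hc ▸ Sym2.mem_mk_left c.fst c.snd), zero_add]
    simp only [Pi.single_apply, hiff d rfl, hiff d' hfst.symm]
    by_cases hcd : c = d
    · have : d ≠ d' := hne
      simp [hcd, this]
    · simp [hcd])
  have h4 := hone n le_rfl hn0
  rw [hn, hf.eq_of_faceOf_eq hface] at h4
  exact one_ne_zero (left_eq_add.1 h4)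

/-- An edge of a 2-connected plane graph lies on two different faces. -/
theorem faceOf_symm_ne [Fintype G.Dart] (hS : S.IsPlane) (hG : TwoConnected G) (d : G.Dart) :
    S.faceOf d.symm ≠ S.faceOf d := by
  intro h
  have hrot : S.rot d = d := by
    refine eq_of_faceOf_eq_of_fst_eq hS hG ?_ (S.rot_fst d)
    rw [← S.faceMap_symm_apply, faceOf_faceMap, h]
  have huniq : ∀ d' : G.Dart, d'.fst = d.fst → d' = d := by
    intro d' hd'
    obtain ⟨n, rfl⟩ := S.rot_cyclic d d' hd'.symm
    exact Function.iterate_fixed hrot n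
  obtain ⟨z, hz⟩ : ∃ z, z ∉ ({d.fst, d.snd} : Finset V) := by
    by_contra! hall
    have := Finset.card_le_card (fun z _ => hall z : Finset.univ ⊆ ({d.fst, d.snd} : Finset V))
    have := Finset.card_le_two (a := d.fst) (b := d.snd)
    have := hG.1
    rw [Finset.card_univ] at *
    omega
  simp only [Finset.mem_insert, Finset.mem_singleton, not_or] at hz
  obtain ⟨p⟩ := (hG.2 d.snd).preconnected ⟨d.fst, by simp⟩
    ⟨z, by simpa using hz.2⟩
  cases p with
  | nil => exact hz.1 rfl
  | @cons _ y _ hy p =>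
    have hadj := SimpleGraph.Subgraph.deleteVerts_adj.1 hy
    have hG' : G.Adj d.fst y := hadj.2.2.2.2
    have := huniq ⟨(d.fst, y), hG'⟩ rfl
    exact hadj.2.2.2.1 (congrArg (fun d : G.Dart => d.snd) this)

end TwoConnected

section Outer

variable {V : Type} [LinearOrder V] {G : SimpleGraph V} {S : RotationSystem G} [Fintype G.Dart]

/-- The boundary of a face that visits no vertex twice is a cycle. -/
theorem exists_boundary_cycle (d : G.Dart) [DecidablePred fun d' => S.faceOf d' = S.faceOf d]
    (hinj : ∀ d₁ d₂ : G.Dart, S.faceOf d₁ = S.faceOf d → S.faceOf d₂ = S.faceOf d →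
      d₁.fst = d₂.fst → d₁ = d₂) :
    ∃ t : List V, (d.snd :: t).Nodup ∧ (d.snd :: t).getLast? = some d.fst ∧
      (∀ x ∈ S.faceVerts (S.faceOf d), x ∈ d.snd :: t) ∧
      edgeBd (fun d' => if S.faceOf d' = S.faceOf d then 1 else 0) =
        cycleSum d.snd d.fst (d.snd :: t) := by
  classical
  have hpos : 0 < Function.minimalPeriod S.faceMap d :=
    Function.minimalPeriod_pos_of_mem_periodicPts (S.faceMap.injective.mem_periodicPts d)
  have hper : S.faceMap^[Function.minimalPeriod S.faceMap d] d = d :=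
    Function.iterate_minimalPeriod
  have hitinj := iterate_injOn_range (S := S) d
  have hfil := filter_faceOf_eq (S := S) d
  have hex : ∀ d' : G.Dart, S.faceOf d' = S.faceOf d →
      ∃ i < Function.minimalPeriod S.faceMap d, S.faceMap^[i] d = d' :=
    fun d' => exists_iterate_of_faceOf_eq
  obtain ⟨k, hk⟩ : ∃ k, Function.minimalPeriod S.faceMap d = k + 1 :=
    ⟨_, (Nat.sub_add_cancel hpos).symm⟩
  rw [hk] at hper hitinj hfil hex
  set u : ℕ → V := fun i => (S.faceMap^[i + 1] d).fst with hu
  have hu0 : u 0 = d.snd := S.fst_faceMap d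
  have hlist : d.snd :: (List.range k).map (fun i => u (i + 1)) = (List.range (k + 1)).map u := by
    rw [List.range_succ_eq_map, List.map_cons, hu0, List.map_map]
    rfl
  have hedge : ∀ i, (S.faceMap^[i + 1] d).edge = s(u i, u (i + 1)) := by
    intro i
    change _ = s(_, (S.faceMap^[i + 1 + 1] d).fst)
    rw [Function.iterate_succ_apply' _ (i + 1), S.fst_faceMap]
    rfl
  refine ⟨(List.range k).map fun i => u (i + 1), ?_⟩
  rw [hlist]
  refine ⟨?_, ?_, ?_, ?_⟩
  · refine List.nodup_range.map_on ?_
    intro i hi j hj hij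
    have h := hinj _ _ (faceOf_iterate d _) (faceOf_iterate d _) hij
    rw [Function.iterate_succ_apply', Function.iterate_succ_apply'] at h
    exact hitinj (by simpa using hi) (by simpa using hj) (S.faceMap.injective h)
  · rw [List.range_succ, List.map_append, List.map_singleton, List.getLast?_append]
    simp only [hu, hper, List.getLast?_singleton, Option.some_or]
  · rintro x ⟨d', hd', rfl⟩
    obtain ⟨i, hi, h⟩ := hex (S.faceMap.symm d') (by
      rw [← hd', ← faceOf_faceMap, Equiv.apply_symm_apply])
    refine List.mem_map.2 ⟨i, List.mem_range.2 hi, ?_⟩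
    simp only [hu]
    rw [Function.iterate_succ_apply', h, Equiv.apply_symm_apply]
  · rw [edgeBd_def]
    simp only [ite_smul, one_smul, zero_smul]
    rw [← Finset.sum_filter, hfil, Finset.sum_image hitinj, Finset.sum_range_succ', cycleSum,
      pathSum_map_range]
    congr 1
    · exact Finset.sum_congr rfl fun i _ => by rw [hedge]
    · rw [Sym2.eq_swap]
      rfl

end Outer

end RotationSystem

theorem graphPoly_eq_edgesPoly {V : Type} [Fintype V] [DecidableEq V] [LinearOrder V]
    {G : SimpleGraph V} {E : Finset (Sym2 V)} (hE : ∀ e, e ∈ E ↔ e ∈ G.edgeSet) :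
    graphPoly G = edgesPoly E := by
  let _ : Fintype G.edgeSet := Fintype.ofFinite _
  refine Finset.prod_congr ?_ fun _ _ => rfl
  ext e
  rw [SimpleGraph.mem_edgeFinset, hE]

theorem stmt0 {V : Type} [Fintype V] [DecidableEq V] [LinearOrder V]
    {G : SimpleGraph V} (S : RotationSystem G) (outer : S.Face)
    (hNT : IsNearTriangulation S outer)
    (a b : V) (hab : G.Adj a b)
    (he : ∃ d : G.Dart, S.faceOf d = outer ∧ d.edge = s(a, b)) :
    ∃ m : V →₀ ℕ,
      MvPolynomial.coeff m (graphPoly (G.deleteEdges {s(a, b)})) ≠ 0 ∧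
      m a = 0 ∧ m b = 0 ∧
      (∀ v ∈ S.faceVerts outer, v ≠ a → v ≠ b → m v ≤ 2) ∧
      (∀ u : V, u ∉ S.faceVerts outer → m u ≤ 4) := by
  classical
  let _ : Fintype G.Dart := Fintype.ofFinite _
  obtain ⟨hS, hG, hsize⟩ := hNT
  obtain ⟨d, rfl, hde⟩ := he
  obtain ⟨t, hnd, hlast, hverts, hbd⟩ := RotationSystem.exists_boundary_cycle d
    fun d₁ d₂ h₁ h₂ h => RotationSystem.eq_of_faceOf_eq_of_fst_eq hS hG (h₁.trans h₂.symm) h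
  set r : G.Dart → ZMod 2 := fun d' => if S.faceOf d' = S.faceOf d then 1 else 0 with hr
  have hinv : S.FaceInvariant (1 + r) :=
    RotationSystem.FaceInvariant.of_face fun F => 1 + if F = S.faceOf d then 1 else 0
  have hne : ∀ d', (1 + r) d' ≠ 0 ↔ S.faceOf d' ≠ S.faceOf d := by
    intro d'
    by_cases h : S.faceOf d' = S.faceOf d
    · simp only [Pi.add_apply, Pi.one_apply, hr, h, if_true, ne_eq, not_true, iff_false, not_not]
      decide
    · simp [hr, h]
  have hone : RotationSystem.edgeBd (1 : G.Dart → ZMod 2) = 0 := by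
    ext e
    by_contra h
    obtain ⟨d', rfl, -⟩ := RotationSystem.exists_dart_of_edgeBd_ne_zero h
    rw [RotationSystem.edgeBd_edge] at h
    exact h (CharTwo.add_self_eq_zero _)
  obtain ⟨m, hm, h1, h2, hL, h4⟩ := RotationSystem.hasGoodMonomial_of_edgeBd_eq hS hinv
    (fun d' hd' => RotationSystem.iterate_three_of_faceSize (hsize _ ((hne d').1 hd')))
    ⟨d, by_contra fun h => (hne d).1 h rfl⟩ hnd hlast d.fst_ne_snd.symm
    (by rw [map_add, hone, zero_add, hbd])
  have hmem : ∀ e, e ∈ RotationSystem.edgeSupp (1 + r) ↔ e ∈ G.edgeSet := by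
    intro e
    constructor
    · intro h
      obtain ⟨d', -, rfl⟩ := RotationSystem.mem_edgeSupp.1 h
      exact d'.edge_mem
    · intro h
      induction e with
      | _ x y =>
        let d' : G.Dart := ⟨(x, y), h⟩
        have := RotationSystem.faceOf_symm_ne hS hG d'
        change d'.edge ∈ _
        rw [RotationSystem.edge_mem_edgeSupp, hne, hne]
        by_contra! hc
        exact this (hc.2.trans hc.1.symm)
  have hde' : s(d.snd, d.fst) = s(a, b) := by rw [Sym2.eq_swap]; exact hde
  rw [hde'] at hm
  refine ⟨m, ?_, ?_, ?_, fun v hv _ _ => hL v (hverts v hv), fun u _ => h4 u⟩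
  · rwa [graphPoly_eq_edgesPoly fun e => ?_]
    rw [RotationSystem.mem_erase_edgeSupp, hmem, SimpleGraph.edgeSet_deleteEdges, Set.mem_sdiff,
      Set.mem_singleton_iff, and_comm]
  all_goals
    rcases Sym2.eq_iff.1 hde' with ⟨rfl, rfl⟩ | ⟨rfl, rfl⟩
    all_goals assumption
end

section
/- For every planar graph G, the graph polynomial P_G contains a nonvanishing monomial whose degree with respect to every variable is at most 4 (equivalently, the Alon–Tarsi number of every planar graph is at most 5). -/
/-- `H` is a minor of `G`: there is a family of nonempty, pairwise disjoint, connected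
branch sets in `G`, one for each vertex of `H`, such that every edge of `H` is realized by
an edge of `G` between the corresponding branch sets. -/
def SimpleGraph.IsMinorOf {W V : Type} (H : SimpleGraph W) (G : SimpleGraph V) : Prop :=
  ∃ B : W → Set V,
    (∀ w, (B w).Nonempty) ∧
    (∀ w, (G.induce (B w)).Connected) ∧
    (∀ w w', w ≠ w' → Disjoint (B w) (B w')) ∧
    (∀ w w', H.Adj w w' → ∃ a ∈ B w, ∃ b ∈ B w', G.Adj a b)

/-- A graph is planar iff it has no `K₅` and no `K₃,₃` minor (Kuratowski–Wagner). -/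
def SimpleGraph.Planar {V : Type} (G : SimpleGraph V) : Prop :=
  ¬ (completeGraph (Fin 5)).IsMinorOf G ∧
  ¬ (completeBipartiteGraph (Fin 3) (Fin 3)).IsMinorOf G

open MvPolynomial

section EdgeProducts

variable {V : Type}

/-- Some nonvanishing monomial of `p` has its exponents bounded by `f`. -/
def HasMonomialLE (p : MvPolynomial V ℤ) (f : V → ℕ) : Prop :=
  ∃ m : V →₀ ℕ, coeff m p ≠ 0 ∧ ∀ v, m v ≤ f v

lemma HasMonomialLE.mono {p : MvPolynomial V ℤ} {f g : V → ℕ} (h : HasMonomialLE p f)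
    (hfg : ∀ v, f v ≤ g v) : HasMonomialLE p g :=
  let ⟨m, hm, hf⟩ := h
  ⟨m, hm, fun v => (hf v).trans (hfg v)⟩

lemma HasMonomialLE.neg {p : MvPolynomial V ℤ} {f : V → ℕ} (h : HasMonomialLE p f) :
    HasMonomialLE (-p) f :=
  let ⟨m, hm, hf⟩ := h
  ⟨m, by simpa using hm, hf⟩

lemma exists_coeff_ne_zero_of_mul {p q : MvPolynomial V ℤ} {m : V →₀ ℕ}
    (h : coeff m (p * q) ≠ 0) : ∃ k, coeff k p ≠ 0 ∧ k ≤ m := by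
  classical
  rw [coeff_mul] at h
  obtain ⟨x, hx, hne⟩ := Finset.exists_ne_zero_of_sum_ne_zero h
  rw [Finset.HasAntidiagonal.mem_antidiagonal] at hx
  exact ⟨x.1, left_ne_zero_of_mul hne, hx ▸ le_self_add⟩

lemma HasMonomialLE.of_mul {p q : MvPolynomial V ℤ} {f : V → ℕ}
    (h : HasMonomialLE (p * q) f) : HasMonomialLE p f := by
  obtain ⟨m, hm, hf⟩ := h
  obtain ⟨k, hk, hkm⟩ := exists_coeff_ne_zero_of_mul hm
  exact ⟨k, hk, fun v => (hkm v).trans (hf v)⟩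

lemma HasMonomialLE.mul_X_sub_X {p : MvPolynomial V ℤ} {f : V → ℕ} {u s : V}
    (h : HasMonomialLE p f) (hs : f s = 0) (hus : u ≠ s) :
    HasMonomialLE (p * (X u - X s)) (f + ({u} : Set V).indicator 1) := by
  classical
  obtain ⟨m, hm, hf⟩ := h
  refine ⟨m + Finsupp.single u 1, ?_, fun v => ?_⟩
  · have h0 : m s = 0 := Nat.le_zero.mp (hs ▸ hf s)
    rw [mul_sub, coeff_sub, coeff_mul_X, coeff_mul_X', if_neg, sub_zero]
    · exact hm
    · simp [h0, hus.symm]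
  · by_cases hv : v = u
    · subst hv; simpa using hf v
    · simpa [Finsupp.single_apply, hv, Ne.symm hv] using hf v

/-- The linear factor of the graph polynomial which belongs to a single edge. -/
noncomputable def edgeFactor [LinearOrder V] (e : Sym2 V) : MvPolynomial V ℤ :=
  Sym2.lift ⟨fun a b => (X (min a b) : MvPolynomial V ℤ) - X (max a b),
      fun a b => by simp only [min_comm a b, max_comm a b]⟩ e

lemma edgeFactor_mk [LinearOrder V] (u v : V) :
    edgeFactor s(u, v) = X u - X v ∨ edgeFactor s(u, v) = -(X u - X v) := by
  rcases le_total u v with h | h <;> simp [edgeFactor, h]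

lemma edgeFactor_isHomogeneous [LinearOrder V] (e : Sym2 V) : (edgeFactor e).IsHomogeneous 1 := by
  induction e with
  | h u v => exact (isHomogeneous_X _ _).sub (isHomogeneous_X _ _)

variable [Finite V] [LinearOrder V]

/-- The product of the linear factors of a set of edges. -/
noncomputable def edgeProd (E : Set (Sym2 V)) : MvPolynomial V ℤ :=
  ∏ e ∈ E.toFinite.toFinset, edgeFactor e

lemma edgeProd_union {E F : Set (Sym2 V)} (h : Disjoint E F) :
    edgeProd (E ∪ F) = edgeProd E * edgeProd F := by
  classical
  unfold edgeProd
  rw [← Finset.prod_union]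
  · exact Finset.prod_congr (by ext; simp) fun _ _ => rfl
  · rw [Finset.disjoint_left]
    intro e he hf
    exact Set.disjoint_left.mp h (by simpa using he) (by simpa using hf)

lemma edgeProd_singleton (e : Sym2 V) : edgeProd {e} = edgeFactor e := by
  simp [edgeProd]

lemma HasMonomialLE.subset {E F : Set (Sym2 V)} {f : V → ℕ} (h : HasMonomialLE (edgeProd F) f)
    (hEF : E ⊆ F) : HasMonomialLE (edgeProd E) f := by
  rw [← Set.union_sdiff_cancel hEF, edgeProd_union Set.disjoint_sdiff_right] at h
  exact h.of_mul

lemma edgeProd_isHomogeneous (E : Set (Sym2 V)) :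
    (edgeProd E).IsHomogeneous E.toFinite.toFinset.card := by
  simpa [edgeProd] using IsHomogeneous.prod E.toFinite.toFinset _ (fun _ => 1)
    fun e _ => edgeFactor_isHomogeneous e

lemma coeff_edgeProd_eq_zero {E : Set (Sym2 V)} {v : V} (hv : ∀ e ∈ E, v ∉ e) {m : V →₀ ℕ}
    (hm : coeff m (edgeProd E) ≠ 0) : m v = 0 := by
  classical
  by_contra hne
  have hmem : v ∈ (edgeProd E).vars :=
    (mem_vars_iff_mem_support v).mpr ⟨m, mem_support_iff.mpr hm, Finsupp.mem_support_iff.mpr hne⟩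
  obtain ⟨e, he, hve⟩ := Finset.mem_biUnion.mp (vars_prod _ hmem)
  refine hv e (by simpa using he) ?_
  induction e with
  | h x y =>
    have := vars_sub_subset (p := (X (min x y) : MvPolynomial V ℤ)) (q := X (max x y)) hve
    rw [vars_X, vars_X] at this
    rw [Sym2.mem_iff]
    rcases le_total x y with h | h <;> simp_all [or_comm]

lemma HasMonomialLE.of_avoid {E : Set (Sym2 V)} {f g : V → ℕ}
    (h : HasMonomialLE (edgeProd E) f) (hg : ∀ v, f v ≤ g v ∨ ∀ e ∈ E, v ∉ e) :
    HasMonomialLE (edgeProd E) g := by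
  obtain ⟨m, hm, hf⟩ := h
  refine ⟨m, hm, fun v => ?_⟩
  rcases hg v with h | h
  · exact (hf v).trans h
  · simp [coeff_edgeProd_eq_zero h hm]

lemma HasMonomialLE.insert_edge {E : Set (Sym2 V)} {f : V → ℕ} {u s : V}
    (h : HasMonomialLE (edgeProd E) f) (hs : f s = 0) (hus : u ≠ s) :
    HasMonomialLE (edgeProd (E ∪ {s(u, s)})) (f + ({u} : Set V).indicator 1) := by
  by_cases he : s(u, s) ∈ E
  · rw [Set.union_singleton, Set.insert_eq_of_mem he]
    exact h.mono fun v => by simp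
  rw [edgeProd_union (by simpa using he), edgeProd_singleton]
  rcases edgeFactor_mk u s with h' | h' <;> rw [h']
  · exact h.mul_X_sub_X hs hus
  · rw [mul_neg]
    exact (h.mul_X_sub_X hs hus).neg

/-- Adding a star whose centre has bound zero. -/
lemma HasMonomialLE.union_star_of_center {E : Set (Sym2 V)} {f : V → ℕ} {v : V}
    (h : HasMonomialLE (edgeProd E) f) (hv : f v = 0) (T : Set V) (hvT : v ∉ T) :
    HasMonomialLE (edgeProd (E ∪ (fun u => s(u, v)) '' T)) (f + T.indicator 1) := by
  classical
  induction T, T.toFinite using Set.Finite.induction_on with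
  | empty => exact HasMonomialLE.mono (by simpa using h) fun x => by simp
  | @insert u T hu _ ih =>
    have hvu : u ≠ v := fun h => hvT (h ▸ Set.mem_insert _ _)
    have hvT' : v ∉ T := fun h => hvT (Set.mem_insert_of_mem _ h)
    have := (ih hvT').insert_edge (u := u) (s := v) (by simp [hv, hvT']) hvu
    rw [Set.image_insert_eq, Set.insert_eq, Set.union_comm {_}, ← Set.union_assoc]
    refine this.mono fun x => ?_
    by_cases hx : x = u <;> by_cases hxT : x ∈ T <;> simp_all

/-- Adding a star all of whose leaves have bound zero. -/
lemma HasMonomialLE.union_star_of_leaves {E : Set (Sym2 V)} {f : V → ℕ} {v : V}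
    (h : HasMonomialLE (edgeProd E) f) (D : Set V) (hD : ∀ d ∈ D, f d = 0) (hvD : v ∉ D) :
    HasMonomialLE (edgeProd (E ∪ (fun u => s(u, v)) '' D))
      (f + ({v} : Set V).indicator (fun _ => D.ncard)) := by
  classical
  induction D, D.toFinite using Set.Finite.induction_on with
  | empty => exact HasMonomialLE.mono (by simpa using h) fun x => by simp
  | @insert u D hu _ ih =>
    have hvu : u ≠ v := fun h => hvD (h ▸ Set.mem_insert _ _)
    have hvD' : v ∉ D := fun h => hvD (Set.mem_insert_of_mem _ h)
    have := (ih (fun d hd => hD d (Set.mem_insert_of_mem _ hd)) hvD').insert_edge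
      (u := v) (s := u) (by simp [hvu, hD u (Set.mem_insert _ _)]) hvu.symm
    rw [Set.image_insert_eq, Set.insert_eq, Set.union_comm {_}, ← Set.union_assoc,
      Sym2.eq_swap (a := u)]
    refine this.mono fun x => ?_
    rw [Set.ncard_insert_of_notMem hu]
    by_cases hx : x = v <;> simp_all [add_assoc]

/-- Adding a star with centre `v` one of whose leaves, `w`, must not gain anything,
whereas the others may gain two. -/
lemma HasMonomialLE.union_star_insert {E : Set (Sym2 V)} {f : V → ℕ} {v w : V}
    (h : HasMonomialLE (edgeProd E) f) (hv : ∀ e ∈ E, v ∉ e) (hfv : f v = 0)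
    (U : Set V) (hvU : v ∉ U) (hwU : w ∉ U) (hvw : w ≠ v) :
    HasMonomialLE (edgeProd (E ∪ (fun u => s(u, v)) '' U ∪ {s(w, v)}))
      (f + U.indicator (fun _ => 2) + ({v} : Set V).indicator 1) := by
  classical
  by_cases hB : HasMonomialLE (edgeProd E) (f + U.indicator 1 - ({w} : Set V).indicator 1) ∧
      f w ≠ 0
  · have := (hB.1.union_star_of_center (v := v) (by simp [hfv, hvU, hvw.symm]) U hvU).insert_edge
      (u := w) (s := v) (by simp [hfv, hvU, hvw.symm]) hvw
    refine this.mono fun x => ?_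
    by_cases hx : x = w <;> by_cases hxU : x ∈ U <;>
      by_cases hxv : x = v <;> simp_all
    omega
  · obtain ⟨m, hm, hf⟩ := h
    have hmv : m v = 0 := coeff_edgeProd_eq_zero hv hm
    have hstar : HasMonomialLE (edgeProd (E ∪ (fun u => s(u, v)) '' U)) (⇑m + U.indicator 1) :=
      HasMonomialLE.union_star_of_center ⟨m, hm, fun _ => le_rfl⟩ hmv U hvU
    obtain ⟨k, hk, hkm⟩ := hstar
    have hdisj : Disjoint E ((fun u => s(u, v)) '' U) := by
      rw [Set.disjoint_left]
      rintro _ he ⟨u, -, rfl⟩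
      exact hv _ he (by simp)
    have hwv : s(w, v) ∉ E ∪ (fun u => s(u, v)) '' U := by
      rintro (he | ⟨u, hu, hue⟩)
      · exact hv _ he (by simp)
      · rw [Sym2.eq_iff] at hue
        rcases hue with ⟨rfl, -⟩ | ⟨-, rfl⟩
        · exact hwU hu
        · exact hvw rfl
    have hmain : HasMonomialLE (edgeProd (E ∪ (fun u => s(u, v)) '' U) * (X v - X w))
        (f + U.indicator (fun _ => 2) + ({v} : Set V).indicator 1) := by
      refine ⟨k + Finsupp.single v 1, ?_, fun x => ?_⟩
      · rw [mul_sub, coeff_sub, coeff_mul_X, coeff_mul_X']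
        split_ifs with hkw
        · suffices coeff (k + Finsupp.single v 1 - Finsupp.single w 1)
              (edgeProd (E ∪ (fun u => s(u, v)) '' U)) = 0 by rwa [this, sub_zero]
          by_contra hne
          rw [edgeProd_union hdisj] at hne
          obtain ⟨l, hl, hle⟩ := exists_coeff_ne_zero_of_mul hne
          have hlv : l v = 0 := coeff_edgeProd_eq_zero hv hl
          refine hB ⟨⟨l, hl, fun x => ?_⟩, ?_⟩
          · have h1 := hle x
            have h2 := hkm x
            have h3 := hf x
            by_cases hx : x = w <;> by_cases hxU : x ∈ U <;>
              by_cases hxv : x = v <;> simp_all <;> grind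
          · have h2 := hkm w
            have h3 := hf w
            intro h0
            simp_all
        · rwa [sub_zero]
      · have h2 := hkm x
        have h3 := hf x
        by_cases hxU : x ∈ U <;>
          by_cases hxv : x = v <;> simp_all <;> grind
    rw [edgeProd_union (by simpa using hwv), edgeProd_singleton]
    rcases edgeFactor_mk w v with h' | h' <;> rw [h']
    · rw [← neg_sub, mul_neg]
      exact hmain.neg
    · rwa [neg_sub]

/-- Gluing along a set of vertices on which the second monomial is constant. -/
lemma HasMonomialLE.union {E F : Set (Sym2 V)} {f g h : V → ℕ} (C : Set V)
    (hE : HasMonomialLE (edgeProd E) f) (hF : HasMonomialLE (edgeProd F) g)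
    (hEC : ∀ e ∈ E, ∀ v ∈ C, v ∉ e) (hFC : ∀ e ∈ F, ∃ v ∈ C, v ∈ e)
    (hg : ∀ v, v ∉ C → g v = 0 ∨ ∀ e ∈ F, v ∉ e)
    (hgh : ∀ v ∈ C, g v ≤ h v) (hfh : ∀ v, v ∉ C → f v ≤ h v) :
    HasMonomialLE (edgeProd (E ∪ F)) h := by
  classical
  obtain ⟨m, hm, hmf⟩ := hE
  obtain ⟨k, hk, hkg⟩ := hF
  have hkC : ∀ v, v ∉ C → k v = 0 := fun v hv => by
    rcases hg v hv with h0 | h0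
    · exact Nat.le_zero.mp (h0 ▸ hkg v)
    · exact coeff_edgeProd_eq_zero h0 hk
  have hC0 : ∀ {l : V →₀ ℕ}, coeff l (edgeProd E) ≠ 0 → ∀ v ∈ C, l v = 0 := fun hl v hv =>
    coeff_edgeProd_eq_zero (fun e he => hEC e he v hv) hl
  have hdisj : Disjoint E F := Set.disjoint_left.mpr fun e he hf =>
    let ⟨v, hv, hve⟩ := hFC e hf
    hEC e he v hv hve
  refine ⟨m + k, ?_, fun v => ?_⟩
  · rw [edgeProd_union hdisj, coeff_mul, Finset.sum_eq_single (m, k)]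
    · exact mul_ne_zero hm hk
    · rintro ⟨m', k'⟩ hx hne
      rw [Finset.HasAntidiagonal.mem_antidiagonal] at hx
      by_contra hc
      have hm' := left_ne_zero_of_mul hc
      have hk' := right_ne_zero_of_mul hc
      have hle : k ≤ k' := fun v => by
        by_cases hv : v ∈ C
        · have := DFunLike.congr_fun hx v
          simp [hC0 hm' v hv, hC0 hm v hv] at this
          exact this.ge
        · simp [hkC v hv]
      have hdeg : k.degree = k'.degree := by
        have h1 := edgeProd_isHomogeneous F hk
        have h2 := edgeProd_isHomogeneous F hk'
        have hone := Finsupp.degree_eq_weight_one (σ := V) (R := ℕ)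
        exact (DFunLike.congr_fun hone k).trans
          (h1.trans (h2.symm.trans (DFunLike.congr_fun hone k').symm))
      have hkk : k = k' := by
        obtain ⟨d, rfl⟩ := exists_add_of_le hle
        rw [map_add] at hdeg
        have : d.degree = 0 := by omega
        rw [Finsupp.degree_eq_zero_iff] at this
        simp [this]
      subst hkk
      exact hne (by simpa using hx)
    · intro hx
      simp at hx
  · by_cases hv : v ∈ C
    · simpa [hC0 hm v hv] using (hkg v).trans (hgh v hv)
    · simpa [hkC v hv] using (hmf v).trans (hfh v hv)

end EdgeProducts

section ConnectedSets

variable {V : Type}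

/-- A nonempty vertex set which no proper nonempty subset of it disconnects. -/
def ConnectedOn (H : SimpleGraph V) (B : Set V) : Prop :=
  B.Nonempty ∧ ∀ P ⊆ B, P.Nonempty → (∀ u ∈ P, ∀ v ∈ B, H.Adj u v → v ∈ P) → B ⊆ P

/-- Some edge joins the two sets. -/
def Touch (H : SimpleGraph V) (A B : Set V) : Prop :=
  ∃ u ∈ A, ∃ v ∈ B, H.Adj u v

lemma Touch.symm {H : SimpleGraph V} {A B : Set V} (h : Touch H A B) : Touch H B A :=
  let ⟨u, hu, v, hv, huv⟩ := h
  ⟨v, hv, u, hu, huv.symm⟩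

lemma connectedOn_iff {H : SimpleGraph V} {B : Set V} :
    ConnectedOn H B ↔ (H.induce B).Connected := by
  constructor
  · rintro ⟨hne, hB⟩
    have : Nonempty B := hne.to_subtype
    refine SimpleGraph.Connected.mk fun x y => ?_
    have := hB {v | ∃ h : v ∈ B, (H.induce B).Reachable x ⟨v, h⟩} (fun v hv => hv.1)
      ⟨x, x.2, SimpleGraph.Reachable.refl _⟩ (by
        rintro u ⟨hu, hxu⟩ v hv huv
        exact ⟨hv, hxu.trans (SimpleGraph.Adj.reachable (by simpa using huv))⟩)
    exact (this y.2).2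
  · intro h
    have := h.nonempty
    refine ⟨Set.nonempty_coe_sort.mp this, fun P hPB ⟨p, hp⟩ hP v hv => ?_⟩
    obtain ⟨w⟩ := h.preconnected ⟨p, hPB hp⟩ ⟨v, hv⟩
    have key : ∀ {x y : B}, (H.induce B).Walk x y → (x : V) ∈ P → (y : V) ∈ P := by
      intro x y w
      induction w with
      | nil => exact id
      | cons hadj _ ih => exact fun hx => ih (hP _ hx _ (Subtype.property _) (by simpa using hadj))
    exact key w hp

lemma connectedOn_singleton (H : SimpleGraph V) (v : V) : ConnectedOn H {v} := by
  refine ⟨⟨v, rfl⟩, fun P hP ⟨p, hp⟩ _ => ?_⟩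
  have := hP hp
  rw [Set.mem_singleton_iff] at this
  simpa [← this] using hp

lemma ConnectedOn.insert_vertex {H : SimpleGraph V} {B : Set V} {v : V} (hB : ConnectedOn H B)
    (hv : Touch H B {v}) : ConnectedOn H (insert v B) := by
  obtain ⟨u, hu, w, rfl, huw⟩ := hv
  refine ⟨⟨w, Set.mem_insert _ _⟩, fun P hP ⟨p, hp⟩ hcl => ?_⟩
  have huP : u ∈ P → insert w B ⊆ P := fun huP => by
    have : B ⊆ P ∩ B := hB.2 (P ∩ B) Set.inter_subset_right ⟨u, huP, hu⟩
      fun x hx y hy hxy => ⟨hcl x hx.1 y (Set.mem_insert_of_mem _ hy) hxy, hy⟩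
    exact Set.insert_subset (hcl u huP w (Set.mem_insert _ _) huw)
      (this.trans Set.inter_subset_left)
  rcases hP hp with rfl | hpB
  · exact huP (hcl p hp u (Set.mem_insert_of_mem _ hu) huw.symm)
  · exact huP ((hB.2 (P ∩ B) Set.inter_subset_right ⟨p, hp, hpB⟩
      fun x hx y hy hxy => ⟨hcl x hx.1 y (Set.mem_insert_of_mem _ hy) hxy, hy⟩) hu).1

/-- An edge leaves every proper nonempty subset of a connected set. -/
lemma ConnectedOn.exists_adj {H : SimpleGraph V} {B P : Set V} (hB : ConnectedOn H B)
    (hPB : P ⊆ B) (hP : P.Nonempty) {x : V} (hx : x ∈ B) (hxP : x ∉ P) :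
    ∃ u ∈ P, ∃ v ∈ B, v ∉ P ∧ H.Adj u v := by
  by_contra! h
  exact hxP (hB.2 P hPB hP (fun u hu v hv huv => by_contra fun hvP => h u hu v hv hvP huv) hx)

/-- The vertices reachable from `p` by walks inside `R`. -/
def compOf (H : SimpleGraph V) (R : Set V) (p : V) : Set V :=
  {q | Relation.ReflTransGen (fun u v => H.Adj u v ∧ v ∈ R) p q}

lemma mem_compOf_self (H : SimpleGraph V) (R : Set V) (p : V) : p ∈ compOf H R p :=
  Relation.ReflTransGen.refl

lemma compOf_subset {H : SimpleGraph V} {R : Set V} {p : V} (hp : p ∈ R) : compOf H R p ⊆ R := by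
  intro q hq
  rcases Relation.ReflTransGen.cases_tail hq with rfl | ⟨_, _, h⟩
  · exact hp
  · exact h.2

lemma compOf_closed {H : SimpleGraph V} {R : Set V} {p u v : V} (hu : u ∈ compOf H R p)
    (hv : v ∈ R) (huv : H.Adj u v) : v ∈ compOf H R p :=
  Relation.ReflTransGen.tail hu ⟨huv, hv⟩

lemma compOf_connectedOn (H : SimpleGraph V) (R : Set V) (p : V) :
    ConnectedOn H (compOf H R p) := by
  refine ⟨⟨p, mem_compOf_self H R p⟩, fun P hPB ⟨q, hq⟩ hP => ?_⟩
  have hpP : p ∈ P := by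
    have hpq : Relation.ReflTransGen (fun u v => H.Adj u v ∧ v ∈ R) p q := hPB hq
    induction hpq with
    | refl => exact hq
    | @tail b c hb hbc ih => exact ih (hP c hq b hb hbc.1.symm)
  intro v hv
  have hpv : Relation.ReflTransGen (fun u v => H.Adj u v ∧ v ∈ R) p v := hv
  induction hpv with
  | refl => exact hpP
  | @tail b c hb hbc ih => exact hP b (ih hb) c (Relation.ReflTransGen.tail hb hbc) hbc.1

/-- A component of `R \ {z}` touches `z` when `R` is connected. -/
lemma compOf_touch {H : SimpleGraph V} {R R' : Set V} {p z : V} (hR : ConnectedOn H R)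
    (hz : z ∈ R) (hp : p ∈ R') (hR' : ∀ v, v ∈ R' ↔ v ∈ R ∧ v ≠ z) :
    Touch H (compOf H R' p) {z} := by
  have hsub := compOf_subset (H := H) hp
  obtain ⟨u, hu, v, hv, hvP, huv⟩ := hR.exists_adj (fun q hq => ((hR' q).mp (hsub hq)).1)
    ⟨p, mem_compOf_self H R' p⟩ hz (fun h => ((hR' z).mp (hsub h)).2 rfl)
  have hvz : v = z := by
    by_contra hne
    exact hvP (compOf_closed hu ((hR' v).mpr ⟨hv, hne⟩) huv)
  exact ⟨u, hu, z, rfl, hvz ▸ huv⟩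

end ConnectedSets

section Minors

variable {V : Type}

lemma SimpleGraph.Planar.mono {G H : SimpleGraph V} (hH : H.Planar) (hGH : G ≤ H) :
    G.Planar := by
  have key : ∀ {W : Type} (K : SimpleGraph W), K.IsMinorOf G → K.IsMinorOf H := by
    rintro W K ⟨B, h1, h2, h3, h4⟩
    refine ⟨B, h1, fun w => (h2 w).mono fun x y hxy => hGH hxy, h3, fun w w' hww => ?_⟩
    obtain ⟨x, hx, y, hy, hxy⟩ := h4 w w' hww
    exact ⟨x, hx, y, hy, hGH hxy⟩
  exact ⟨fun h => hH.1 (key _ h), fun h => hH.2 (key _ h)⟩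

/-- The graph obtained by contracting the set `Q` into the vertex `p`; the vertices of `Q`
become isolated. -/
def contractInto (H : SimpleGraph V) (Q : Set V) (p : V) : SimpleGraph V where
  Adj u v := u ∉ Q ∧ v ∉ Q ∧ u ≠ v ∧
    (H.Adj u v ∨ (u = p ∧ ∃ q ∈ Q, H.Adj q v) ∨ (v = p ∧ ∃ q ∈ Q, H.Adj q u))
  symm := ⟨by
    rintro u v ⟨hu, hv, hne, h⟩
    exact ⟨hv, hu, hne.symm, h.imp (fun h => h.symm) Or.symm⟩⟩
  loopless := ⟨fun u h => h.2.2.1 rfl⟩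

lemma SimpleGraph.IsMinorOf.of_contractInto {W : Type} {K : SimpleGraph W} {H : SimpleGraph V}
    {Q : Set V} {p : V} (hK : ∀ w, ∃ w', K.Adj w w') (hQ : ConnectedOn H Q) (hp : p ∉ Q)
    (hpQ : Touch H Q {p}) (h : K.IsMinorOf (contractInto H Q p)) : K.IsMinorOf H := by
  classical
  obtain ⟨B, h1, h2, h3, h4⟩ := h
  simp only [← connectedOn_iff] at h2
  have hBQ : ∀ w, ∀ x ∈ B w, x ∉ Q := by
    intro w x hx hxQ
    obtain ⟨w', hw⟩ := hK w
    obtain ⟨u, hu, v, hv, huv⟩ := h4 w w' hw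
    by_cases hux : u = x
    · exact huv.1 (hux ▸ hxQ)
    · obtain ⟨y, hy, z, -, -, hyz⟩ := (h2 w).exists_adj (P := {x}) (by simpa using hx) ⟨x, rfl⟩ hu
        (by simpa using hux)
      rw [Set.mem_singleton_iff] at hy
      exact hyz.1 (hy ▸ hxQ)
  let B' : W → Set V := fun w => if p ∈ B w then B w ∪ Q else B w
  have hle : ∀ w, B w ⊆ B' w := fun w => by
    by_cases hpw : p ∈ B w <;> simp [B', hpw]
  have mem_or_of_mem : ∀ w, ∀ x ∈ B' w, x ∈ B w ∨ (x ∈ Q ∧ p ∈ B w) := by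
    intro w x hx
    by_cases hpw : p ∈ B w
    · simp only [B', hpw, if_true] at hx
      exact hx.imp_right fun h => ⟨h, hpw⟩
    · simp only [B', hpw, if_false] at hx
      exact Or.inl hx
  refine ⟨B', fun w => (h1 w).mono (hle w), fun w => connectedOn_iff.mp ?_, fun w w' hww => ?_,
    fun w w' hww => ?_⟩
  · refine ⟨(h1 w).mono (hle w), fun P hPB ⟨x, hx⟩ hP => ?_⟩
    obtain ⟨q₀, hq₀, p', rfl, hq₀p⟩ := hpQ
    have hQP : p' ∈ B w → (∃ q ∈ Q, q ∈ P) → Q ⊆ P := by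
      rintro hpw ⟨q, hq, hqP⟩
      have hQB : Q ⊆ B' w := by simp [B', hpw]
      exact (hQ.2 (P ∩ Q) Set.inter_subset_right ⟨q, hqP, hq⟩
        fun u hu v hv huv => ⟨hP u hu.1 v (hQB hv) huv, hv⟩).trans Set.inter_subset_left
    have hpP : p' ∈ B w → ((∃ q ∈ Q, q ∈ P) ↔ p' ∈ P) := by
      intro hpw
      have hQB : Q ⊆ B' w := by simp [B', hpw]
      refine ⟨fun h => hP q₀ (hQP hpw h hq₀) p' (hle w hpw) hq₀p, fun h =>
        ⟨q₀, hq₀, hP p' h q₀ (hQB hq₀) hq₀p.symm⟩⟩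
    have hBP : B w ⊆ P ∩ B w := by
      refine (h2 w).2 _ Set.inter_subset_right ?_ ?_
      · rcases mem_or_of_mem w x (hPB hx) with h | ⟨hxQ, hpw⟩
        · exact ⟨x, hx, h⟩
        · exact ⟨p', (hpP hpw).mp ⟨x, hxQ, hx⟩, hpw⟩
      · rintro u ⟨huP, hu⟩ v hv ⟨-, -, -, huv | ⟨rfl, q, hq, hqv⟩ | ⟨rfl, q, hq, hqu⟩⟩
        · exact ⟨hP u huP v (hle w hv) huv, hv⟩
        · exact ⟨hP q (hQP hu ((hpP hu).mpr huP) hq) v (hle w hv) hqv, hv⟩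
        · have hQB : Q ⊆ B' w := by simp [B', hv]
          exact ⟨(hpP hv).mp ⟨q, hq, hP u huP q (hQB hq) hqu.symm⟩, hv⟩
    intro y hy
    rcases mem_or_of_mem w y hy with h | ⟨hyQ, hpw⟩
    · exact (hBP h).1
    · exact hQP hpw ((hpP hpw).mpr (hBP hpw).1) hyQ
  · rw [Set.disjoint_left]
    intro x hx hx'
    have hd := Set.disjoint_left.mp (h3 w w' hww)
    rcases mem_or_of_mem w x hx with h | ⟨hxQ, hpw⟩ <;> rcases mem_or_of_mem w' x hx' with h' | ⟨hxQ', hpw'⟩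
    · exact hd h h'
    · exact hBQ w x h hxQ'
    · exact hBQ w' x h' hxQ
    · exact hd hpw hpw'
  · obtain ⟨u, hu, v, hv, -, -, -, huv | ⟨rfl, q, hq, hqv⟩ | ⟨rfl, q, hq, hqu⟩⟩ := h4 w w' hww
    · exact ⟨u, hle w hu, v, hle w' hv, huv⟩
    · exact ⟨q, by simp [B', hu, hq], v, hle w' hv, hqv⟩
    · exact ⟨u, hle w hu, q, by simp [B', hv, hq], hqu.symm⟩

lemma SimpleGraph.Planar.contractInto {H : SimpleGraph V} {Q : Set V} {p : V} (hH : H.Planar)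
    (hQ : ConnectedOn H Q) (hp : p ∉ Q) (hpQ : Touch H Q {p}) :
    (contractInto H Q p).Planar := by
  refine ⟨fun h => hH.1 (h.of_contractInto ?_ hQ hp hpQ),
    fun h => hH.2 (h.of_contractInto ?_ hQ hp hpQ)⟩
  · exact fun w => ⟨w + 1, by simp [completeGraph]⟩
  · rintro (w | w)
    · exact ⟨Sum.inr w, by simp⟩
    · exact ⟨Sum.inl w, by simp⟩

lemma SimpleGraph.Planar.not_five {H : SimpleGraph V} (hH : H.Planar) (B : Fin 5 → Set V)
    (hconn : ∀ i, ConnectedOn H (B i)) (hdisj : ∀ i j, i < j → Disjoint (B i) (B j))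
    (htouch : ∀ i j, i < j → Touch H (B i) (B j)) : False := by
  refine hH.1 ⟨B, fun i => (hconn i).1, fun i => connectedOn_iff.mp (hconn i),
    fun i j hij => ?_, fun i j hij => ?_⟩
  · rcases lt_or_gt_of_ne hij with h | h
    · exact hdisj i j h
    · exact (hdisj j i h).symm
  · rcases lt_or_gt_of_ne hij.ne with h | h
    · exact htouch i j h
    · exact (htouch j i h).symm

lemma SimpleGraph.Planar.not_three_three {H : SimpleGraph V} (hH : H.Planar)
    (A B : Fin 3 → Set V) (hA : ∀ i, ConnectedOn H (A i)) (hB : ∀ i, ConnectedOn H (B i))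
    (hAA : ∀ i j, i < j → Disjoint (A i) (A j)) (hBB : ∀ i j, i < j → Disjoint (B i) (B j))
    (hAB : ∀ i j, Disjoint (A i) (B j)) (htouch : ∀ i j, Touch H (A i) (B j)) : False := by
  have hconn : ∀ w : Fin 3 ⊕ Fin 3, ConnectedOn H (Sum.elim A B w) := by
    rintro (w | w)
    exacts [hA w, hB w]
  refine hH.2 ⟨Sum.elim A B, fun i => (hconn i).1, fun i => connectedOn_iff.mp (hconn i),
    ?_, ?_⟩
  · rintro (i | i) (j | j) hij
    · rcases lt_or_gt_of_ne (fun h => hij (congrArg _ h) : i ≠ j) with h | h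
      · exact hAA i j h
      · exact (hAA j i h).symm
    · exact hAB i j
    · exact (hAB j i).symm
    · rcases lt_or_gt_of_ne (fun h => hij (congrArg _ h) : i ≠ j) with h | h
      · exact hBB i j h
      · exact (hBB j i h).symm
  · rintro (i | i) (j | j) hij
    · simp at hij
    · exact htouch i j
    · exact (htouch j i).symm
    · simp at hij

/-- A planar graph has no `K₅` minor with a vertex `a` as one of its branch sets. -/
lemma SimpleGraph.Planar.not_rooted_four {H : SimpleGraph V} (hH : H.Planar) {a : V}
    {Q X Y Z : Set V} (hQ : ConnectedOn H Q) (hX : ConnectedOn H X) (hY : ConnectedOn H Y)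
    (hZ : ConnectedOn H Z) (haQ : a ∉ Q) (haX : a ∉ X) (haY : a ∉ Y) (haZ : a ∉ Z)
    (hQX : Disjoint Q X) (hQY : Disjoint Q Y) (hQZ : Disjoint Q Z) (hXY : Disjoint X Y)
    (hXZ : Disjoint X Z) (hYZ : Disjoint Y Z) (taQ : Touch H {a} Q) (taX : Touch H {a} X)
    (taY : Touch H {a} Y) (taZ : Touch H {a} Z) (tQX : Touch H Q X) (tQY : Touch H Q Y)
    (tQZ : Touch H Q Z) (tXY : Touch H X Y) (tXZ : Touch H X Z) (tYZ : Touch H Y Z) :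
    False := by
  refine hH.not_five ![{a}, Q, X, Y, Z] ?_ ?_ ?_
  · intro i
    fin_cases i
    exacts [connectedOn_singleton H a, hQ, hX, hY, hZ]
  · intro i j hij
    fin_cases i <;> fin_cases j <;> first | (exact absurd hij (by decide)) | simp_all
  · intro i j hij
    fin_cases i <;> fin_cases j <;> first | (exact absurd hij (by decide)) | assumption

/-- A planar graph has no `K₃,₃` minor with a vertex `a` and three of its neighbours as
branch sets. -/
lemma SimpleGraph.Planar.not_rooted_three {H : SimpleGraph V} (hH : H.Planar) {a x y z : V}
    {Q T : Set V} (hQ : ConnectedOn H Q) (hT : ConnectedOn H T) (haQ : a ∉ Q) (haT : a ∉ T)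
    (hQT : Disjoint Q T) (hxy : x ≠ y) (hxz : x ≠ z) (hyz : y ≠ z) (hax : H.Adj a x)
    (hay : H.Adj a y) (haz : H.Adj a z) (hxQ : x ∉ Q) (hyQ : y ∉ Q) (hzQ : z ∉ Q) (hxT : x ∉ T)
    (hyT : y ∉ T) (hzT : z ∉ T) (tx : Touch H Q {x}) (ty : Touch H Q {y}) (tz : Touch H Q {z})
    (tTx : Touch H T {x}) (tTy : Touch H T {y}) (tTz : Touch H T {z}) : False := by
  have ta : ∀ {w : V}, H.Adj a w → Touch H {a} {w} := fun h => ⟨a, rfl, _, rfl, h⟩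
  refine hH.not_three_three ![{a}, Q, T] ![{x}, {y}, {z}] ?_ ?_ ?_ ?_ ?_ ?_
  · intro i
    fin_cases i
    exacts [connectedOn_singleton H a, hQ, hT]
  · intro i
    fin_cases i
    exacts [connectedOn_singleton H x, connectedOn_singleton H y, connectedOn_singleton H z]
  · intro i j hij
    fin_cases i <;> fin_cases j <;>
      first | (exact absurd hij (by decide)) | simpa using haQ | simpa using haT | exact hQT
  · intro i j hij
    fin_cases i <;> fin_cases j <;> first
      | (exact absurd hij (by decide)) | simpa using hxy | simpa using hxz | simpa using hyz
  · intro i j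
    fin_cases i <;> fin_cases j <;> simp [*, hax.ne, hay.ne, haz.ne]
  · have h1 := ta hax
    have h2 := ta hay
    have h3 := ta haz
    intro i j
    fin_cases i <;> fin_cases j <;> assumption

/-- Three neighbours of `a`, all touching a connected set `Q` with a neighbour of `a`, cannot be
pairwise linked in `R` avoiding the third one. -/
lemma SimpleGraph.Planar.not_rooted_triple {H : SimpleGraph V} (hH : H.Planar) {a x y z : V}
    {Q R : Set V} (hQ : ConnectedOn H Q) (haQ : a ∉ Q) (taQ : Touch H {a} Q)
    (hxy : x ≠ y) (hxz : x ≠ z) (hyz : y ≠ z) (hax : H.Adj a x) (hay : H.Adj a y)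
    (haz : H.Adj a z) (tx : Touch H Q {x}) (ty : Touch H Q {y}) (tz : Touch H Q {z})
    (haR : a ∉ R) (hQR : Disjoint Q R) (hx : x ∈ R) (hy : y ∈ R) (hz : z ∈ R)
    (hRx : ConnectedOn H (R \ {x})) (hRy : ConnectedOn H (R \ {y}))
    (hRz : ConnectedOn H (R \ {z})) : False := by
  have ta : ∀ {w : V} {B : Set V}, H.Adj a w → w ∈ B → Touch H {a} B := fun h hB =>
    ⟨a, rfl, _, hB, h⟩
  have tB : ∀ {w : V} {A B : Set V}, Touch H A {w} → w ∈ B → Touch H A B := by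
    rintro w A B ⟨u, hu, v, rfl, huv⟩ hB
    exact ⟨u, hu, v, hB, huv⟩
  have dR : ∀ {B : Set V}, B ⊆ R → Disjoint Q B := fun h => hQR.mono_right h
  have aR : ∀ {B : Set V}, B ⊆ R → a ∉ B := fun h ha => haR (h ha)
  have sR : ∀ {w : V}, w ∈ R → ({w} : Set V) ⊆ R := fun h => by simpa using h
  have conn := compOf_connectedOn H
  set X := compOf H (R \ {y, z}) x with hXdef
  set Y := compOf H (R \ {x, z}) y with hYdef
  have hxR : x ∈ R \ {y, z} := by simp [hx, hxy, hxz]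
  have hyR : y ∈ R \ {x, z} := by simp [hy, hxy.symm, hyz]
  have hzR : z ∈ R \ {x, y} := by simp [hz, hxz.symm, hyz.symm]
  have hXs : X ⊆ R \ {y, z} := compOf_subset hxR
  have hYs : Y ⊆ R \ {x, z} := compOf_subset hyR
  have hXR : X ⊆ R := hXs.trans Set.sdiff_subset
  have hYR : Y ⊆ R := hYs.trans Set.sdiff_subset
  have hxX : x ∈ X := mem_compOf_self _ _ _
  have hyY : y ∈ Y := mem_compOf_self _ _ _
  have tXz : Touch H X {z} := compOf_touch hRy (by simp [hz, hyz.symm]) hxR (by simp; tauto)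
  have tXy : Touch H X {y} := compOf_touch hRz (by simp [hy, hyz]) hxR (by simp; tauto)
  have tYz : Touch H Y {z} := compOf_touch hRx (by simp [hz, hxz.symm]) hyR (by simp; tauto)
  by_cases hdisj : Disjoint X Y
  · exact hH.not_rooted_four hQ (conn _ _) (conn _ _) (connectedOn_singleton H z) haQ (aR hXR)
      (aR hYR) (aR (sR hz)) (dR hXR) (dR hYR) (dR (sR hz)) hdisj
      (by simpa using fun h => (hXs h).2 (by simp)) (by simpa using fun h => (hYs h).2 (by simp))
      taQ (ta hax hxX) (ta hay hyY) (ta haz rfl) (tB tx hxX) (tB ty hyY) tz (tB tXy hyY) tXz tYz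
  obtain ⟨t, htX, htY⟩ := Set.not_disjoint_iff.mp hdisj
  have htR : t ∈ R \ {x, y, z} := by
    have h1 := hXs htX
    have h2 := hYs htY
    simp only [Set.mem_sdiff, Set.mem_insert_iff, Set.mem_singleton_iff] at h1 h2 ⊢
    tauto
  set T := compOf H (R \ {x, y, z}) t with hTdef
  have hTs : T ⊆ R \ {x, y, z} := compOf_subset htR
  have hTR : T ⊆ R := hTs.trans Set.sdiff_subset
  have htT : t ∈ T := mem_compOf_self _ _ _
  have leave : ∀ {c : V} {B : Set V}, ConnectedOn H B → t ∈ B → c ∈ B → c ∉ T →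
      B ⊆ insert c (R \ {x, y, z}) → Touch H T {c} := by
    intro c B hB htB hcB hcT hBs
    obtain ⟨u, hu, v, hv, hvP, huv⟩ := hB.exists_adj (P := T ∩ B) Set.inter_subset_right
      ⟨t, htT, htB⟩ hcB (fun h => hcT h.1)
    rcases hBs hv with rfl | h
    · exact ⟨u, hu.1, v, rfl, huv⟩
    · exact absurd ⟨compOf_closed hu.1 h huv, hv⟩ hvP
  have hxT : x ∉ T := fun h => (hTs h).2 (by simp)
  have hyT : y ∉ T := fun h => (hTs h).2 (by simp)
  have hzT : z ∉ T := fun h => (hTs h).2 (by simp)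
  have tTx : Touch H T {x} := leave (conn _ _) htX hxX hxT fun w hw => by
    have := hXs hw
    simp only [Set.mem_sdiff, Set.mem_insert_iff, Set.mem_singleton_iff] at this ⊢
    tauto
  have tTy : Touch H T {y} := leave (conn _ _) htY hyY hyT fun w hw => by
    have := hYs hw
    simp only [Set.mem_sdiff, Set.mem_insert_iff, Set.mem_singleton_iff] at this ⊢
    tauto
  by_cases tTz : Touch H T {z}
  · exact hH.not_rooted_three hQ (conn _ _) haQ (aR hTR) (dR hTR) hxy hxz hyz hax hay haz
      (by simpa using dR (sR hx)) (by simpa using dR (sR hy)) (by simpa using dR (sR hz))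
      hxT hyT hzT tx ty tz tTx tTy tTz
  · set Z := compOf H (R \ {x, y}) z with hZdef
    have hZs : Z ⊆ R \ {x, y} := compOf_subset hzR
    have hZR : Z ⊆ R := hZs.trans Set.sdiff_subset
    have hzZ : z ∈ Z := mem_compOf_self _ _ _
    have tZx : Touch H Z {x} := compOf_touch hRy (by simp [hx, hxy]) hzR (by simp; tauto)
    have tZy : Touch H Z {y} := compOf_touch hRx (by simp [hy, hxy.symm]) hzR (by simp; tauto)
    have hZT : Disjoint Z T := by
      by_contra hnd
      obtain ⟨s, hsZ, hsT⟩ := Set.not_disjoint_iff.mp hnd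
      obtain ⟨u, hu, v, hv, hvP, huv⟩ := (conn (R \ {x, y}) z).exists_adj (P := T ∩ Z)
        Set.inter_subset_right ⟨s, hsT, hsZ⟩ hzZ (fun h => hzT h.1)
      by_cases hvz : v = z
      · exact tTz ⟨u, hu.1, z, rfl, hvz ▸ huv⟩
      · refine hvP ⟨compOf_closed hu.1 ?_ huv, hv⟩
        have := hZs hv
        simp only [Set.mem_sdiff, Set.mem_insert_iff, Set.mem_singleton_iff] at this ⊢
        tauto
    have hYT : insert y T ⊆ R := Set.insert_subset hy hTR
    refine hH.not_rooted_four hQ (conn (R \ {x, y}) z) ((conn (R \ {x, y, z}) t).insert_vertex tTy)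
      (connectedOn_singleton H x) haQ (aR hZR) (aR hYT) (aR (sR hx)) (dR hZR) (dR hYT)
      (dR (sR hx)) ?_ (by simpa using fun h => (hZs h).2 (by simp)) ?_ taQ (ta haz hzZ)
      (ta hay (Set.mem_insert _ _)) (ta hax rfl) (tB tz hzZ) (tB ty (Set.mem_insert _ _)) tx
      (tB tZy (Set.mem_insert _ _)) tZx ?_
    · rw [Set.disjoint_insert_right]
      exact ⟨fun h => (hZs h).2 (by simp), hZT⟩
    · simpa [hxy] using hxT
    · obtain ⟨u, hu, v, hv, huv⟩ := tTx
      exact ⟨u, Set.mem_insert_of_mem _ hu, v, hv, huv⟩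

/-- A connected set in which all degrees are two stays connected without any one vertex. -/
lemma ConnectedOn.diff_singleton [Finite V] {H : SimpleGraph V} {K : Set V}
    (hK : ConnectedOn H K)
    (hdeg : ∀ k ∈ K, ∃ x ∈ K, ∃ y ∈ K, x ≠ y ∧ ∀ v ∈ K, H.Adj k v ↔ v = x ∨ v = y)
    {k : V} (hk : k ∈ K) : ConnectedOn H (K \ {k}) := by
  classical
  obtain ⟨x, hx, y, hy, hxy, hkxy⟩ := hdeg k hk
  have hkx : H.Adj k x := (hkxy x hx).mpr (Or.inl rfl)
  refine ⟨⟨x, hx, hkx.ne'⟩, fun P hP hPne hcl => ?_⟩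
  by_contra hsub
  obtain ⟨z, hz, hzP⟩ := Set.not_subset.mp hsub
  have hkP : k ∉ P := fun h => (hP h).2 rfl
  have nbr : ∀ P' ⊆ K \ {k}, P'.Nonempty → (∀ u ∈ P', ∀ v ∈ K \ {k}, H.Adj u v → v ∈ P') →
      ∃ u ∈ P', H.Adj k u := by
    intro P' hP' hne hcl'
    obtain ⟨u, hu, v, hv, hvP, huv⟩ := hK.exists_adj (hP'.trans Set.sdiff_subset) hne hk
      (fun h => (hP' h).2 rfl)
    have : v = k := by
      by_contra hvk
      exact hvP (hcl' u hu v ⟨hv, hvk⟩ huv)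
    exact ⟨u, hu, this ▸ huv.symm⟩
  obtain ⟨p, hp, hkp⟩ := nbr P hP hPne hcl
  obtain ⟨q, hq, hkq⟩ := nbr ((K \ {k}) \ P) Set.sdiff_subset ⟨z, hz, hzP⟩
    fun u hu v hv huv => ⟨hv, fun hvP => hu.2 (hcl v hvP u hu.1 huv.symm)⟩
  have hpq : p ≠ q := fun h => hq.2 (h ▸ hp)
  have honly : ∀ u ∈ P, H.Adj k u → u = p := by
    intro u hu hku
    have huq : u ≠ q := fun h => hq.2 (h ▸ hu)
    have h1 := (hkxy u (hP hu).1).mp hku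
    have h2 := (hkxy p (hP hp).1).mp hkp
    have h3 := (hkxy q hq.1.1).mp hkq
    grind
  let F : SimpleGraph V :=
    { Adj := fun u v => H.Adj u v ∧ u ∈ P ∧ v ∈ P
      symm := ⟨fun _ _ h => ⟨h.1.symm, h.2.2, h.2.1⟩⟩
      loopless := ⟨fun _ h => h.1.ne rfl⟩ }
  have := Fintype.ofFinite V
  have hodd : ∀ v, Odd (F.degree v) ↔ v = p := by
    intro v
    by_cases hv : v ∈ P
    · obtain ⟨s, hs, t, ht, hst, hvst⟩ := hdeg v (hP hv).1
      have hnb : ∀ w, F.Adj v w ↔ (w = s ∨ w = t) ∧ w ≠ k := by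
        intro w
        constructor
        · rintro ⟨h, -, hw⟩
          exact ⟨(hvst w (hP hw).1).mp h, (hP hw).2⟩
        · rintro ⟨hw, hwk⟩
          have hwK : w ∈ K := by rcases hw with rfl | rfl <;> assumption
          have hadj := (hvst w hwK).mpr hw
          exact ⟨hadj, hv, hcl v hv w ⟨hwK, hwk⟩ hadj⟩
      by_cases hvp : v = p
      · have hkst := (hvst k hk).mp (hvp ▸ hkp.symm)
        obtain ⟨r, hr⟩ : ∃ r, F.neighborFinset v = {r} := by
          rcases hkst with h | h
          · exact ⟨t, by ext w; simp [hnb]; grind⟩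
          · exact ⟨s, by ext w; simp [hnb]; grind⟩
        simp [← SimpleGraph.card_neighborFinset_eq_degree, hr, hvp]
      · have hkv : ¬ H.Adj v k := fun h => hvp (honly v hv h.symm)
        have hks : k ≠ s ∧ k ≠ t := by
          have := hvst k hk
          tauto
        have : F.neighborFinset v = {s, t} := by
          ext w
          simp [hnb]
          grind
        rw [← SimpleGraph.card_neighborFinset_eq_degree, this, Finset.card_pair hst]
        simp [hvp]
    · have : F.neighborFinset v = ∅ := by
        ext w
        simp [F, hv]
      rw [← SimpleGraph.card_neighborFinset_eq_degree, this]
      simp only [Finset.card_empty, Nat.not_odd_zero, false_iff]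
      exact fun h => hv (h ▸ hp)
  have heven := F.even_card_odd_degree_vertices
  have hsingle : (Finset.univ.filter fun v => Odd (F.degree v)) = {p} := by
    ext v
    simp [hodd]
  rw [hsingle] at heven
  simp at heven

end Minors

section InnerEdges

variable {V : Type}

/-- The edges of `H` which avoid `a` and do not lie inside `S`. -/
def innerEdges (H : SimpleGraph V) (a : V) (S : Set V) : Set (Sym2 V) :=
  {e | e ∈ H.edgeSet ∧ a ∉ e ∧ ¬ ∀ v ∈ e, v ∈ S}

lemma mk_mem_innerEdges {H : SimpleGraph V} {a u v : V} {S : Set V} :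
    s(u, v) ∈ innerEdges H a S ↔ H.Adj u v ∧ a ≠ u ∧ a ≠ v ∧ ¬ (u ∈ S ∧ v ∈ S) := by
  simp [innerEdges]
  tauto

open Classical in
/-- The degrees allowed when `S` is precoloured and the neighbours of `a` are on the outer face. -/
noncomputable def innerBound (H : SimpleGraph V) (a : V) (S : Set V) (u : V) : ℕ :=
  if u ∈ S then 0 else if H.Adj a u then 2 else 4

/-- The subgraph spanned by the edges inside `W`. -/
def restrictTo (H : SimpleGraph V) (W : Set V) : SimpleGraph V where
  Adj u v := H.Adj u v ∧ u ∈ W ∧ v ∈ W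
  symm := ⟨fun _ _ h => ⟨h.1.symm, h.2.2, h.2.1⟩⟩
  loopless := ⟨fun _ h => h.1.ne rfl⟩

lemma restrictTo_adj {H : SimpleGraph V} {W : Set V} {u v : V} :
    (restrictTo H W).Adj u v ↔ H.Adj u v ∧ u ∈ W ∧ v ∈ W := Iff.rfl

lemma SimpleGraph.Planar.restrictTo {H : SimpleGraph V} (hH : H.Planar) (W : Set V) :
    (restrictTo H W).Planar :=
  hH.mono fun _ _ h => h.1

/-- A planar graph on `W`, a vertex `a`, and a clique `S` of at most two neighbours of `a`. -/
structure InnerConfig (W : Set V) (H : SimpleGraph V) (a : V) (S : Set V) : Prop where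
  planar : H.Planar
  mem : ∀ u v, H.Adj u v → u ∈ W
  apex_mem : a ∈ W
  adj : ∀ s ∈ S, H.Adj a s
  clique : ∀ s ∈ S, ∀ t ∈ S, s ≠ t → H.Adj s t
  card : S.ncard ≤ 2

variable [Finite V] [LinearOrder V]

/-- The inner edges have a nonvanishing monomial within the allowed degrees. -/
def HasInnerMonomial (H : SimpleGraph V) (a : V) (S : Set V) : Prop :=
  HasMonomialLE (edgeProd (innerEdges H a S)) (innerBound H a S)

lemma HasInnerMonomial.apex {H : SimpleGraph V} {b : V} {S : Set V} {g : V → ℕ}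
    (h : HasInnerMonomial H b S) (hg : ∀ u, u ∉ insert b S → 4 ≤ g u) :
    HasMonomialLE (edgeProd {e | e ∈ H.edgeSet ∧ ¬ ∀ v ∈ e, v ∈ insert b S}) g := by
  classical
  have h1 : HasMonomialLE (edgeProd (innerEdges H b S))
      (fun u => if u = b then 0 else innerBound H b S u) := by
    refine h.of_avoid fun v => ?_
    by_cases hv : v = b
    · exact Or.inr fun e he => hv ▸ he.2.1
    · simp [hv]
  have h2 := h1.union_star_of_center (v := b) (by simp) {v | H.Adj b v ∧ v ∉ S} (by simp)
  refine (h2.subset ?_).mono ?_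
  · rintro ⟨u, v⟩ ⟨he, hS⟩
    have huv : H.Adj u v := he
    have hS' : ¬ (u ∈ insert b S ∧ v ∈ insert b S) := by simpa using hS
    simp only [Set.mem_insert_iff] at hS'
    by_cases hu : u = b
    · subst hu
      exact Or.inr ⟨v, ⟨huv, by tauto⟩, Sym2.eq_swap⟩
    by_cases hv : v = b
    · subst hv
      exact Or.inr ⟨u, ⟨huv.symm, by tauto⟩, rfl⟩
    · exact Or.inl (mk_mem_innerEdges.mpr ⟨huv, Ne.symm hu, Ne.symm hv, by tauto⟩)
  · intro u
    have := hg u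
    by_cases hub : u = b <;> by_cases huS : u ∈ S <;> by_cases hu : H.Adj b u <;>
      simp_all [innerBound]
    exact le_trans (by norm_num) (hg u hub huS)

/-- The inner edges always have a suitable monomial over the vertex set `W`. -/
def InnerClaim (W : Set V) : Prop :=
  ∀ (H : SimpleGraph V) (a : V) (S : Set V), InnerConfig W H a S → HasInnerMonomial H a S

namespace InnerConfig

variable {W : Set V} {H : SimpleGraph V} {a : V} {S : Set V}

lemma hasInnerMonomial_of_nbrs_subset (hc : InnerConfig W H a S)
    (ih : ∀ W' ⊂ W, InnerClaim W') (hN : ∀ v, H.Adj a v → v ∈ S) : HasInnerMonomial H a S := by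
  by_cases hb : ∃ b ∈ W, b ≠ a ∧ (b ∈ S ∨ S = ∅)
  · obtain ⟨b, hbW, hba, hbS⟩ := hb
    have hc' : InnerConfig (W \ {a}) (restrictTo H {a}ᶜ) b (S \ {b}) := by
      refine ⟨hc.planar.restrictTo _, fun u v h => ⟨hc.mem u v h.1, h.2.1⟩, ⟨hbW, hba⟩, ?_, ?_,
        (Set.ncard_le_ncard Set.sdiff_subset (Set.toFinite S)).trans hc.card⟩
      · rintro s ⟨hs, hsb⟩
        refine ⟨hc.clique b ?_ s hs (Ne.symm hsb), hba, (hc.adj s hs).ne'⟩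
        rcases hbS with h | h
        · exact h
        · simp [h] at hs
      · rintro s ⟨hs, -⟩ t ⟨ht, -⟩ hst
        exact ⟨hc.clique s hs t ht hst, (hc.adj s hs).ne', (hc.adj t ht).ne'⟩
    have h := ih (W \ {a}) ⟨Set.sdiff_subset, fun h => (h hc.apex_mem).2 rfl⟩ _ _ _ hc'
    refine (h.apex (g := innerBound H a S) fun u hu => ?_).subset ?_
    · simp only [Set.insert_sdiff_singleton, Set.mem_insert_iff, not_or] at hu
      have : ¬ H.Adj a u := fun h => hu.2 (hN u h)
      simp [innerBound, hu.2, this]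
    · rintro ⟨u, v⟩ he
      obtain ⟨huv, hau, hav, hS⟩ := mk_mem_innerEdges.mp he
      refine ⟨⟨huv, hau.symm, hav.symm⟩, fun hall => ?_⟩
      have hu := hall u (Sym2.mem_mk_left u v)
      have hv := hall v (Sym2.mem_mk_right u v)
      have := huv.ne
      simp only [Set.insert_sdiff_singleton, Set.mem_insert_iff] at hu hv
      rcases hbS with h | h
      · exact hS ⟨hu.elim (· ▸ h) id, hv.elim (· ▸ h) id⟩
      · simp_all
  · push Not at hb
    have hS : S = ∅ := by
      by_contra hS
      obtain ⟨s, hs⟩ := Set.nonempty_iff_ne_empty.mpr hS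
      exact (hb s (hc.mem s a (hc.adj s hs).symm) (hc.adj s hs).ne').1 hs
    have hE : innerEdges H a S = ∅ := by
      rw [Set.eq_empty_iff_forall_notMem]
      rintro ⟨u, v⟩ he
      obtain ⟨huv, hau, -, -⟩ := mk_mem_innerEdges.mp he
      exact (hb u (hc.mem u v huv) hau.symm).2.ne_empty hS
    refine ⟨0, ?_, fun v => by simp⟩
    simp [hE, edgeProd]

/-- Splitting off a set `C` which is attached to the rest only through `X` and `a`. -/
lemma hasInnerMonomial_of_separation (hc : InnerConfig W H a S)
    (ih : ∀ W' ⊂ W, InnerClaim W') {C X : Set V} {K : SimpleGraph V} (hCne : C.Nonempty)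
    (hCW : C ⊆ W) (haC : a ∉ C) (hCS : Disjoint C S) (hCX : Disjoint C X) (hXW : X ⊆ W)
    (hK : K.Planar) (hKa : ∀ x ∈ X, K.Adj a x) (hKX : ∀ x ∈ X, ∀ y ∈ X, x ≠ y → K.Adj x y)
    (hX : X.ncard ≤ 2) (hHK : ∀ u ∈ C, ∀ v, H.Adj u v → K.Adj u v ∧ v ∈ insert a (C ∪ X))
    {r : V} (hrW : r ∈ W) (hr : r ∉ insert a (C ∪ X)) : HasInnerMonomial H a S := by
  obtain ⟨H', hc', hH'⟩ : ∃ H', InnerConfig (insert a (C ∪ X)) H' a X ∧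
      ∀ u ∈ C, ∀ v, H.Adj u v → H'.Adj u v := by
    have hXs : ∀ x ∈ X, x ∈ insert a (C ∪ X) := fun x hx => Or.inr (Or.inr hx)
    exact ⟨restrictTo K (insert a (C ∪ X)), ⟨hK.restrictTo _, fun _ _ h => h.2.1,
      Set.mem_insert _ _, fun x hx => ⟨hKa x hx, Set.mem_insert _ _, hXs x hx⟩,
      fun x hx y hy hxy => ⟨hKX x hx y hy hxy, hXs x hx, hXs y hy⟩, hX⟩,
      fun u hu v huv => ⟨(hHK u hu v huv).1, Or.inr (Or.inl hu), (hHK u hu v huv).2⟩⟩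
  have hdS := Set.disjoint_left.mp hCS
  have hdX := Set.disjoint_left.mp hCX
  obtain ⟨c, hcC⟩ := hCne
  have hc₁ : InnerConfig (W \ C) (restrictTo H Cᶜ) a S := by
    refine ⟨hc.planar.restrictTo _, fun u v h => ⟨hc.mem u v h.1, h.2.1⟩, ⟨hc.apex_mem, haC⟩,
      fun s hs => ⟨hc.adj s hs, haC, fun h => hdS h hs⟩, fun s hs t ht hst =>
      ⟨hc.clique s hs t ht hst, fun h => hdS h hs, fun h => hdS h ht⟩, hc.card⟩
  have h₁ := ih (W \ C) ⟨Set.sdiff_subset, fun h => (h (hCW hcC)).2 hcC⟩ _ _ _ hc₁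
  have h₂ := ih (insert a (C ∪ X))
    ⟨Set.insert_subset hc.apex_mem (Set.union_subset hCW hXW), fun h => hr (h hrW)⟩ _ _ _ hc'
  refine (HasMonomialLE.union (h := innerBound H a S) C h₁ h₂ ?_ ?_ ?_ ?_ ?_).subset ?_
  · rintro ⟨u, v⟩ he w hw hwe
    obtain ⟨huv, -, -, -⟩ := mk_mem_innerEdges.mp he
    rcases Sym2.mem_iff.mp hwe with rfl | rfl
    · exact huv.2.1 hw
    · exact huv.2.2 hw
  · rintro ⟨u, v⟩ he
    obtain ⟨huv, hau, hav, hX⟩ := mk_mem_innerEdges.mp he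
    have hu := hc'.mem u v huv
    have hv := hc'.mem v u huv.symm
    simp only [Set.mem_insert_iff, Set.mem_union] at hu hv
    by_cases huC : u ∈ C
    · exact ⟨u, huC, Sym2.mem_mk_left u v⟩
    · exact ⟨v, by have := hau.symm; have := hav.symm; tauto, Sym2.mem_mk_right u v⟩
  · intro v hv
    by_cases hvX : v ∈ X
    · exact Or.inl (by simp [innerBound, hvX])
    · refine Or.inr ?_
      rintro ⟨u, w⟩ he hve
      obtain ⟨huv, hau, hav, -⟩ := mk_mem_innerEdges.mp he
      have hu := hc'.mem u w huv
      have hw := hc'.mem w u huv.symm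
      simp only [Set.mem_insert_iff, Set.mem_union] at hu hw
      rcases Sym2.mem_iff.mp hve with rfl | rfl
      · have := hau.symm; tauto
      · have := hav.symm; tauto
  · intro v hv
    have h1 : v ∉ S := hdS hv
    have h2 : v ∉ X := hdX hv
    by_cases hav : H.Adj a v
    · simp [innerBound, h1, h2, hav, (hH' v hv a hav.symm).symm]
    · simp only [innerBound, h1, h2, hav, if_false]
      split_ifs <;> simp
  · intro v hv
    have : (restrictTo H Cᶜ).Adj a v ↔ H.Adj a v := by simp [restrictTo_adj, haC, hv]
    unfold innerBound
    split_ifs <;> simp_all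
  · rintro ⟨u, v⟩ he
    obtain ⟨huv, hau, hav, hS⟩ := mk_mem_innerEdges.mp he
    by_cases hu : u ∈ C
    · exact Or.inr (mk_mem_innerEdges.mpr ⟨hH' u hu v huv, hau, hav, fun h => hdX hu h.1⟩)
    by_cases hv : v ∈ C
    · exact Or.inr (mk_mem_innerEdges.mpr
        ⟨(hH' v hv u huv.symm).symm, hau, hav, fun h => hdX hv h.2⟩)
    · exact Or.inl (mk_mem_innerEdges.mpr ⟨⟨huv, hu, hv⟩, hau, hav, hS⟩)

end InnerConfig

end InnerEdges

namespace InnerConfig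

variable {V : Type} [Finite V] [LinearOrder V] {W : Set V} {H : SimpleGraph V} {a : V} {S : Set V}

/-- If a component `D` of `W \ {a, x, y}` misses `y`, which is not adjacent to `x`, then `x`
and `a` separate. -/
lemma hasInnerMonomial_of_not_touch (hc : InnerConfig W H a S)
    (ih : ∀ W' ⊂ W, InnerClaim W') {x y : V} {D : Set V} (hxy : x ≠ y) (hax : H.Adj a x)
    (hay : H.Adj a y) (hD : D ⊆ W \ {a, x, y}) (hDne : D.Nonempty)
    (hcl : ∀ u ∈ D, ∀ v ∈ W \ {a, x, y}, H.Adj u v → v ∈ D)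
    (hS : ∀ s ∈ S, s = x ∨ s = y ∨ s ∈ D) (hnxy : ¬ H.Adj x y) (hDy : ¬ Touch H D {y}) :
    HasInnerMonomial H a S := by
  have hxW := hc.mem x a hax.symm
  have hyW := hc.mem y a hay.symm
  have hDy' : ∀ u ∈ D, ¬ H.Adj u y := fun u hu h => hDy ⟨u, hu, y, rfl, h⟩
  obtain ⟨d, hd⟩ := hDne
  by_cases hyS : y ∈ S
  · have hSy : ∀ s ∈ S, s = y := by
      intro s hs
      by_contra hne
      have hsy := hc.clique s hs y hyS hne
      rcases hS s hs with rfl | rfl | h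
      exacts [hnxy hsy, hne rfl, hDy' s h hsy]
    refine hc.hasInnerMonomial_of_separation ih (C := D) (X := {x}) (K := H) (r := y) ⟨d, hd⟩
      (hD.trans Set.sdiff_subset) (fun h => (hD h).2 (by simp)) ?_ ?_ (by simpa using hxW)
      hc.planar (by simpa using hax) (by simp) (by simp) ?_ hyW ?_
    · rw [Set.disjoint_left]
      intro u hu huS
      exact (hD hu).2 (by simp [hSy u huS])
    · simpa using fun h => (hD h).2 (by simp)
    · intro u hu v huv
      refine ⟨huv, ?_⟩
      have h1 := hcl u hu v
      have h2 : v ≠ y := fun h => hDy' u hu (h ▸ huv)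
      have h3 := hc.mem v u huv.symm
      simp only [Set.mem_sdiff, Set.mem_insert_iff, Set.mem_singleton_iff, Set.mem_union] at h1 ⊢
      tauto
    · have h1 : y ∉ D := fun h => (hD h).2 (by simp)
      simp [hay.ne', hxy.symm, h1]
  · have hdR := hD hd
    simp only [Set.mem_sdiff, Set.mem_insert_iff, Set.mem_singleton_iff, not_or] at hdR
    refine hc.hasInnerMonomial_of_separation ih (C := (W \ {a, x}) \ D) (X := {x}) (K := H)
      (r := d)
      ⟨y, ?_⟩ (fun u hu => hu.1.1) (fun h => h.1.2 (by simp)) ?_ (by simp) (by simpa using hxW)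
      hc.planar (by simpa using hax) (by simp) (by simp) ?_ hdR.1 ?_
    · have h1 : y ∉ D := fun h => (hD h).2 (by simp)
      simp [hyW, hay.ne', hxy.symm, h1]
    · rw [Set.disjoint_left]
      rintro u ⟨⟨-, hu⟩, huD⟩ huS
      simp only [Set.mem_insert_iff, Set.mem_singleton_iff, not_or] at hu
      rcases hS u huS with rfl | rfl | h
      exacts [hu.2 rfl, hyS huS, huD h]
    · rintro u ⟨⟨huW, hu⟩, huD⟩ v huv
      refine ⟨huv, ?_⟩
      have h1 : v ∉ D := fun hv => by
        have h2 : u ≠ y := fun h => hDy' v hv (h ▸ huv.symm)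
        refine huD (hcl v hv u ⟨huW, ?_⟩ huv.symm)
        simp only [Set.mem_insert_iff, Set.mem_singleton_iff] at hu ⊢
        tauto
      have h3 := hc.mem v u huv.symm
      simp only [Set.mem_sdiff, Set.mem_insert_iff, Set.mem_singleton_iff, Set.mem_union]
      tauto
    · simp [hd, hdR]

lemma connectedOn_or_hasInnerMonomial (hc : InnerConfig W H a S)
    (ih : ∀ W' ⊂ W, InnerClaim W') {x y : V} (hxy : x ≠ y) (hax : H.Adj a x)
    (hay : H.Adj a y) (hne : (W \ {a, x, y}).Nonempty) :
    ConnectedOn H (W \ {a, x, y}) ∨ HasInnerMonomial H a S := by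
  set R := W \ {a, x, y} with hRdef
  have hxW := hc.mem x a hax.symm
  have hyW := hc.mem y a hay.symm
  have hSR : ∀ s ∈ S, s = x ∨ s = y ∨ s ∈ R := by
    intro s hs
    have h1 := hc.mem s a (hc.adj s hs).symm
    have h2 := (hc.adj s hs).ne'
    simp only [hRdef, Set.mem_sdiff, Set.mem_insert_iff, Set.mem_singleton_iff]
    tauto
  obtain ⟨p, hpR, hp⟩ : ∃ p ∈ R, ∀ s ∈ S, s = x ∨ s = y ∨ s ∈ compOf H R p := by
    by_cases h : ∃ p ∈ S, p ∈ R
    · obtain ⟨p, hpS, hpR⟩ := h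
      refine ⟨p, hpR, fun s hs => (hSR s hs).imp_right fun h => h.imp_right fun hsR => ?_⟩
      by_cases hsp : p = s
      · exact hsp ▸ mem_compOf_self H R p
      · exact compOf_closed (mem_compOf_self H R p) hsR (hc.clique p hpS s hs hsp)
    · push Not at h
      obtain ⟨p, hpR⟩ := hne
      exact ⟨p, hpR, fun s hs => (hSR s hs).imp_right fun h' => h'.imp_right fun hsR =>
        absurd hsR (h s hs)⟩
  set D := compOf H R p with hDdef
  have hpD : p ∈ D := mem_compOf_self H R p
  have hDR : D ⊆ R := compOf_subset hpR
  have hcl : ∀ u ∈ D, ∀ v ∈ R, H.Adj u v → v ∈ D := fun u hu v hv huv => compOf_closed hu hv huv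
  have hDconn : ConnectedOn H D := compOf_connectedOn H R p
  by_cases hRD : R ⊆ D
  · exact Or.inl (hDR.antisymm hRD ▸ hDconn)
  obtain ⟨c, hcR, hcD⟩ := Set.not_subset.mp hRD
  refine Or.inr ?_
  have hxD : x ∉ D := fun h => (hDR h).2 (by simp)
  have hyD : y ∉ D := fun h => (hDR h).2 (by simp)
  have haD : a ∉ D := fun h => (hDR h).2 (by simp)
  have key : ∀ K : SimpleGraph V, K.Planar → K.Adj x y → K.Adj a x → K.Adj a y →
      (∀ u v, u ∉ D → v ∉ D → H.Adj u v → K.Adj u v) → HasInnerMonomial H a S := by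
    intro K hK hKxy hKax hKay hKH
    refine hc.hasInnerMonomial_of_separation ih (C := R \ D) (X := {x, y}) (K := K) (r := p)
      ⟨c, hcR, hcD⟩ (fun u hu => hu.1.1) (fun h => h.1.2 (by simp)) ?_ ?_ ?_ hK ?_ ?_
      ((Set.ncard_insert_le _ _).trans (by simp)) ?_ hpR.1 ?_
    · rw [Set.disjoint_left]
      rintro u ⟨huR, huD⟩ huS
      rcases hp u huS with rfl | rfl | h
      exacts [huR.2 (by simp), huR.2 (by simp), huD h]
    · rw [Set.disjoint_left]
      rintro u ⟨huR, -⟩ hu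
      exact huR.2 (Or.inr hu)
    · rintro u (rfl | rfl)
      exacts [hxW, hyW]
    · rintro u (rfl | rfl)
      exacts [hKax, hKay]
    · rintro u (rfl | rfl) v (rfl | rfl) huv
      exacts [absurd rfl huv, hKxy, hKxy.symm, absurd rfl huv]
    · rintro u ⟨huR, huD⟩ v huv
      have hvD : v ∉ D := fun hv => huD (hcl v hv u huR huv.symm)
      refine ⟨hKH u v huD hvD huv, ?_⟩
      have h3 := hc.mem v u huv.symm
      simp only [hRdef, Set.mem_sdiff, Set.mem_insert_iff, Set.mem_singleton_iff, Set.mem_union]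
      tauto
    · have := hpR.2
      simp only [Set.mem_insert_iff, Set.mem_union, Set.mem_sdiff] at this ⊢
      tauto
  by_cases hadj : H.Adj x y
  · exact key H hc.planar hadj hax hay fun _ _ _ _ h => h
  by_cases tx : Touch H D {x}
  · by_cases ty : Touch H D {y}
    · obtain ⟨q, hq, y', rfl, hqy⟩ := ty
      exact key (contractInto H D x) (hc.planar.contractInto hDconn hxD tx)
        ⟨hxD, hyD, hxy, Or.inr (Or.inl ⟨rfl, q, hq, hqy⟩)⟩ ⟨haD, hxD, hax.ne, Or.inl hax⟩
        ⟨haD, hyD, hay.ne, Or.inl hay⟩ fun u v hu hv huv => ⟨hu, hv, huv.ne, Or.inl huv⟩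
    · exact hc.hasInnerMonomial_of_not_touch ih hxy hax hay hDR ⟨p, hpD⟩ hcl hp hadj ty
  · have hcomm : R = W \ {a, y, x} := by rw [hRdef, Set.pair_comm]
    refine hc.hasInnerMonomial_of_not_touch ih hxy.symm hay hax (hcomm ▸ hDR) ⟨p, hpD⟩
      (hcomm ▸ hcl) (fun s hs => ?_) (fun h => hadj h.symm) tx
    have := hp s hs
    tauto

end InnerConfig

namespace InnerConfig

variable {V : Type} {W : Set V} {H : SimpleGraph V} {a : V} {S : Set V}

/-- Contracting a neighbour `v` of `a` outside `S` into `a`. -/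
lemma contract_nbr (hc : InnerConfig W H a S) {v : V} (hav : H.Adj a v) (hvS : v ∉ S) :
    InnerConfig (W \ {v}) (contractInto H {v} a) a S := by
  have hSv : ∀ s ∈ S, s ≠ v := fun s hs h => hvS (h ▸ hs)
  refine ⟨hc.planar.contractInto (connectedOn_singleton H v) hav.ne
    ⟨v, rfl, a, rfl, hav.symm⟩, ?_, ⟨hc.apex_mem, hav.ne⟩,
    fun s hs => ⟨hav.ne, hSv s hs, (hc.adj s hs).ne, Or.inl (hc.adj s hs)⟩,
    fun s hs t ht hst => ⟨hSv s hs, hSv t ht, hst, Or.inl (hc.clique s hs t ht hst)⟩, hc.card⟩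
  rintro u w ⟨hu, -, -, h | ⟨rfl, -⟩ | ⟨-, q, -, hq⟩⟩
  · exact ⟨hc.mem u w h, hu⟩
  · exact ⟨hc.apex_mem, hu⟩
  · exact ⟨hc.mem u q hq.symm, hu⟩

/-- If no two neighbours of `a` separate together with `a`, then a neighbour of `a` has at most
two common neighbours with `a`. -/
lemma not_three_common_nbrs (hc : InnerConfig W H a S)
    (hconn : ∀ x y, x ≠ y → H.Adj a x → H.Adj a y → (W \ {a, x, y}).Nonempty →
      ConnectedOn H (W \ {a, x, y})) {v x y z : V} (hav : H.Adj a v) (hax : H.Adj a x)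
    (hay : H.Adj a y) (haz : H.Adj a z) (hvx : H.Adj v x) (hvy : H.Adj v y) (hvz : H.Adj v z)
    (hxy : x ≠ y) (hxz : x ≠ z) (hyz : y ≠ z) : False := by
  have hmem : ∀ {w}, H.Adj a w → H.Adj v w → w ∈ W \ {a, v} := fun h1 h2 => by
    simp [hc.mem _ _ h1.symm, h1.ne', h2.ne']
  have hR : ∀ {w u}, H.Adj a w → H.Adj v w → H.Adj a u → H.Adj v u → u ≠ w →
      ConnectedOn H ((W \ {a, v}) \ {w}) := by
    intro w u haw hvw hau hvu huw
    have heq : (W \ {a, v}) \ {w} = W \ {a, v, w} := by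
      ext t
      simp only [Set.mem_sdiff, Set.mem_insert_iff, Set.mem_singleton_iff]
      tauto
    rw [heq]
    exact hconn v w hvw.ne hav haw ⟨u, heq ▸ ⟨hmem hau hvu, huw⟩⟩
  exact hc.planar.not_rooted_triple (connectedOn_singleton H v) hav.ne ⟨a, rfl, v, rfl, hav⟩
    hxy hxz hyz hax hay haz ⟨v, rfl, x, rfl, hvx⟩ ⟨v, rfl, y, rfl, hvy⟩ ⟨v, rfl, z, rfl, hvz⟩
    (by simp) (by simp) (hmem hax hvx) (hmem hay hvy) (hmem haz hvz) (hR hax hvx hay hvy hxy.symm)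
    (hR hay hvy hax hvx hxy) (hR haz hvz hax hvx hxz)

/-- If no two neighbours of `a` separate together with `a`, then the neighbours of `a` outside
`S` cannot all have two neighbours of this kind. -/
lemma not_all_two_nbrs [Finite V] (hc : InnerConfig W H a S)
    (hconn : ∀ x y, x ≠ y → H.Adj a x → H.Adj a y → (W \ {a, x, y}).Nonempty →
      ConnectedOn H (W \ {a, x, y})) {k s : V} (hak : H.Adj a k) (hkS : k ∉ S) (hs : s ∈ S)
    (htwo : ∀ v, H.Adj a v → v ∉ S → ∃ x y, x ≠ y ∧ H.Adj a x ∧ x ∉ S ∧ H.Adj a y ∧ y ∉ S ∧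
      H.Adj v x ∧ H.Adj v y ∧ ∀ z, H.Adj a z → H.Adj v z → z = x ∨ z = y) : False := by
  set M : Set V := {v | H.Adj a v ∧ v ∉ S} with hMdef
  set K := compOf H M k with hKdef
  have hkK : k ∈ K := mem_compOf_self H M k
  have hKM : K ⊆ M := compOf_subset (show k ∈ M from ⟨hak, hkS⟩)
  have hdeg : ∀ k ∈ K, ∃ x ∈ K, ∃ y ∈ K, x ≠ y ∧ ∀ v ∈ K, H.Adj k v ↔ v = x ∨ v = y := by
    intro v hv
    obtain ⟨x, y, hxy, hax, hxS, hay, hyS, hvx, hvy, h⟩ := htwo v (hKM hv).1 (hKM hv).2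
    refine ⟨x, compOf_closed hv ⟨hax, hxS⟩ hvx, y, compOf_closed hv ⟨hay, hyS⟩ hvy, hxy,
      fun z hz => ⟨h z (hKM hz).1, ?_⟩⟩
    rintro (rfl | rfl)
    exacts [hvx, hvy]
  have hKconn : ConnectedOn H K := compOf_connectedOn H M k
  have hsR : s ∈ (W \ {a}) \ K :=
    ⟨⟨hc.mem s a (hc.adj s hs).symm, (hc.adj s hs).ne'⟩, fun h => (hKM h).2 hs⟩
  set Q := compOf H ((W \ {a}) \ K) s with hQdef
  have hsQ : s ∈ Q := mem_compOf_self _ _ _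
  have hQs : Q ⊆ (W \ {a}) \ K := compOf_subset hsR
  have third : ∀ x y, ∃ z ∈ K, z ≠ x ∧ z ≠ y := by
    obtain ⟨x, hx, y, hy, hxy, h⟩ := hdeg k hkK
    have hkx := ((h x hx).mpr (Or.inl rfl)).ne
    have hky := ((h y hy).mpr (Or.inr rfl)).ne
    intro p q
    by_cases hk : k = p ∨ k = q
    · by_cases hx' : x = p ∨ x = q
      · exact ⟨y, hy, by rintro rfl; grind only, by rintro rfl; grind only⟩
      · exact ⟨x, hx, by tauto, by tauto⟩
    · exact ⟨k, hkK, by tauto, by tauto⟩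
  have touch : ∀ x ∈ K, ∀ y ∈ K, x ≠ y → ∃ c ∈ K, c ≠ x ∧ c ≠ y ∧ Touch H Q {c} := by
    intro x hx y hy hxy
    have hQR : Q ⊆ W \ {a, x, y} := by
      intro q hq
      have h1 := hQs hq
      have h2 : q ≠ x := fun h => h1.2 (h ▸ hx)
      have h3 : q ≠ y := fun h => h1.2 (h ▸ hy)
      simpa [h2, h3] using h1.1
    obtain ⟨z, hz, hzx, hzy⟩ := third x y
    obtain ⟨u, hu, v, hv, hvQ, huv⟩ :=
      (hconn x y hxy (hKM hx).1 (hKM hy).1 ⟨s, hQR hsQ⟩).exists_adj hQR ⟨s, hsQ⟩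
        (x := z) (by simp [hzx, hzy, (hKM hz).1.ne', hc.mem z a (hKM hz).1.symm])
        (fun h => (hQs h).2 hz)
    have hv' := hv.2
    simp only [Set.mem_insert_iff, Set.mem_singleton_iff, not_or] at hv'
    have hvK : v ∈ K := by
      by_contra hvK
      exact hvQ (compOf_closed hu ⟨⟨hv.1, hv'.1⟩, hvK⟩ huv)
    exact ⟨v, hvK, hv'.2.1, hv'.2.2, u, hu, v, rfl, huv⟩
  obtain ⟨k', hk', hkk', -⟩ := third k k
  obtain ⟨x, hx, -, -, tx⟩ := touch k hkK k' hk' hkk'.symm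
  obtain ⟨x', hx', hxx', -⟩ := third x x
  obtain ⟨y, hy, hyx, -, ty⟩ := touch x hx x' hx' hxx'.symm
  obtain ⟨z, hz, hzx, hzy, tz⟩ := touch x hx y hy hyx.symm
  exact hc.planar.not_rooted_triple (compOf_connectedOn H _ s) (fun h => (hQs h).1.2 rfl)
    ⟨a, rfl, s, hsQ, hc.adj s hs⟩ hyx.symm hzx.symm hzy.symm (hKM hx).1 (hKM hy).1 (hKM hz).1
    tx ty tz (fun h => (hKM h).1.ne rfl) (Set.disjoint_left.mpr fun q hq => (hQs hq).2) hx hy hz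
    (hKconn.diff_singleton hdeg hx) (hKconn.diff_singleton hdeg hy)
    (hKconn.diff_singleton hdeg hz)

/-- If no two neighbours of `a` separate together with `a`, then some neighbour of `a` outside
`S` has few common neighbours with `a`. -/
lemma exists_removable [Finite V] (hc : InnerConfig W H a S)
    (hconn : ∀ x y, x ≠ y → H.Adj a x → H.Adj a y → (W \ {a, x, y}).Nonempty →
      ConnectedOn H (W \ {a, x, y})) (hS : S.Nonempty) {k : V} (hak : H.Adj a k) (hkS : k ∉ S) :
    ∃ v, H.Adj a v ∧ v ∉ S ∧ ((∀ u, H.Adj a u → H.Adj v u → u ∈ S) ∨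
      ∃ w, H.Adj a w ∧ H.Adj v w ∧ w ∉ S ∧ (∀ u, H.Adj a u → H.Adj v u → u ∈ S ∨ u = w) ∧
        {u | u ∈ S ∧ H.Adj v u}.ncard ≤ 1) := by
  by_contra! hno
  obtain ⟨s, hs⟩ := hS
  refine hc.not_all_two_nbrs hconn hak hkS hs fun v hav hvS => ?_
  obtain ⟨⟨x, hax, hvx, hxS⟩, hx⟩ := hno v hav hvS
  have hno3 := fun {x y z : V} => hc.not_three_common_nbrs hconn (x := x) (y := y) (z := z) hav
  obtain ⟨y, hay, hvy, hyS, hyx⟩ : ∃ y, H.Adj a y ∧ H.Adj v y ∧ y ∉ S ∧ y ≠ x := by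
    by_contra! hall
    have hcard := hx x hax hvx hxS fun u hau hvu => by
      by_contra! h
      exact h.2 (hall u hau hvu h.1)
    obtain ⟨p, hp, q, hq, hpq⟩ := (Set.one_lt_ncard (Set.toFinite _)).mp hcard
    exact hno3 (hc.adj p hp.1) (hc.adj q hq.1) hax hp.2 hq.2 hvx hpq (fun h => hxS (h ▸ hp.1))
      (fun h => hxS (h ▸ hq.1))
  refine ⟨x, y, hyx.symm, hax, hxS, hay, hyS, hvx, hvy, fun z haz hvz => ?_⟩
  by_contra! h
  exact hno3 hax hay haz hvx hvy hvz hyx.symm h.1.symm h.2.symm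

variable [Finite V] [LinearOrder V]

lemma hasInnerMonomial_of_removable (hc : InnerConfig W H a S)
    (ih : ∀ W' ⊂ W, InnerClaim W') {v : V} (hav : H.Adj a v) (hvS : v ∉ S)
    (hv : (∀ u, H.Adj a u → H.Adj v u → u ∈ S) ∨
      ∃ w, H.Adj a w ∧ H.Adj v w ∧ w ∉ S ∧ (∀ u, H.Adj a u → H.Adj v u → u ∈ S ∨ u = w) ∧
        {u | u ∈ S ∧ H.Adj v u}.ncard ≤ 1) : HasInnerMonomial H a S := by
  classical
  set H' := contractInto H {v} a with hH'
  set f : V → ℕ := fun u => if u = v then 0 else innerBound H' a S u with hf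
  set U : Set V := {u | H.Adj v u ∧ u ≠ a ∧ ¬ H.Adj a u} with hU
  set D : Set V := {u | u ∈ S ∧ H.Adj v u} with hD
  have hc' := hc.contract_nbr hav hvS
  have h := ih (W \ {v}) ⟨Set.sdiff_subset, fun h => (h (hc.mem v a hav.symm)).2 rfl⟩ _ _ _ hc'
  have havoid : ∀ e ∈ innerEdges H' a S, v ∉ e := by
    rintro ⟨u, w⟩ he hve
    obtain ⟨huw, -⟩ := mk_mem_innerEdges.mp he
    rcases Sym2.mem_iff.mp hve with rfl | rfl
    exacts [huw.1 rfl, huw.2.1 rfl]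
  have h1 : HasMonomialLE (edgeProd (innerEdges H' a S)) f := by
    refine h.of_avoid fun u => ?_
    by_cases hu : u = v
    · exact Or.inr fun e he => hu.symm ▸ havoid e he
    · simp [hf, hu, hH']
  have hfv : f v = 0 := by simp [hf]
  have hvU : v ∉ U := by simp [hU]
  have hvD : v ∉ D := by simp [hD]
  have hfS : ∀ d ∈ S, f d = 0 := fun d hd => by simp [hf, innerBound, hd]
  have hUS : ∀ d ∈ S, d ∉ U := fun d hd h => h.2.2 (hc.adj d hd)
  have hbv : innerBound H a S v = 2 := by simp [innerBound, hav, hvS]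
  have hfU : ∀ u ∈ U, f u ≤ 2 ∧ innerBound H a S u = 4 := by
    intro u hu
    have huS : u ∉ S := fun h => hUS u h hu
    have huv : u ≠ v := hu.1.ne'
    have hadj : H'.Adj a u := ⟨hav.ne, huv, hu.2.1.symm, Or.inr (Or.inl ⟨rfl, v, rfl, hu.1⟩)⟩
    exact ⟨by simp [hf, innerBound, hadj, huv, huS], by simp [innerBound, huS, hu.2.2]⟩
  have hle : ∀ u, f u ≤ innerBound H a S u := by
    intro u
    by_cases huv : u = v
    · simp [huv, hfv]
    by_cases huS : u ∈ S
    · simp [hfS u huS]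
    by_cases hau : H.Adj a u
    · have hadj : H'.Adj a u := ⟨hav.ne, huv, hau.ne, Or.inl hau⟩
      simp [hf, innerBound, huv, huS, hau, hadj]
    · simp only [hf, innerBound, huv, huS, hau, if_false]
      split_ifs <;> simp
  have hedge : ∀ {E : Set (Sym2 V)}, innerEdges H' a S ⊆ E →
      (∀ u, u ≠ a → H.Adj v u → s(u, v) ∈ E) → innerEdges H a S ⊆ E := by
    rintro E hE hEv ⟨u, w⟩ he
    obtain ⟨huw, hau, haw, hS⟩ := mk_mem_innerEdges.mp he
    by_cases hu : u = v
    · have := hEv w haw.symm (hu ▸ huw)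
      rw [← hu, Sym2.eq_swap] at this
      exact this
    by_cases hw : w = v
    · have := hEv u hau.symm (hw ▸ huw.symm)
      rw [← hw] at this
      exact this
    · exact hE (mk_mem_innerEdges.mpr ⟨⟨hu, hw, huw.ne, Or.inl huw⟩, hau, haw, hS⟩)
  have hDcard : D.ncard ≤ 2 :=
    (Set.ncard_le_ncard (fun _ h => h.1) (Set.toFinite S)).trans hc.card
  rcases hv with hv | ⟨w, haw, hvw, -, hv, hD1⟩
  · have h2 := (h1.union_star_of_center hfv U hvU).union_star_of_leaves (v := v) D
      (fun d hd => by simp [hfS d hd.1, hUS d hd.1]) hvD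
    refine (h2.subset (hedge (fun e he => Or.inl (Or.inl he)) fun u hua hvu => ?_)).mono
      fun u => ?_
    · by_cases hau : H.Adj a u
      · exact Or.inr ⟨u, ⟨hv u hau hvu, hvu⟩, rfl⟩
      · exact Or.inl (Or.inr ⟨u, ⟨hvu, hua, hau⟩, rfl⟩)
    · by_cases huv : u = v
      · subst huv
        simpa [hfv, hvU, hbv] using hDcard
      by_cases huU : u ∈ U
      · have := hfU u huU
        simp [huv, huU]
        omega
      · simpa [huv, huU] using hle u
  · have hwU : w ∉ U := fun h => h.2.2 haw
    have h2 := (h1.union_star_insert havoid hfv U hvU hwU hvw.ne').union_star_of_leaves (v := v) D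
      (fun d hd => by simp [hfS d hd.1, hUS d hd.1, hd.2.ne']) hvD
    refine (h2.subset (hedge (fun e he => Or.inl (Or.inl (Or.inl he))) fun u hua hvu => ?_)).mono
      fun u => ?_
    · by_cases hau : H.Adj a u
      · rcases hv u hau hvu with h | rfl
        · exact Or.inr ⟨u, ⟨h, hvu⟩, rfl⟩
        · exact Or.inl (Or.inr rfl)
      · exact Or.inl (Or.inl (Or.inr ⟨u, ⟨hvu, hua, hau⟩, rfl⟩))
    · by_cases huv : u = v
      · subst huv
        simp [hfv, hvU, hbv]
        omega
      by_cases huU : u ∈ U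
      · have := hfU u huU
        simp [huv, huU]
        omega
      · simpa [huv, huU] using hle u

lemma hasInnerMonomial_of_nonempty (hc : InnerConfig W H a S)
    (ih : ∀ W' ⊂ W, InnerClaim W') (hS : S.Nonempty) : HasInnerMonomial H a S := by
  by_contra hno
  obtain ⟨k, hak, hkS⟩ : ∃ k, H.Adj a k ∧ k ∉ S := by
    by_contra! h
    exact hno (hc.hasInnerMonomial_of_nbrs_subset ih h)
  obtain ⟨v, hav, hvS, hv⟩ := hc.exists_removable
    (fun x y hxy hax hay hne =>
      (hc.connectedOn_or_hasInnerMonomial ih hxy hax hay hne).resolve_right hno) hS hak hkS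
  exact hno (hc.hasInnerMonomial_of_removable ih hav hvS hv)

end InnerConfig

lemma innerClaim {V : Type} [Finite V] [LinearOrder V] (W : Set V) : InnerClaim W := by
  induction W using WellFoundedLT.induction with
  | ind W ih =>
    intro H a S hc
    rcases S.eq_empty_or_nonempty with rfl | hS
    · by_cases hN : ∃ v, H.Adj a v
      · obtain ⟨v, hav⟩ := hN
        have hc' : InnerConfig W H a {v} := ⟨hc.planar, hc.mem, hc.apex_mem, by simpa using hav,
          by simp, by simp⟩
        refine ((hc'.hasInnerMonomial_of_nonempty ih ⟨v, rfl⟩).subset ?_).mono fun u => ?_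
        · rintro ⟨x, y⟩ he
          obtain ⟨hxy, hax, hay, -⟩ := mk_mem_innerEdges.mp he
          exact mk_mem_innerEdges.mpr ⟨hxy, hax, hay, fun h => hxy.ne (h.1.trans h.2.symm)⟩
        · by_cases hu : u = v <;> simp [innerBound, hu]
      · push Not at hN
        exact hc.hasInnerMonomial_of_nbrs_subset ih fun v hv => absurd hv (hN v)
    · exact hc.hasInnerMonomial_of_nonempty ih hS

/-- Zhu's theorem: the graph polynomial of every planar graph has a nonvanishing monomial
of degree at most `4` in every variable (so the Alon–Tarsi number of a planar graph is at
most `5`). -/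
theorem stmt1 {V : Type} [Fintype V] [DecidableEq V] [LinearOrder V]
    (G : SimpleGraph V) (hG : G.Planar) :
    ∃ m : V →₀ ℕ,
      MvPolynomial.coeff m (graphPoly G) ≠ 0 ∧ ∀ v : V, m v ≤ 4 := by
  have hprod : graphPoly G = edgeProd G.edgeSet := by
    unfold graphPoly edgeProd
    exact Finset.prod_congr (by ext; simp) fun _ _ => rfl
  rw [hprod]
  rcases isEmpty_or_nonempty V with hV | ⟨⟨a⟩⟩
  · have hE : G.edgeSet = ∅ := by
      rw [Set.eq_empty_iff_forall_notMem]
      rintro ⟨u, -⟩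
      exact hV.elim u
    exact ⟨0, by simp [hE, edgeProd], fun v => hV.elim v⟩
  · have hc : InnerConfig Set.univ G a ∅ := ⟨hG, fun _ _ _ => trivial, trivial, by simp,
      by simp, by simp⟩
    refine ((innerClaim _ _ _ _ hc).apex (g := fun _ => 4) fun _ _ => le_rfl).subset ?_
    rintro ⟨u, v⟩ he
    have huv : G.Adj u v := he
    refine ⟨huv, fun h => huv.ne ?_⟩
    have hu := h u (Sym2.mem_mk_left u v)
    have hv := h v (Sym2.mem_mk_right u v)
    simp only [Set.mem_insert_iff, Set.mem_empty_iff_false, or_false] at hu hv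
    rw [hu, hv]
end
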